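/- Let N ≥ 2, p₀ > 1, α, β ∈ ℝ and ϰ ≥ 0 with α + β > p₀ + ϰ, and let φ₀, ψ₀ be Orlicz functions (convex, vanishing at 0, with φ₀(t)/t → 0 as t → 0 and → ∞ as t → ∞, likewise ψ₀) satisfying c₁ t^{p₀}(log t)^{−β} ≤ φ₀(t) ≤ c₂ t^{p₀}(log t)^{−β} and c₁ t^{p₀}(log t)^{α} ≤ ψ₀(t) ≤ c₂ t^{p₀}(log t)^{α} for all t ≥ T, for some 0 < c₁ ≤ c₂ and T ≥ e. Then there exist a bounded weight a : ℝ^N → [0,∞) with |a(x) − a(y)| ≤ L·(log(1/|x−y|))^{−ϰ} for 0 < |x−y| ≤ 1/2, defining Φ(x,t) = φ₀(t) + a(x)ψ₀(t), a compact Lebesgue-null set S ⊂ Ω, and a bounded function w : Ω → ℝ, smooth on Ω∖S, with weak gradient g ∈ L¹(Ω;ℝ^N) and ∫_Ω Φ(x,|g|) dx < ∞, such that there is no sequence (φ_j) of C^∞ functions on Ω with ∫_Ω Φ(x,|∇φ_j|) dx < ∞ for every j, φ_j → w in L¹(Ω), and ∫_Ω Φ(x, λ|∇φ_j − g|) dx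 → 0 as j → ∞ for every λ > 0. (This is the 0-form non-density statement of Theorem B, new even in the scalar case.) -/

import Mathlib

open MeasureTheory Real Filter
open scoped Topology ENNReal

noncomputable section

/-- `ℝ^N` with the Euclidean structure. -/
abbrev Euc (N : ℕ) := EuclideanSpace ℝ (Fin N)

/-- The open ball of radius `√N` centered at the origin. -/
def Omg (N : ℕ) : Set (Euc N) := Metric.ball 0 (Real.sqrt N)

/-- A smooth function compactly supported in `Ω`. -/
def IsTestFun (N : ℕ) (φ : Euc N → ℝ) : Prop :=
  ContDiff ℝ (⊤ : ℕ∞) φ ∧ HasCompactSupport φ ∧ tsupport φ ⊆ Omg N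

/-- `w` is locally integrable on `Ω` and has weak gradient `g ∈ L¹(Ω;ℝ^N)`. -/
def HasWeakGradOn (N : ℕ) (w : Euc N → ℝ) (g : Euc N → Euc N) : Prop :=
  LocallyIntegrableOn w (Omg N) ∧ IntegrableOn g (Omg N) ∧
  ∀ φ : Euc N → ℝ, IsTestFun N φ → ∀ i : Fin N,
    (∫ x in Omg N, w x * fderiv ℝ φ x (EuclideanSpace.single i 1))
      = - ∫ x in Omg N, g x i * φ x

/-- An Orlicz function: convex on `[0,∞)`, vanishing at `0`, with
`f(t)/t → 0` as `t → 0⁺` and `f(t)/t → ∞` as `t → ∞`. -/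
def IsOrlicz (f : ℝ → ℝ) : Prop :=
  ConvexOn ℝ (Set.Ici 0) f ∧ f 0 = 0 ∧
  Tendsto (fun t => f t / t) (𝓝[>] 0) (𝓝 0) ∧
  Tendsto (fun t => f t / t) atTop atTop

/-- A sequence of counts growing geometrically, with ratio between `ρ₁ > 1` and `ρ₂ < 2`. -/
structure GeomGrowth (ρ₁ ρ₂ : ℝ) (q : ℕ → ℝ) : Prop where
  one_lt : 1 < ρ₁
  lt_two : ρ₂ < 2
  one_le : 1 ≤ q 0
  lower : ∀ n, ρ₁ * q n ≤ q (n + 1)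
  upper : ∀ n, q (n + 1) ≤ ρ₂ * q n

namespace GeomGrowth

variable {ρ₁ ρ₂ r₀ : ℝ} {q : ℕ → ℝ}

lemma one_le_all (h : GeomGrowth ρ₁ ρ₂ q) (n : ℕ) : 1 ≤ q n := by
  induction n with
  | zero => exact h.one_le
  | succ n ih => nlinarith [h.lower n, h.one_lt]

lemma pos (h : GeomGrowth ρ₁ ρ₂ q) (n : ℕ) : 0 < q n := by linarith [h.one_le_all n]

lemma ratio_pos (h : GeomGrowth ρ₁ ρ₂ q) : 0 < ρ₂ := by
  have := h.lower 0; have := h.upper 0; have := h.one_le; have := h.one_lt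
  by_contra hc
  nlinarith

lemma le_pow (h : GeomGrowth ρ₁ ρ₂ q) (n k : ℕ) : q (n + k) ≤ ρ₂ ^ k * q n := by
  induction k with
  | zero => simp
  | succ k ih =>
    calc q (n + (k + 1)) ≤ ρ₂ * q (n + k) := h.upper (n + k)
      _ ≤ ρ₂ * (ρ₂ ^ k * q n) := by gcongr; exact h.ratio_pos.le
      _ = _ := by ring

lemma sum_le (h : GeomGrowth ρ₁ ρ₂ q) (n : ℕ) :
    ∑ j ∈ Finset.range (n + 1), q j ≤ ρ₁ / (ρ₁ - 1) * q n := by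
  have h1 : 0 < ρ₁ - 1 := by linarith [h.one_lt]
  induction n with
  | zero =>
    simp only [zero_add, Finset.sum_range_one]
    have : 1 ≤ ρ₁ / (ρ₁ - 1) := by rw [le_div_iff₀ h1]; linarith
    nlinarith [h.one_le]
  | succ n ih =>
    rw [Finset.sum_range_succ]
    have h2 : ρ₁ / (ρ₁ - 1) * q n ≤ 1 / (ρ₁ - 1) * q (n + 1) := by
      rw [div_mul_eq_mul_div, div_mul_eq_mul_div]
      have := h.lower n
      have := h.pos n
      apply div_le_div_of_nonneg_right _ h1.le
      linarith
    have h3 : ρ₁ / (ρ₁ - 1) = 1 / (ρ₁ - 1) + 1 := by field_simp; ring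
    rw [h3, add_mul, one_mul]
    linarith

/-- The increasing jump function whose range is a Cantor type set. -/
def jumpFun (r₀ : ℝ) (q : ℕ → ℝ) (s : ℝ) : ℝ := ∑' n, r₀ / 2 ^ n * (⌊q n * s⌋ : ℝ)

lemma summable_scale (r₀ : ℝ) : Summable (fun n : ℕ => r₀ / 2 ^ n) := by
  simpa [div_eq_mul_inv] using
    (summable_geometric_of_lt_one (r := (1 / 2 : ℝ)) (by norm_num) (by norm_num)).mul_left r₀

lemma tail_term_le (h : GeomGrowth ρ₁ ρ₂ q) (hr : 0 < r₀) (n k : ℕ) :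
    r₀ / 2 ^ (n + k) * q (n + k) ≤ (r₀ / 2 ^ n * q n) * (ρ₂ / 2) ^ k := by
  calc r₀ / 2 ^ (n + k) * q (n + k) ≤ r₀ / 2 ^ (n + k) * (ρ₂ ^ k * q n) := by
        gcongr; exact h.le_pow n k
    _ = _ := by rw [pow_add, div_pow]; field_simp

lemma summable_weight (h : GeomGrowth ρ₁ ρ₂ q) (hr : 0 < r₀) :
    Summable (fun n => r₀ / 2 ^ n * q n) := by
  refine Summable.of_nonneg_of_le (fun n => ?_) (fun n => ?_)
    ((summable_geometric_of_lt_one (r := ρ₂ / 2) (by linarith [h.ratio_pos])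
      (by linarith [h.lt_two])).mul_left (r₀ * q 0))
  · have := h.pos n; positivity
  · simpa using h.tail_term_le hr 0 n

lemma abs_floor_le (x : ℝ) : |(⌊x⌋ : ℝ)| ≤ |x| + 1 := by
  have h1 := Int.floor_le x
  have h2 := Int.lt_floor_add_one x
  rw [abs_le]
  constructor <;> cases abs_cases x <;> linarith

lemma summable_jump (h : GeomGrowth ρ₁ ρ₂ q) (hr : 0 < r₀) (s : ℝ) :
    Summable (fun n => r₀ / 2 ^ n * (⌊q n * s⌋ : ℝ)) := by
  refine Summable.of_norm_bounded (g := fun n => |s| * (r₀ / 2 ^ n * q n) + r₀ / 2 ^ n)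
    (((h.summable_weight hr).mul_left _).add (summable_scale r₀)) (fun n => ?_)
  have hq := h.pos n
  rw [norm_mul, Real.norm_eq_abs, Real.norm_eq_abs, abs_of_pos (by positivity)]
  calc r₀ / 2 ^ n * |(⌊q n * s⌋ : ℝ)| ≤ r₀ / 2 ^ n * (|q n * s| + 1) := by
        gcongr; exact abs_floor_le _
    _ = _ := by rw [abs_mul, abs_of_pos hq]; ring

lemma jump_sub_hasSum (h : GeomGrowth ρ₁ ρ₂ q) (hr : 0 < r₀) (s t : ℝ) :
    HasSum (fun n => r₀ / 2 ^ n * ((⌊q n * t⌋ : ℝ) - ⌊q n * s⌋))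
      (jumpFun r₀ q t - jumpFun r₀ q s) := by
  simp only [mul_sub]
  exact (h.summable_jump hr t).hasSum.sub (h.summable_jump hr s).hasSum

lemma floor_sub_nonneg (h : GeomGrowth ρ₁ ρ₂ q) {s t : ℝ} (hst : s ≤ t) (n : ℕ) :
    0 ≤ (⌊q n * t⌋ : ℝ) - ⌊q n * s⌋ := by
  have : ⌊q n * s⌋ ≤ ⌊q n * t⌋ := by
    apply Int.floor_mono
    have := h.pos n
    gcongr
  rw [sub_nonneg]; exact_mod_cast this

lemma jump_mono (h : GeomGrowth ρ₁ ρ₂ q) (hr : 0 < r₀) : Monotone (jumpFun r₀ q) := by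
  intro s t hst
  rw [← sub_nonneg, ← (h.jump_sub_hasSum hr s t).tsum_eq]
  exact tsum_nonneg (fun n => mul_nonneg (by positivity) (h.floor_sub_nonneg hst n))

lemma le_jump_sub_of_floor_lt (h : GeomGrowth ρ₁ ρ₂ q) (hr : 0 < r₀) {s t : ℝ} (hst : s ≤ t)
    (n : ℕ) (hn : ⌊q n * s⌋ < ⌊q n * t⌋) :
    r₀ / 2 ^ n ≤ jumpFun r₀ q t - jumpFun r₀ q s := by
  have h1 := le_hasSum (h.jump_sub_hasSum hr s t) n
    (fun j _ => mul_nonneg (by positivity) (h.floor_sub_nonneg hst j))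
  refine le_trans ?_ h1
  have : (⌊q n * s⌋ : ℝ) + 1 ≤ ⌊q n * t⌋ := by exact_mod_cast hn
  have h2 : (0 : ℝ) < r₀ / 2 ^ n := by positivity
  nlinarith

lemma le_jump_sub (h : GeomGrowth ρ₁ ρ₂ q) (hr : 0 < r₀) {s t : ℝ} (n : ℕ)
    (hst : 1 / q n ≤ t - s) : r₀ / 2 ^ n ≤ jumpFun r₀ q t - jumpFun r₀ q s := by
  have hq := h.pos n
  have h0 : s ≤ t := by
    have : 0 < 1 / q n := by positivity
    linarith
  apply h.le_jump_sub_of_floor_lt hr h0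
  rw [div_le_iff₀ hq] at hst
  have : ⌊q n * s⌋ + 1 ≤ ⌊q n * t⌋ := by
    rw [← Int.floor_add_one]
    apply Int.floor_mono
    linarith
  omega

lemma sub_lt_of_floor_eq (h : GeomGrowth ρ₁ ρ₂ q) {s t : ℝ} (n : ℕ)
    (hst : ⌊q n * s⌋ = ⌊q n * t⌋) : t - s < 1 / q n := by
  rw [lt_div_iff₀ (h.pos n)]
  have h1 := Int.floor_le (q n * s)
  have h2 := Int.lt_floor_add_one (q n * t)
  rw [← hst] at h2
  linarith

lemma floor_sub_le (q : ℕ → ℝ) (s t : ℝ) (n : ℕ) :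
    (⌊q n * t⌋ : ℝ) - ⌊q n * s⌋ ≤ q n * (t - s) + 1 := by
  have h1 := Int.lt_floor_add_one (q n * s)
  have h2 := Int.floor_le (q n * t)
  linarith

/-- The constant bounding the oscillation of the jump function on cells. -/
def cellConst (ρ₂ : ℝ) : ℝ := 2 / (2 - ρ₂) + 2

lemma jump_sub_le (h : GeomGrowth ρ₁ ρ₂ q) (hr : 0 < r₀) {s t : ℝ} (n : ℕ)
    (hlen : t - s ≤ 1 / q n) (heq : ∀ j < n, ⌊q j * s⌋ = ⌊q j * t⌋) :
    jumpFun r₀ q t - jumpFun r₀ q s ≤ cellConst ρ₂ * (r₀ / 2 ^ n) := by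
  have hs := h.jump_sub_hasSum hr s t
  rw [← hs.tsum_eq, ← hs.summable.sum_add_tsum_nat_add n]
  have h0 : ∑ j ∈ Finset.range n, r₀ / 2 ^ j * ((⌊q j * t⌋ : ℝ) - ⌊q j * s⌋) = 0 := by
    apply Finset.sum_eq_zero
    intro j hj
    rw [heq j (Finset.mem_range.1 hj)]; simp
  rw [h0, zero_add]
  have hρ : 0 ≤ ρ₂ / 2 := by linarith [h.ratio_pos]
  have hρ1 : ρ₂ / 2 < 1 := by linarith [h.lt_two]
  have hb : HasSum (fun k => r₀ / 2 ^ n * (ρ₂ / 2) ^ k + r₀ / 2 ^ n * (1 / 2) ^ k)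
      (cellConst ρ₂ * (r₀ / 2 ^ n)) := by
    have e1 := ((hasSum_geometric_of_lt_one hρ hρ1).mul_left (r₀ / 2 ^ n)).add
      ((hasSum_geometric_of_lt_one (r := (1 / 2 : ℝ)) (by norm_num) (by norm_num)).mul_left
        (r₀ / 2 ^ n))
    have h2 : 2 - ρ₂ ≠ 0 := by linarith [h.lt_two]
    have h3 : 1 - ρ₂ / 2 ≠ 0 := by linarith [h.lt_two]
    have h4 : cellConst ρ₂ * (r₀ / 2 ^ n) =
        r₀ / 2 ^ n * (1 - ρ₂ / 2)⁻¹ + r₀ / 2 ^ n * (1 - 1 / 2)⁻¹ := by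
      have : (1 - ρ₂ / 2)⁻¹ = 2 / (2 - ρ₂) := by field_simp
      rw [this, cellConst]; norm_num; ring
    rw [h4]; exact e1
  rw [← hb.tsum_eq]
  refine Summable.tsum_le_tsum (fun k => ?_) ((summable_nat_add_iff n).2 hs.summable) hb.summable
  rw [add_comm k n]
  calc r₀ / 2 ^ (n + k) * ((⌊q (n + k) * t⌋ : ℝ) - ⌊q (n + k) * s⌋)
      ≤ r₀ / 2 ^ (n + k) * (q (n + k) * (1 / q n) + 1) := by
        gcongr
        refine (floor_sub_le q s t (n + k)).trans ?_
        have := h.pos (n + k)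
        gcongr
    _ = (r₀ / 2 ^ (n + k) * q (n + k)) * (1 / q n) + r₀ / 2 ^ (n + k) := by ring
    _ ≤ (r₀ / 2 ^ n * q n) * (ρ₂ / 2) ^ k * (1 / q n) + r₀ / 2 ^ (n + k) := by
        have h5 := h.pos n
        have h6 := h.tail_term_le hr n k
        gcongr
    _ = _ := by
        have := h.pos n
        rw [pow_add, one_div_pow]
        field_simp

end GeomGrowth

/-- A closed Lebesgue-null set `C ⊆ ℝ` together with a devil's staircase `F` on a bounded part of
it; at scale `r₀ / 2 ^ n` the set consists of about `q n` pieces. -/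
structure CantorPair (r₀ : ℝ) (q : ℕ → ℝ) where
  C : Set ℝ
  F : ℝ → ℝ
  Y : ℝ
  closed : IsClosed C
  zero_mem : (0 : ℝ) ∈ C
  exists_gt : ∀ x, ∃ c ∈ C, x < c
  exists_lt : ∀ x, ∃ c ∈ C, c < x
  null : volume C = 0
  mono : Monotone F
  osc : ∀ n y y', |y - y'| ≤ r₀ / 2 ^ n → |F y - F y'| ≤ 1 / q n
  osc_zero : ∀ y y', |F y - F y'| ≤ 1 / q 0
  const : ∀ y y', y ≤ y' → Set.Icc y y' ∩ C = ∅ → F y = F y'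
  F_left : ∀ y < 0, F y = 0
  F_right : ∀ y, Y ≤ y → F y = 1 / q 0
  Y_nonneg : 0 ≤ Y
  Y_le : Y ≤ 1 / 16
  gap_left : Set.Ioo (-r₀) 0 ∩ C = ∅
  gap_right : Set.Ioo Y (Y + r₀) ∩ C = ∅
  vol : ∀ X, 0 < X → ∃ K, 0 < K ∧ ∀ n,
    volume {y | |y| ≤ X ∧ Metric.infDist y C ≤ 4 * (r₀ / 2 ^ n)} ≤
      ENNReal.ofReal (K * (q n * (r₀ / 2 ^ n)))

namespace GeomGrowth

variable {ρ₁ ρ₂ r₀ : ℝ} {q : ℕ → ℝ}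

lemma jump_zero : jumpFun r₀ q 0 = 0 := by simp [jumpFun]

lemma le_jump (h : GeomGrowth ρ₁ ρ₂ q) (hr : 0 < r₀) {s : ℝ} (hs : 0 ≤ s) :
    r₀ * (q 0 * s - 1) ≤ jumpFun r₀ q s := by
  have h1 := le_hasSum (h.jump_sub_hasSum hr 0 s) 0
    (fun j _ => mul_nonneg (by positivity) (h.floor_sub_nonneg hs j))
  simp only [jump_zero, mul_zero, Int.floor_zero, pow_zero, div_one, sub_zero, Int.cast_zero] at h1
  refine le_trans ?_ h1
  gcongr
  linarith [Int.lt_floor_add_one (q 0 * s)]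

lemma jump_le (h : GeomGrowth ρ₁ ρ₂ q) (hr : 0 < r₀) {s : ℝ} (hs : s ≤ 0) :
    jumpFun r₀ q s ≤ r₀ * (q 0 * s) := by
  have h1 := le_hasSum (h.jump_sub_hasSum hr s 0) 0
    (fun j _ => mul_nonneg (by positivity) (h.floor_sub_nonneg hs j))
  simp only [jump_zero, mul_zero, Int.floor_zero, pow_zero, div_one, Int.cast_zero] at h1
  have : r₀ * (⌊q 0 * s⌋ : ℝ) ≤ r₀ * (q 0 * s) := by
    gcongr; exact Int.floor_le _
  linarith

lemma abs_le_of_jump (h : GeomGrowth ρ₁ ρ₂ q) (hr : 0 < r₀) {s X : ℝ}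
    (hs : |jumpFun r₀ q s| ≤ X) : |s| ≤ X / r₀ + 1 := by
  have hq := h.one_le
  obtain ⟨h1, h2⟩ := abs_le.1 hs
  have hX : 0 ≤ X := (abs_nonneg _).trans hs
  rcases le_total 0 s with h0 | h0
  · have h3 := h.le_jump hr h0
    have h4 : q 0 * s - 1 ≤ X / r₀ := by
      rw [le_div_iff₀ hr]; linarith
    rw [abs_of_nonneg h0]
    nlinarith
  · have h3 := h.jump_le hr h0
    have h4 : -(q 0 * s) ≤ X / r₀ := by
      rw [le_div_iff₀ hr]; linarith
    rw [abs_of_nonpos h0]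
    nlinarith

/-- The number of jumps, counted up to generation `n`. -/
def jumpCount (q : ℕ → ℝ) (n : ℕ) (s : ℝ) : ℤ := ∑ j ∈ Finset.range (n + 1), ⌊q j * s⌋

lemma floor_le_floor (h : GeomGrowth ρ₁ ρ₂ q) {s t : ℝ} (hst : s ≤ t) (n : ℕ) :
    ⌊q n * s⌋ ≤ ⌊q n * t⌋ := by
  have := h.floor_sub_nonneg hst n
  rw [sub_nonneg] at this
  exact_mod_cast this

lemma jumpCount_mono (h : GeomGrowth ρ₁ ρ₂ q) (n : ℕ) : Monotone (jumpCount q n) :=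
  fun _ _ hst => Finset.sum_le_sum fun j _ => h.floor_le_floor hst j

lemma jump_sub_le_of_count (h : GeomGrowth ρ₁ ρ₂ q) (hr : 0 < r₀) {s t : ℝ} (n : ℕ)
    (heq : jumpCount q n s = jumpCount q n t) :
    |jumpFun r₀ q t - jumpFun r₀ q s| ≤ cellConst ρ₂ * (r₀ / 2 ^ n) := by
  wlog hst : s ≤ t generalizing s t
  · rw [abs_sub_comm]; exact this heq.symm (le_of_not_ge hst)
  rw [abs_of_nonneg (sub_nonneg.2 (h.jump_mono hr hst))]
  have h1 := (Finset.sum_eq_sum_iff_of_le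
    (fun j (_ : j ∈ Finset.range (n + 1)) => h.floor_le_floor hst j)).1 heq
  refine h.jump_sub_le hr n (h.sub_lt_of_floor_eq n (h1 n (by simp))).le (fun j hj => h1 j ?_)
  simp; omega

lemma cellConst_pos (h : GeomGrowth ρ₁ ρ₂ q) : 0 < cellConst ρ₂ := by
  have : 0 < 2 - ρ₂ := by linarith [h.lt_two]
  rw [cellConst]; positivity

lemma count_sub_le (h : GeomGrowth ρ₁ ρ₂ q) {R : ℝ} (hR : 0 < R) (n : ℕ) :
    ((jumpCount q n R + 1 - jumpCount q n (-R) : ℤ) : ℝ)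
      ≤ (2 * R + 2) * (ρ₁ / (ρ₁ - 1)) * q n := by
  have e : ((jumpCount q n R + 1 - jumpCount q n (-R) : ℤ) : ℝ) =
      ∑ j ∈ Finset.range (n + 1), ((⌊q j * R⌋ : ℝ) - ⌊q j * (-R)⌋) + 1 := by
    rw [Finset.sum_sub_distrib]
    simp only [jumpCount]
    push_cast
    ring
  rw [e, mul_assoc]
  have h1 := h.sum_le n
  have h3 : q 0 ≤ ∑ j ∈ Finset.range (n + 1), q j :=
    Finset.single_le_sum (f := q) (fun j _ => (h.pos j).le) (by simp)
  have h2 : ∑ j ∈ Finset.range (n + 1), ((⌊q j * R⌋ : ℝ) - ⌊q j * (-R)⌋) ≤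
      (2 * R + 1) * ∑ j ∈ Finset.range (n + 1), q j := by
    rw [Finset.mul_sum]
    apply Finset.sum_le_sum
    intro j _
    have := floor_sub_le q (-R) R j
    nlinarith [h.one_le_all j]
  nlinarith [h.one_le]

lemma volume_neighborhood (h : GeomGrowth ρ₁ ρ₂ q) (hr : 0 < r₀) {X : ℝ} (hX : 0 < X) :
    ∃ K, 0 < K ∧ ∀ n,
    volume {y | |y| ≤ X ∧ Metric.infDist y (closure (Set.range (jumpFun r₀ q)))
        ≤ 4 * (r₀ / 2 ^ n)} ≤ ENNReal.ofReal (K * (q n * (r₀ / 2 ^ n))) := by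
  set R := (X + 5 * r₀) / r₀ + 1 with hRdef
  have hR : 0 < R := by positivity
  have hκ := h.cellConst_pos
  have hρ : 0 < ρ₁ / (ρ₁ - 1) := by
    have := h.one_lt
    apply div_pos <;> linarith
  refine ⟨(2 * R + 2) * (ρ₁ / (ρ₁ - 1)) * (2 * (cellConst ρ₂ + 5)), by positivity, fun n => ?_⟩
  set rn := r₀ / 2 ^ n with hrn
  have hrn0 : 0 < rn := by positivity
  have hrn1 : rn ≤ r₀ := div_le_self hr.le (one_le_pow₀ (by norm_num))
  classical
  let pick : ℤ → ℝ := fun m => if hm : ∃ s, jumpCount q n s = m then hm.choose else 0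
  set I := Finset.Icc (jumpCount q n (-R)) (jumpCount q n R) with hI
  have hsub : {y | |y| ≤ X ∧ Metric.infDist y (closure (Set.range (jumpFun r₀ q))) ≤ 4 * rn} ⊆
      ⋃ m ∈ I, Metric.closedBall (jumpFun r₀ q (pick m)) ((cellConst ρ₂ + 5) * rn) := by
    rintro y ⟨hy, hd⟩
    rw [Metric.infDist_closure] at hd
    have hd' : Metric.infDist y (Set.range (jumpFun r₀ q)) < 5 * rn := by linarith
    rw [Metric.infDist_lt_iff (Set.range_nonempty _)] at hd'
    obtain ⟨_, ⟨s, rfl⟩, hs⟩ := hd'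
    rw [Real.dist_eq] at hs
    have hs1 : |jumpFun r₀ q s| ≤ X + 5 * r₀ := by
      have := abs_sub_abs_le_abs_sub (jumpFun r₀ q s) y
      rw [abs_sub_comm] at this
      linarith
    have hs2 := abs_le.1 (h.abs_le_of_jump hr hs1)
    have hm : ∃ s', jumpCount q n s' = jumpCount q n s := ⟨s, rfl⟩
    refine Set.mem_iUnion₂.2 ⟨jumpCount q n s, ?_, ?_⟩
    · rw [hI, Finset.mem_Icc]
      exact ⟨h.jumpCount_mono n (by linarith), h.jumpCount_mono n (by linarith)⟩
    · have hp : pick (jumpCount q n s) = hm.choose := dif_pos hm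
      have h5 := h.jump_sub_le_of_count hr n hm.choose_spec
      rw [Metric.mem_closedBall, Real.dist_eq, hp]
      calc |y - jumpFun r₀ q hm.choose|
          ≤ |y - jumpFun r₀ q s| + |jumpFun r₀ q s - jumpFun r₀ q hm.choose| :=
            abs_sub_le _ _ _
        _ ≤ 5 * rn + cellConst ρ₂ * rn := add_le_add hs.le h5
        _ = _ := by ring
  refine (measure_mono hsub).trans ((measure_biUnion_finset_le _ _).trans ?_)
  simp only [Real.volume_closedBall, Finset.sum_const, nsmul_eq_mul]
  have hcard : (I.card : ℝ) ≤ (2 * R + 2) * (ρ₁ / (ρ₁ - 1)) * q n := by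
    refine le_trans (le_of_eq ?_) (h.count_sub_le hR n)
    rw [hI, Int.card_Icc]
    have : (0 : ℤ) ≤ jumpCount q n R + 1 - jumpCount q n (-R) := by
      have := h.jumpCount_mono n (show -R ≤ R by linarith)
      omega
    rw [← Int.cast_natCast, Int.toNat_of_nonneg this]
  rw [← ENNReal.ofReal_natCast, ← ENNReal.ofReal_mul (by positivity)]
  apply ENNReal.ofReal_le_ofReal
  calc (I.card : ℝ) * (2 * ((cellConst ρ₂ + 5) * rn))
      ≤ ((2 * R + 2) * (ρ₁ / (ρ₁ - 1)) * q n) * (2 * ((cellConst ρ₂ + 5) * rn)) := by gcongr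
    _ = _ := by ring

lemma null_closure_range (h : GeomGrowth ρ₁ ρ₂ q) (hr : 0 < r₀) :
    volume (closure (Set.range (jumpFun r₀ q))) = 0 := by
  set C := closure (Set.range (jumpFun r₀ q))
  have hcov : C ⊆ ⋃ k : ℕ, {y | |y| ≤ (k : ℝ) + 1 ∧ y ∈ C} := by
    intro y hy
    obtain ⟨k, hk⟩ := exists_nat_ge |y|
    exact Set.mem_iUnion.2 ⟨k, by linarith, hy⟩
  refine measure_mono_null hcov (measure_iUnion_null fun k => ?_)
  obtain ⟨K, _, hK⟩ := h.volume_neighborhood hr (X := (k : ℝ) + 1) (by positivity)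
  have ht : Tendsto (fun n => ENNReal.ofReal (K * (q n * (r₀ / 2 ^ n)))) atTop (𝓝 0) := by
    rw [← ENNReal.ofReal_zero]
    apply ENNReal.tendsto_ofReal
    have := (h.summable_weight hr).tendsto_atTop_zero.const_mul K
    simpa [mul_comm, mul_left_comm] using this
  refine le_antisymm (ge_of_tendsto' ht fun n => (measure_mono ?_).trans (hK n)) zero_le
  rintro y ⟨hy, hyC⟩
  refine ⟨hy, ?_⟩
  rw [Metric.infDist_zero_of_mem hyC]
  positivity

/-- The staircase: the normalized measure of the parameters mapped below `y`. -/
def stair (r₀ : ℝ) (q : ℕ → ℝ) (y : ℝ) : ℝ :=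
  volume.real {s | s ∈ Set.Ico 0 (1 / q 0) ∧ jumpFun r₀ q s ≤ y}

lemma stair_finite (r₀ : ℝ) (q : ℕ → ℝ) (y : ℝ) :
    volume {s | s ∈ Set.Ico 0 (1 / q 0) ∧ jumpFun r₀ q s ≤ y} ≠ ⊤ :=
  ((measure_mono (fun _ hs => hs.1)).trans_lt
    (measure_Ico_lt_top (a := (0 : ℝ)) (b := 1 / q 0))).ne

lemma stair_mono (r₀ : ℝ) (q : ℕ → ℝ) : Monotone (stair r₀ q) := fun _ y' hy =>
  measureReal_mono (fun _ hs => ⟨hs.1, hs.2.trans hy⟩) (stair_finite r₀ q y')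

lemma stair_le (h : GeomGrowth ρ₁ ρ₂ q) (y : ℝ) : stair r₀ q y ≤ 1 / q 0 := by
  have h1 : stair r₀ q y ≤ volume.real (Set.Ico 0 (1 / q 0)) :=
    measureReal_mono (fun _ hs => hs.1) measure_Ico_lt_top.ne
  have := h.pos 0
  rwa [Real.volume_real_Ico_of_le (by positivity), sub_zero] at h1

lemma stair_osc (h : GeomGrowth ρ₁ ρ₂ q) (hr : 0 < r₀) (n : ℕ) (y y' : ℝ)
    (hy : |y - y'| ≤ r₀ / 2 ^ n) : |stair r₀ q y - stair r₀ q y'| ≤ 1 / q n := by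
  wlog hle : y' ≤ y generalizing y y'
  · rw [abs_sub_comm]; exact this y' y (by rwa [abs_sub_comm]) (le_of_not_ge hle)
  have hq := h.pos n
  rw [abs_of_nonneg (sub_nonneg.2 (stair_mono r₀ q hle))]
  rw [abs_of_nonneg (sub_nonneg.2 hle)] at hy
  set D := {s | jumpFun r₀ q s ∈ Set.Ioc y' y} with hD
  have hsub : {s | s ∈ Set.Ico 0 (1 / q 0) ∧ jumpFun r₀ q s ≤ y} ⊆
      {s | s ∈ Set.Ico 0 (1 / q 0) ∧ jumpFun r₀ q s ≤ y'} ∪ D := by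
    rintro s ⟨h1, h2⟩
    by_cases h3 : jumpFun r₀ q s ≤ y'
    · exact Or.inl ⟨h1, h3⟩
    · exact Or.inr ⟨not_le.1 h3, h2⟩
  have hdiam : volume D ≤ ENNReal.ofReal (1 / q n) := by
    refine (Real.volume_le_diam D).trans (Metric.ediam_le fun s hs t ht => ?_)
    rw [edist_dist]
    apply ENNReal.ofReal_le_ofReal
    by_contra hc
    rw [Real.dist_eq] at hc
    wlog hst : s ≤ t generalizing s t
    · exact this t ht s hs (by rwa [abs_sub_comm]) (le_of_not_ge hst)
    rw [abs_sub_comm, abs_of_nonneg (sub_nonneg.2 hst), not_le] at hc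
    have h1 := h.le_jump_sub hr n hc.le
    have h2 := hs.1
    have h3 := ht.2
    linarith
  have hDr : volume.real D ≤ 1 / q n :=
    ENNReal.toReal_le_of_le_ofReal (by positivity) hdiam
  have h1 : stair r₀ q y ≤ stair r₀ q y' + volume.real D :=
    (measureReal_mono hsub (measure_union_lt_top (stair_finite r₀ q y').lt_top
      (hdiam.trans_lt ENNReal.ofReal_lt_top)).ne).trans (measureReal_union_le _ _)
  linarith

/-- The Cantor set and staircase with prescribed numbers of pieces. -/
def cantorPair (h : GeomGrowth ρ₁ ρ₂ q) (hr : 0 < r₀) (hsmall : cellConst ρ₂ * r₀ ≤ 1 / 16) :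
    CantorPair r₀ q :=
  have hq := h.pos 0
  have hfl : ∀ s < 1 / q 0, jumpFun r₀ q s ≤ jumpFun r₀ q (1 / q 0) - r₀ := fun s hs => by
    have : ⌊q 0 * s⌋ < ⌊q 0 * (1 / q 0)⌋ := by
      rw [mul_one_div_cancel hq.ne', Int.floor_one, Int.floor_lt]
      rw [lt_div_iff₀ hq] at hs
      push_cast; linarith
    have := h.le_jump_sub_of_floor_lt hr hs.le 0 this
    simp only [pow_zero, div_one] at this
    linarith
  { C := closure (Set.range (jumpFun r₀ q))
    F := stair r₀ q
    Y := jumpFun r₀ q (1 / q 0) - r₀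
    closed := isClosed_closure
    zero_mem := subset_closure ⟨0, jump_zero⟩
    exists_gt := fun x => by
      refine ⟨_, subset_closure ⟨|x| / r₀ + 2, rfl⟩, ?_⟩
      have h0 : 0 ≤ |x| / r₀ := by positivity
      refine lt_of_lt_of_le ?_ (h.le_jump hr (by positivity))
      have h1 := h.one_le
      have h2 : |x| / r₀ + 2 ≤ q 0 * (|x| / r₀ + 2) := by nlinarith
      calc x ≤ |x| := le_abs_self x
        _ = r₀ * (|x| / r₀) := by field_simp
        _ < _ := by gcongr; linarith
    exists_lt := fun x => by
      refine ⟨_, subset_closure ⟨-(|x| / r₀ + 2), rfl⟩, ?_⟩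
      have h0 : 0 ≤ |x| / r₀ := by positivity
      refine lt_of_le_of_lt (h.jump_le hr (by linarith)) ?_
      have h1 := h.one_le
      have h2 : |x| / r₀ + 2 ≤ q 0 * (|x| / r₀ + 2) := by nlinarith
      calc r₀ * (q 0 * -(|x| / r₀ + 2)) < r₀ * (-(|x| / r₀)) := by gcongr; linarith
        _ = -|x| := by field_simp
        _ ≤ x := neg_abs_le x
    null := h.null_closure_range hr
    mono := stair_mono r₀ q
    osc := h.stair_osc hr
    osc_zero := fun y y' => by
      have h1 := h.stair_le (r₀ := r₀) y
      have h2 := h.stair_le (r₀ := r₀) y'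
      have h3 : 0 ≤ stair r₀ q y := measureReal_nonneg
      have h4 : 0 ≤ stair r₀ q y' := measureReal_nonneg
      rw [abs_le]; constructor <;> linarith
    const := fun y y' hy hC => by
      unfold stair
      congr 1
      ext s
      simp only [Set.mem_ofPred_eq, and_congr_right_iff]
      refine fun _ => ⟨fun h1 => h1.trans hy, fun h1 => ?_⟩
      by_contra h2
      exact (Set.eq_empty_iff_forall_notMem.1 hC) (jumpFun r₀ q s)
        ⟨⟨(not_le.1 h2).le, h1⟩, subset_closure ⟨s, rfl⟩⟩
    F_left := fun y hy => by
      have : {s | s ∈ Set.Ico 0 (1 / q 0) ∧ jumpFun r₀ q s ≤ y} = ∅ := by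
        ext s
        simp only [Set.mem_ofPred_eq, Set.mem_empty_iff_false, iff_false]
        rintro ⟨h1, h2⟩
        have := h.jump_mono hr h1.1
        rw [jump_zero] at this
        linarith
      rw [stair, this]; simp
    F_right := fun y hy => by
      have : {s | s ∈ Set.Ico 0 (1 / q 0) ∧ jumpFun r₀ q s ≤ y} = Set.Ico 0 (1 / q 0) := by
        ext s
        simp only [Set.mem_ofPred_eq, and_iff_left_iff_imp]
        intro h1
        exact (hfl s h1.2).trans hy
      rw [stair, this, Real.volume_real_Ico_of_le (by positivity), sub_zero]
    Y_nonneg := by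
      have := hfl 0 (by positivity)
      rwa [jump_zero] at this
    Y_le := by
      have h1 := h.jump_sub_le hr (s := 0) (t := 1 / q 0) 0 (by simp) (by simp)
      rw [jump_zero, pow_zero, div_one] at h1
      linarith
    gap_left := by
      have : closure (Set.range (jumpFun r₀ q)) ⊆ (Set.Ioo (-r₀) 0)ᶜ := by
        refine closure_minimal ?_ isOpen_Ioo.isClosed_compl
        rintro _ ⟨s, rfl⟩ ⟨h1, h2⟩
        rcases le_or_gt 0 s with hs | hs
        · have := h.jump_mono hr hs
          rw [jump_zero] at this
          linarith
        · have h3 : ⌊q 0 * s⌋ < ⌊q 0 * 0⌋ := by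
            rw [mul_zero, Int.floor_zero, Int.floor_lt]
            push_cast; nlinarith
          have := h.le_jump_sub_of_floor_lt hr hs.le 0 h3
          rw [jump_zero, pow_zero, div_one] at this
          linarith
      ext y
      simp only [Set.mem_inter_iff, Set.mem_empty_iff_false, iff_false, not_and]
      exact fun h1 h2 => this h2 h1
    gap_right := by
      have : closure (Set.range (jumpFun r₀ q)) ⊆
          (Set.Ioo (jumpFun r₀ q (1 / q 0) - r₀) (jumpFun r₀ q (1 / q 0) - r₀ + r₀))ᶜ := by
        refine closure_minimal ?_ isOpen_Ioo.isClosed_compl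
        rintro _ ⟨s, rfl⟩ ⟨h1, h2⟩
        rcases lt_or_ge s (1 / q 0) with hs | hs
        · linarith [hfl s hs]
        · have := h.jump_mono hr hs
          linarith
      ext y
      simp only [Set.mem_inter_iff, Set.mem_empty_iff_false, iff_false, not_and]
      exact fun h1 h2 => this h2 h1
    vol := fun X hX => h.volume_neighborhood hr hX }

end GeomGrowth

/-- A closed subset of the line that is unbounded in both directions. -/
structure IsClosedUnbdd (C : Set ℝ) : Prop where
  closed : IsClosed C
  exists_gt : ∀ x, ∃ c ∈ C, x < c
  exists_lt : ∀ x, ∃ c ∈ C, c < x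

/-- The left end of the gap of `C` around `x`. -/
def gapLeft (C : Set ℝ) (x : ℝ) : ℝ := sSup (C ∩ Set.Iic x)

/-- The right end of the gap of `C` around `x`. -/
def gapRight (C : Set ℝ) (x : ℝ) : ℝ := sInf (C ∩ Set.Ici x)

/-- A regularized distance to `C`, quadratic on each gap. -/
def regDist (C : Set ℝ) (x : ℝ) : ℝ :=
  (x - gapLeft C x) * (gapRight C x - x) / (gapRight C x - gapLeft C x)

namespace IsClosedUnbdd

variable {C : Set ℝ} {x y : ℝ}

lemma nonempty (h : IsClosedUnbdd C) : C.Nonempty := let ⟨c, hc, _⟩ := h.exists_gt 0; ⟨c, hc⟩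

lemma gapLeft_mem (h : IsClosedUnbdd C) (x : ℝ) : gapLeft C x ∈ C ∩ Set.Iic x := by
  obtain ⟨c, hc, hcx⟩ := h.exists_lt x
  exact (h.closed.inter isClosed_Iic).csSup_mem ⟨c, hc, hcx.le⟩ ⟨x, fun _ h => h.2⟩

lemma gapRight_mem (h : IsClosedUnbdd C) (x : ℝ) : gapRight C x ∈ C ∩ Set.Ici x := by
  obtain ⟨c, hc, hcx⟩ := h.exists_gt x
  exact (h.closed.inter isClosed_Ici).csInf_mem ⟨c, hc, hcx.le⟩ ⟨x, fun _ h => h.2⟩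

lemma le_gapLeft {c : ℝ} (hc : c ∈ C) (hcx : c ≤ x) : c ≤ gapLeft C x :=
  le_csSup ⟨x, fun _ h => h.2⟩ ⟨hc, hcx⟩

lemma gapRight_le {c : ℝ} (hc : c ∈ C) (hcx : x ≤ c) : gapRight C x ≤ c :=
  csInf_le ⟨x, fun _ h => h.2⟩ ⟨hc, hcx⟩

lemma gapLeft_lt (h : IsClosedUnbdd C) (hx : x ∉ C) : gapLeft C x < x :=
  lt_of_le_of_ne (h.gapLeft_mem x).2 fun e => hx (e ▸ (h.gapLeft_mem x).1)

lemma lt_gapRight (h : IsClosedUnbdd C) (hx : x ∉ C) : x < gapRight C x :=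
  lt_of_le_of_ne (h.gapRight_mem x).2 fun e => hx (e.symm ▸ (h.gapRight_mem x).1)

lemma gapLeft_eq (h : IsClosedUnbdd C) (hy : y ∈ Set.Ioo (gapLeft C x) (gapRight C x)) :
    gapLeft C y = gapLeft C x := by
  refine le_antisymm ?_ (le_gapLeft (h.gapLeft_mem x).1 hy.1.le)
  have hm := h.gapLeft_mem y
  rcases le_total (gapLeft C y) x with hle | hle
  · exact le_gapLeft hm.1 hle
  · exact absurd ((gapRight_le hm.1 hle).trans hm.2) (not_le.2 hy.2)

lemma gapRight_eq (h : IsClosedUnbdd C) (hy : y ∈ Set.Ioo (gapLeft C x) (gapRight C x)) :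
    gapRight C y = gapRight C x := by
  refine le_antisymm (gapRight_le (h.gapRight_mem x).1 hy.2.le) ?_
  have hm := h.gapRight_mem y
  rcases le_total x (gapRight C y) with hle | hle
  · exact gapRight_le hm.1 hle
  · exact absurd (le_trans hm.2 (le_gapLeft hm.1 hle)) (not_le.2 hy.1)

lemma regDist_of_mem (h : IsClosedUnbdd C) (hx : x ∈ C) : regDist C x = 0 := by
  have : gapLeft C x = x := le_antisymm (h.gapLeft_mem x).2 (le_gapLeft hx le_rfl)
  simp [regDist, this]

lemma infDist_eq (h : IsClosedUnbdd C) :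
    Metric.infDist x C = min (x - gapLeft C x) (gapRight C x - x) := by
  have hl := h.gapLeft_mem x
  have hr := h.gapRight_mem x
  refine le_antisymm (le_min ?_ ?_) ((Metric.le_infDist h.nonempty).2 fun c hc => ?_)
  · refine (Metric.infDist_le_dist_of_mem hl.1).trans_eq ?_
    rw [Real.dist_eq, abs_of_nonneg (sub_nonneg.2 hl.2)]
  · refine (Metric.infDist_le_dist_of_mem hr.1).trans_eq ?_
    rw [Real.dist_eq, abs_sub_comm, abs_of_nonneg (sub_nonneg.2 hr.2)]
  · rw [Real.dist_eq]
    rcases le_total c x with hcx | hcx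
    · exact (min_le_left _ _).trans ((sub_le_sub_left (le_gapLeft hc hcx) x).trans (le_abs_self _))
    · rw [abs_sub_comm]
      exact (min_le_right _ _).trans ((sub_le_sub_right (gapRight_le hc hcx) x).trans
        (le_abs_self _))

lemma infDist_pos (h : IsClosedUnbdd C) (hx : x ∉ C) : 0 < Metric.infDist x C :=
  (h.closed.notMem_iff_infDist_pos h.nonempty).1 hx

lemma regDist_le (h : IsClosedUnbdd C) : regDist C x ≤ Metric.infDist x C := by
  by_cases hx : x ∈ C
  · rw [h.regDist_of_mem hx]; exact Metric.infDist_nonneg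
  have hl := h.gapLeft_lt hx
  have hr := h.lt_gapRight hx
  rw [h.infDist_eq, regDist, div_le_iff₀ (by linarith)]
  rcases min_cases (x - gapLeft C x) (gapRight C x - x) with ⟨h1, h2⟩ | ⟨h1, h2⟩ <;> rw [h1] <;>
    nlinarith

lemma infDist_le (h : IsClosedUnbdd C) : Metric.infDist x C ≤ 2 * regDist C x := by
  by_cases hx : x ∈ C
  · rw [h.regDist_of_mem hx, Metric.infDist_zero_of_mem hx]; simp
  have hl := h.gapLeft_lt hx
  have hr := h.lt_gapRight hx
  rw [h.infDist_eq, regDist, ← mul_div_assoc, le_div_iff₀ (by linarith)]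
  rcases min_cases (x - gapLeft C x) (gapRight C x - x) with ⟨h1, h2⟩ | ⟨h1, h2⟩ <;> rw [h1] <;>
    nlinarith

lemma regDist_nonneg (h : IsClosedUnbdd C) : 0 ≤ regDist C x := by
  have := h.infDist_le (x := x)
  have := Metric.infDist_nonneg (x := x) (s := C)
  linarith

lemma regDist_pos (h : IsClosedUnbdd C) (hx : x ∉ C) : 0 < regDist C x := by
  have := h.infDist_le (x := x)
  have := h.infDist_pos hx
  linarith

lemma regDist_eventuallyEq (h : IsClosedUnbdd C) (hx : x ∉ C) :
    regDist C =ᶠ[𝓝 x] fun y =>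
      (y - gapLeft C x) * (gapRight C x - y) / (gapRight C x - gapLeft C x) := by
  filter_upwards [Ioo_mem_nhds (h.gapLeft_lt hx) (h.lt_gapRight hx)] with y hy
  rw [regDist, h.gapLeft_eq hy, h.gapRight_eq hy]

lemma contDiffAt_regDist (h : IsClosedUnbdd C) (hx : x ∉ C) :
    ContDiffAt ℝ (⊤ : ℕ∞) (regDist C) x := by
  refine ContDiffAt.congr_of_eventuallyEq ?_ (h.regDist_eventuallyEq hx)
  refine ContDiffAt.div_const ?_ _
  fun_prop

lemma regDist_lip (h : IsClosedUnbdd C) (hx : x ∉ C) :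
    ∀ᶠ y in 𝓝 x, |regDist C y - regDist C x| ≤ |y - x| := by
  have hl := h.gapLeft_lt hx
  have hr := h.lt_gapRight hx
  filter_upwards [Ioo_mem_nhds hl hr] with y hy
  rw [regDist, regDist, h.gapLeft_eq hy, h.gapRight_eq hy, ← sub_div, abs_div,
    abs_of_pos (a := gapRight C x - gapLeft C x) (by linarith), div_le_iff₀ (by linarith)]
  have e : (y - gapLeft C x) * (gapRight C x - y) - (x - gapLeft C x) * (gapRight C x - x) =
    (y - x) * ((gapRight C x - x) - (y - gapLeft C x)) := by ring
  rw [e, abs_mul]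
  refine mul_le_mul_of_nonneg_left ?_ (abs_nonneg _)
  rw [abs_le]
  constructor <;> linarith [hy.1, hy.2]

end IsClosedUnbdd

/-- A fixed smooth probability density supported in `[-1/4, 1/4]`. -/
def molKernel : ℝ → ℝ :=
  ContDiffBump.normed (⟨1 / 8, 1 / 4, by norm_num, by norm_num⟩ : ContDiffBump (0 : ℝ)) volume

lemma molKernel_contDiff : ContDiff ℝ (⊤ : ℕ∞) molKernel := ContDiffBump.contDiff_normed _

lemma molKernel_hasCompactSupport : HasCompactSupport molKernel :=
  ContDiffBump.hasCompactSupport_normed _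

lemma integral_molKernel : ∫ u, molKernel u = 1 := ContDiffBump.integral_normed _

lemma molKernel_eq_zero {u : ℝ} (hu : 1 / 4 ≤ |u|) : molKernel u = 0 := by
  rw [← Function.notMem_support, molKernel, ContDiffBump.support_normed_eq]
  simpa using hu

lemma exists_molKernel_bound : ∃ M, 0 < M ∧ (∀ u, |molKernel u| ≤ M) ∧
    ∀ u v, |molKernel u - molKernel v| ≤ M * |u - v| := by
  obtain ⟨M, hM⟩ := molKernel_contDiff.continuous.bounded_above_of_compact_support
    molKernel_hasCompactSupport
  obtain ⟨L, hL⟩ := molKernel_contDiff.lipschitzWith_of_hasCompactSupport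
    molKernel_hasCompactSupport (by simp)
  refine ⟨|M| + L + 1, by positivity, fun u => ?_, fun u v => ?_⟩
  · have := hM u
    rw [Real.norm_eq_abs] at this
    linarith [le_abs_self M, L.2, show (0:ℝ) ≤ L from L.2]
  · have h1 := hL.dist_le_mul u v
    rw [Real.dist_eq, Real.dist_eq] at h1
    exact h1.trans (mul_le_mul_of_nonneg_right (by linarith [abs_nonneg M]) (abs_nonneg _))

/-- Mollification of `F` at scale `ε`. -/
def mollify (F : ℝ → ℝ) (ε y : ℝ) : ℝ := ∫ u, F (y - ε * u) * molKernel u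

lemma mollify_eq (F : ℝ → ℝ) {ε : ℝ} (hε : 0 < ε) (y : ℝ) :
    mollify F ε y = ∫ t, F t * (ε⁻¹ * molKernel (ε⁻¹ * (y - t))) := by
  rw [← integral_sub_left_eq_self (fun t => F t * (ε⁻¹ * molKernel (ε⁻¹ * (y - t)))) volume y]
  simp only [sub_sub_cancel]
  have := Measure.integral_comp_mul_left (fun t => F (y - t) * (ε⁻¹ * molKernel (ε⁻¹ * t))) ε
  have e : ∀ u, ε⁻¹ * (ε * u) = u := fun u => by field_simp
  simp only [e] at this
  have h2 : (∫ t, F (y - t) * (ε⁻¹ * molKernel (ε⁻¹ * t))) =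
      ε * ∫ x, F (y - ε * x) * (ε⁻¹ * molKernel x) := by
    rw [this, smul_eq_mul, abs_of_pos (inv_pos.2 hε), ← mul_assoc, mul_inv_cancel₀ hε.ne', one_mul]
  rw [h2, mollify, ← integral_const_mul]
  congr 1; ext u; field_simp

lemma mollify_of_const {F : ℝ → ℝ} {ε y : ℝ} (hε : 0 ≤ ε)
    (h : ∀ z, |z - y| ≤ ε / 4 → F z = F y) : mollify F ε y = F y := by
  have : ∀ u, F (y - ε * u) * molKernel u = F y * molKernel u := fun u => by
    by_cases hu : 1 / 4 ≤ |u|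
    · simp [molKernel_eq_zero hu]
    · rw [h (y - ε * u)]
      rw [sub_sub_cancel_left, abs_neg, abs_mul, abs_of_nonneg hε]
      nlinarith [not_le.1 hu]
  simp only [mollify, this]
  rw [integral_const_mul, integral_molKernel, mul_one]

lemma abs_mollify_le {F : ℝ → ℝ} {B : ℝ} (hF : ∀ y, |F y| ≤ B) (ε y : ℝ) :
    |mollify F ε y| ≤ B := by
  have hi : Integrable molKernel :=
    molKernel_contDiff.continuous.integrable_of_hasCompactSupport molKernel_hasCompactSupport
  have := norm_integral_le_of_norm_le (f := fun u => F (y - ε * u) * molKernel u)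
    (hi.const_mul B) (Eventually.of_forall fun u => by
      rw [norm_mul]
      have h0 : 0 ≤ molKernel u := ContDiffBump.nonneg_normed _ _
      rw [Real.norm_of_nonneg h0, Real.norm_eq_abs]
      exact mul_le_mul_of_nonneg_right (hF _) h0)
  rwa [integral_const_mul, integral_molKernel, mul_one] at this

lemma contDiffOn_mollify {F : ℝ → ℝ} (hF : Monotone F) :
    ContDiffOn ℝ (⊤ : ℕ∞) (fun q : ℝ × ℝ => mollify F q.1 q.2) (Set.Ioi 0 ×ˢ Set.univ) := by
  rintro ⟨ε, y⟩ ⟨hε, -⟩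
  simp only [Set.mem_Ioi] at hε
  set s : Set ℝ := Set.Ioo 0 (ε + 1) with hs
  have hc := contDiffOn_convolution_right_with_param (𝕜 := ℝ) (n := (⊤ : ℕ∞)) (μ := volume)
    (f := F) (ContinuousLinearMap.mul ℝ ℝ)
    (g := fun p x => p⁻¹ * molKernel (p⁻¹ * x)) (s := s)
    (k := Set.Icc (-(ε + 1)) (ε + 1)) isOpen_Ioo isCompact_Icc ?_ hF.locallyIntegrable ?_
  · have hmem : (ε, y) ∈ s ×ˢ (Set.univ : Set ℝ) := ⟨⟨hε, by simp⟩, trivial⟩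
    have h1 := (hc (ε, y) hmem).contDiffAt ((isOpen_Ioo.prod isOpen_univ).mem_nhds hmem)
    refine (h1.congr_of_eventuallyEq ?_).contDiffWithinAt
    filter_upwards [(isOpen_Ioo.prod isOpen_univ).mem_nhds hmem] with q hq
    rw [mollify_eq F hq.1.1]
    rfl
  · intro p x hp hx
    have : molKernel (p⁻¹ * x) = 0 := by
      apply molKernel_eq_zero
      rw [abs_mul, abs_of_pos (inv_pos.2 hp.1), inv_mul_eq_div, le_div_iff₀ hp.1]
      by_contra! hlt
      refine hx (abs_le.1 ?_)
      linarith [hp.1, hp.2]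
    simp [this]
  · rintro ⟨p, x⟩ ⟨hp, -⟩
    have hp0 : p ≠ 0 := hp.1.ne'
    have hinv : ContDiffAt ℝ (⊤ : ℕ∞) (fun q : ℝ × ℝ => q.1⁻¹) (p, x) :=
      contDiffAt_fst.inv hp0
    refine ContDiffAt.contDiffWithinAt ?_
    exact hinv.mul (molKernel_contDiff.contDiffAt.comp (p, x) (hinv.mul contDiffAt_snd))

lemma mollify_lip_aux {M ε₀ y₀ ε y t : ℝ} (hM : ∀ u, |molKernel u| ≤ M)
    (hL : ∀ u v, |molKernel u - molKernel v| ≤ M * |u - v|) (hε₀ : 0 < ε₀)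
    (h1 : |ε - ε₀| ≤ ε₀ / 2) (ht : |t - y₀| ≤ ε₀) (hM0 : 0 < M) :
    |ε⁻¹ * molKernel (ε⁻¹ * (y - t)) - ε₀⁻¹ * molKernel (ε₀⁻¹ * (y₀ - t))| ≤
      4 * M / ε₀ ^ 2 * (|ε - ε₀| + |y - y₀|) := by
  have hε : ε₀ / 2 ≤ ε := by linarith [(abs_le.1 h1).1]
  have hεp : 0 < ε := by linarith
  have hi : ε⁻¹ ≤ 2 / ε₀ := by
    rw [inv_eq_one_div, div_le_div_iff₀ hεp hε₀]; linarith
  have hd : |ε⁻¹ - ε₀⁻¹| ≤ 2 / ε₀ ^ 2 * |ε - ε₀| := by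
    have : ε⁻¹ - ε₀⁻¹ = (ε₀ - ε) * ε⁻¹ * ε₀⁻¹ := by field_simp
    rw [this, abs_mul, abs_mul, abs_of_pos (inv_pos.2 hεp), abs_of_pos (inv_pos.2 hε₀),
      abs_sub_comm]
    calc |ε - ε₀| * ε⁻¹ * ε₀⁻¹ ≤ |ε - ε₀| * (2 / ε₀) * ε₀⁻¹ := by gcongr
      _ = 2 / ε₀ ^ 2 * |ε - ε₀| := by field_simp
  have ha : |ε⁻¹ * (y - t) - ε₀⁻¹ * (y₀ - t)| ≤ 2 / ε₀ * (|ε - ε₀| + |y - y₀|) := by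
    have : ε⁻¹ * (y - t) - ε₀⁻¹ * (y₀ - t) = ε⁻¹ * (y - y₀) + (ε⁻¹ - ε₀⁻¹) * (y₀ - t) := by ring
    rw [this]
    refine (abs_add_le _ _).trans ?_
    rw [abs_mul, abs_mul, abs_of_pos (inv_pos.2 hεp), abs_sub_comm y₀ t]
    calc ε⁻¹ * |y - y₀| + |ε⁻¹ - ε₀⁻¹| * |t - y₀|
        ≤ 2 / ε₀ * |y - y₀| + 2 / ε₀ ^ 2 * |ε - ε₀| * ε₀ := by gcongr
      _ = 2 / ε₀ * (|ε - ε₀| + |y - y₀|) := by field_simp; ring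
  have e : ε⁻¹ * molKernel (ε⁻¹ * (y - t)) - ε₀⁻¹ * molKernel (ε₀⁻¹ * (y₀ - t)) =
    (ε⁻¹ - ε₀⁻¹) * molKernel (ε⁻¹ * (y - t)) +
      ε₀⁻¹ * (molKernel (ε⁻¹ * (y - t)) - molKernel (ε₀⁻¹ * (y₀ - t))) := by ring
  rw [e]
  refine (abs_add_le _ _).trans ?_
  rw [abs_mul, abs_mul, abs_of_pos (inv_pos.2 hε₀)]
  calc |ε⁻¹ - ε₀⁻¹| * |molKernel (ε⁻¹ * (y - t))| +
        ε₀⁻¹ * |molKernel (ε⁻¹ * (y - t)) - molKernel (ε₀⁻¹ * (y₀ - t))|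
      ≤ 2 / ε₀ ^ 2 * |ε - ε₀| * M + ε₀⁻¹ * (M * (2 / ε₀ * (|ε - ε₀| + |y - y₀|))) := by
        gcongr
        · exact hM _
        · exact (hL _ _).trans (by gcongr)
    _ ≤ 2 / ε₀ ^ 2 * (|ε - ε₀| + |y - y₀|) * M +
        ε₀⁻¹ * (M * (2 / ε₀ * (|ε - ε₀| + |y - y₀|))) := by
        gcongr; linarith [abs_nonneg (y - y₀)]
    _ = _ := by field_simp; ring

lemma integrable_mul_kernel {F : ℝ → ℝ} (hF : Monotone F) {ε : ℝ} (hε : 0 < ε) (y : ℝ) :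
    Integrable fun t => F t * (ε⁻¹ * molKernel (ε⁻¹ * (y - t))) := by
  have hcont : Continuous fun t => ε⁻¹ * molKernel (ε⁻¹ * (y - t)) := by
    have := molKernel_contDiff.continuous
    fun_prop
  refine hF.locallyIntegrable.integrable_smul_right_of_hasCompactSupport hcont ?_
  refine HasCompactSupport.intro (isCompact_Icc (a := y - ε) (b := y + ε)) fun t ht => ?_
  have : molKernel (ε⁻¹ * (y - t)) = 0 := by
    apply molKernel_eq_zero
    rw [abs_mul, abs_of_pos (inv_pos.2 hε), inv_mul_eq_div, le_div_iff₀ hε]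
    by_contra! hlt
    refine ht ?_
    have := abs_lt.1 hlt
    constructor <;> linarith
  simp [this]

lemma exists_mollify_lip : ∃ K, 0 < K ∧ ∀ F : ℝ → ℝ, Monotone F → ∀ ε₀ y₀ ω : ℝ, 0 < ε₀ →
    (∀ z, |z - y₀| ≤ ε₀ → |F z - F y₀| ≤ ω) →
    ∀ᶠ q : ℝ × ℝ in 𝓝 (ε₀, y₀),
      |mollify F q.1 q.2 - mollify F ε₀ y₀| ≤ K * ω / ε₀ * (|q.1 - ε₀| + |q.2 - y₀|) := by
  obtain ⟨M, hM0, hM, hL⟩ := exists_molKernel_bound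
  refine ⟨8 * M, by positivity, fun F hF ε₀ y₀ ω hε₀ hω => ?_⟩
  have hnh : Set.Icc (ε₀ - ε₀ / 2) (ε₀ + ε₀ / 2) ×ˢ Set.Icc (y₀ - ε₀ / 2) (y₀ + ε₀ / 2) ∈
      𝓝 (ε₀, y₀) :=
    prod_mem_nhds (Icc_mem_nhds (by linarith) (by linarith))
      (Icc_mem_nhds (by linarith) (by linarith))
  filter_upwards [hnh] with q hq
  obtain ⟨ε, y⟩ := q
  obtain ⟨h1, h2⟩ := hq
  simp only at h1 h2 ⊢
  have h1' : |ε - ε₀| ≤ ε₀ / 2 := abs_le.2 ⟨by linarith [h1.1], by linarith [h1.2]⟩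
  have h2' : |y - y₀| ≤ ε₀ / 2 := abs_le.2 ⟨by linarith [h2.1], by linarith [h2.2]⟩
  have hε : 0 < ε := by linarith [h1.1]
  have hω0 : 0 ≤ ω := (abs_nonneg _).trans (hω y₀ (by simpa using hε₀.le))
  have hone : ∀ ε y, 0 < ε → ∫ t, ε⁻¹ * molKernel (ε⁻¹ * (y - t)) = 1 := fun ε y hε => by
    have := mollify_eq (fun _ => 1) hε y
    rw [mollify] at this
    simp only [one_mul] at this
    rw [← this, integral_molKernel]
  have hint1 : ∀ ε y, 0 < ε → Integrable fun t => ε⁻¹ * molKernel (ε⁻¹ * (y - t)) :=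
    fun ε y hε => by simpa using integrable_mul_kernel (F := fun _ => 1) monotone_const hε y
  have e : mollify F ε y - mollify F ε₀ y₀ = ∫ t, (F t - F y₀) *
      (ε⁻¹ * molKernel (ε⁻¹ * (y - t)) - ε₀⁻¹ * molKernel (ε₀⁻¹ * (y₀ - t))) := by
    have hG := integrable_mul_kernel hF hε y
    have hG₀ := integrable_mul_kernel hF hε₀ y₀
    have e1 : ∀ t, (F t - F y₀) *
      (ε⁻¹ * molKernel (ε⁻¹ * (y - t)) - ε₀⁻¹ * molKernel (ε₀⁻¹ * (y₀ - t))) =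
      (F t * (ε⁻¹ * molKernel (ε⁻¹ * (y - t))) - F t * (ε₀⁻¹ * molKernel (ε₀⁻¹ * (y₀ - t)))) -
      F y₀ * (ε⁻¹ * molKernel (ε⁻¹ * (y - t)) - ε₀⁻¹ * molKernel (ε₀⁻¹ * (y₀ - t))) :=
      fun t => by ring
    simp only [e1]
    have hK := (((hint1 ε y hε).sub (hint1 ε₀ y₀ hε₀)).const_mul (F y₀))
    have hGG := hG.sub hG₀
    simp only [Pi.sub_apply, Pi.sub_def] at hK hGG
    rw [integral_sub hGG hK,
      integral_sub hG hG₀, integral_const_mul, integral_sub (hint1 ε y hε) (hint1 ε₀ y₀ hε₀),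
      hone _ _ hε, hone _ _ hε₀, mollify_eq F hε, mollify_eq F hε₀]
    ring
  rw [e]
  set D := |ε - ε₀| + |y - y₀| with hD
  have hD0 : 0 ≤ D := by positivity
  have hb : ∀ t, ‖(F t - F y₀) *
      (ε⁻¹ * molKernel (ε⁻¹ * (y - t)) - ε₀⁻¹ * molKernel (ε₀⁻¹ * (y₀ - t)))‖ ≤
      (Set.Icc (y₀ - ε₀) (y₀ + ε₀)).indicator (fun _ => ω * (4 * M / ε₀ ^ 2 * D)) t := by
    intro t
    by_cases ht : t ∈ Set.Icc (y₀ - ε₀) (y₀ + ε₀)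
    · rw [Set.indicator_of_mem ht, norm_mul, Real.norm_eq_abs, Real.norm_eq_abs]
      have ht' : |t - y₀| ≤ ε₀ := abs_le.2 ⟨by linarith [ht.1], by linarith [ht.2]⟩
      exact mul_le_mul (hω t ht') (mollify_lip_aux hM hL hε₀ h1' ht' hM0) (abs_nonneg _) hω0
    · rw [Set.indicator_of_notMem ht]
      have hfar : ε₀ < |t - y₀| := by
        by_contra! hle
        exact ht ⟨by linarith [(abs_le.1 hle).1], by linarith [(abs_le.1 hle).2]⟩
      have hz : molKernel (ε⁻¹ * (y - t)) = 0 := by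
        apply molKernel_eq_zero
        rw [abs_mul, abs_of_pos (inv_pos.2 hε), inv_mul_eq_div, le_div_iff₀ hε, abs_sub_comm]
        have := abs_sub_abs_le_abs_sub (t - y₀) (y - y₀)
        rw [sub_sub_sub_cancel_right] at this
        linarith [h1.2]
      have hz₀ : molKernel (ε₀⁻¹ * (y₀ - t)) = 0 := by
        apply molKernel_eq_zero
        rw [abs_mul, abs_of_pos (inv_pos.2 hε₀), inv_mul_eq_div, le_div_iff₀ hε₀, abs_sub_comm]
        linarith
      simp [hz, hz₀]
  have hbi : Integrable ((Set.Icc (y₀ - ε₀) (y₀ + ε₀)).indicator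
      (fun _ => ω * (4 * M / ε₀ ^ 2 * D))) :=
    (integrable_indicator_iff measurableSet_Icc).2
      (integrableOn_const (measure_Icc_lt_top.ne))
  have := norm_integral_le_of_norm_le hbi (Eventually.of_forall hb)
  rw [Real.norm_eq_abs] at this
  refine this.trans_eq ?_
  rw [integral_indicator measurableSet_Icc, setIntegral_const, smul_eq_mul,
    Real.volume_real_Icc_of_le (by linarith)]
  field_simp
  ring

lemma CantorPair.isClosedUnbdd {r₀ : ℝ} {q : ℕ → ℝ} (P : CantorPair r₀ q) : IsClosedUnbdd P.C :=
  ⟨P.closed, P.exists_gt, P.exists_lt⟩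

section stairMix

variable {N : ℕ} {r₀ : ℝ} {q : ℕ → ℝ} (P : CantorPair r₀ q) (C : Set ℝ) (i j : Fin N)

/-- The staircase of `P` in the variable `x j`, mollified at the scale of the distance from `x i`
to `C`. -/
def stairMix (x : Euc N) : ℝ := mollify P.F (regDist C (x i)) (x j)

variable {C}

lemma CantorPair.F_nonneg (y : ℝ) : 0 ≤ P.F y := by
  have h := P.F_left (min y (-1)) (by simp)
  rw [← h]
  exact P.mono (min_le_left _ _)

lemma CantorPair.F_le (y : ℝ) : P.F y ≤ 1 / q 0 := by
  have h := P.F_right (max y P.Y) (le_max_right _ _)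
  rw [← h]
  exact P.mono (le_max_left _ _)

lemma CantorPair.eq_of_lt_infDist {y z : ℝ} (h : |z - y| < Metric.infDist y P.C) :
    P.F z = P.F y := by
  have key : ∀ c ∈ P.C, |z - y| < |c - y| := fun c hc => by
    have := Metric.infDist_le_dist_of_mem (x := y) hc
    rw [dist_comm, Real.dist_eq] at this
    exact h.trans_le this
  have h1 := neg_abs_le (z - y)
  have h2 := le_abs_self (z - y)
  rcases le_total z y with hzy | hzy
  · refine P.const z y hzy (Set.eq_empty_of_forall_notMem fun c ⟨hc1, hc2⟩ => ?_)
    have := key c hc2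
    rw [abs_of_nonpos (by linarith : z - y ≤ 0), abs_of_nonpos (by linarith [hc1.2] : c - y ≤ 0)]
      at this
    linarith [hc1.1]
  · refine (P.const y z hzy (Set.eq_empty_of_forall_notMem fun c ⟨hc1, hc2⟩ => ?_)).symm
    have := key c hc2
    rw [abs_of_nonneg (by linarith : 0 ≤ z - y), abs_of_nonneg (by linarith [hc1.1] : 0 ≤ c - y)]
      at this
    linarith [hc1.2]

lemma abs_stairMix_le (C : Set ℝ) (x : Euc N) : |stairMix P C i j x| ≤ 1 / q 0 :=
  abs_mollify_le (fun y => by rw [abs_of_nonneg (P.F_nonneg y)]; exact P.F_le y) _ _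

lemma contDiff_coord (i : Fin N) : ContDiff ℝ (⊤ : ℕ∞) (fun x : Euc N => x i) := by fun_prop

lemma contDiffAt_stairMix_of_notMem (hC : IsClosedUnbdd C) {x : Euc N} (hx : x i ∉ C) :
    ContDiffAt ℝ (⊤ : ℕ∞) (stairMix P C i j) x := by
  have h1 : (regDist C (x i), x j) ∈ Set.Ioi (0 : ℝ) ×ˢ (Set.univ : Set ℝ) :=
    ⟨hC.regDist_pos hx, trivial⟩
  have h2 := (contDiffOn_mollify P.mono _ h1).contDiffAt
    ((isOpen_Ioi.prod isOpen_univ).mem_nhds h1)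
  have h3 : ContDiffAt ℝ (⊤ : ℕ∞) (fun x : Euc N => (regDist C (x i), x j)) x :=
    (ContDiffAt.comp (g := regDist C) (f := fun y : Euc N => y i) x
      (hC.contDiffAt_regDist hx) (contDiff_coord i).contDiffAt).prodMk
      (contDiff_coord j).contDiffAt
  exact ContDiffAt.comp (g := fun p : ℝ × ℝ => mollify P.F p.1 p.2)
    (f := fun y : Euc N => (regDist C (y i), y j)) x h2 h3

lemma stairMix_eq (hC : IsClosedUnbdd C) {x : Euc N}
    (hx : Metric.infDist (x i) C / 4 < Metric.infDist (x j) P.C) :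
    stairMix P C i j x = P.F (x j) := by
  refine mollify_of_const hC.regDist_nonneg fun z hz => P.eq_of_lt_infDist ?_
  linarith [hC.regDist_le (x := x i)]

lemma stairMix_eventuallyEq (hC : IsClosedUnbdd C) {x : Euc N}
    (hx : Metric.infDist (x i) C / 4 < Metric.infDist (x j) P.C) :
    stairMix P C i j =ᶠ[𝓝 x] fun _ => P.F (x j) := by
  have hci : Continuous fun y : Euc N => y i := (contDiff_coord i).continuous
  have hcj : Continuous fun y : Euc N => y j := (contDiff_coord j).continuous
  have hcont1 : Continuous fun y : Euc N => Metric.infDist (y i) C / 4 :=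
    ((Metric.continuous_infDist_pt C).comp hci).div_const 4
  have hcont2 : Continuous fun y : Euc N => Metric.infDist (y j) P.C :=
    (Metric.continuous_infDist_pt P.C).comp hcj
  have hpos : 0 < Metric.infDist (x j) P.C :=
    (div_nonneg Metric.infDist_nonneg (by norm_num)).trans_lt hx
  have h3 : ∀ᶠ y : Euc N in 𝓝 x, |y j - x j| < Metric.infDist (x j) P.C := by
    have : Tendsto (fun y : Euc N => |y j - x j|) (𝓝 x) (𝓝 |x j - x j|) :=
      ((hcj.sub continuous_const).abs).tendsto x
    rw [sub_self, abs_zero] at this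
    exact this.eventually (gt_mem_nhds hpos)
  filter_upwards [(isOpen_lt hcont1 hcont2).mem_nhds hx, h3] with y hy1 hy2
  rw [stairMix_eq P i j hC hy1, P.eq_of_lt_infDist hy2]

lemma contDiffAt_stairMix (hC : IsClosedUnbdd C) {x : Euc N} (hx : ¬ (x i ∈ C ∧ x j ∈ P.C)) :
    ContDiffAt ℝ (⊤ : ℕ∞) (stairMix P C i j) x := by
  by_cases hi : x i ∈ C
  · have hj : x j ∉ P.C := fun h => hx ⟨hi, h⟩
    refine contDiffAt_const.congr_of_eventuallyEq (stairMix_eventuallyEq P i j hC ?_)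
    rw [Metric.infDist_zero_of_mem hi, zero_div]
    exact P.isClosedUnbdd.infDist_pos hj
  · exact contDiffAt_stairMix_of_notMem P i j hC hi

lemma fderiv_stairMix_eq_zero (hC : IsClosedUnbdd C) {x : Euc N}
    (hx : Metric.infDist (x i) C / 4 < Metric.infDist (x j) P.C) :
    fderiv ℝ (stairMix P C i j) x = 0 := by
  rw [(stairMix_eventuallyEq P i j hC hx).fderiv_eq]; simp

lemma exists_fderiv_stairMix_le : ∃ K, 0 < K ∧ ∀ (N : ℕ) (r₀ : ℝ) (q : ℕ → ℝ)
    (P : CantorPair r₀ q) (C : Set ℝ) (i j : Fin N), IsClosedUnbdd C → ∀ (x : Euc N) (ω : ℝ),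
    x i ∉ C → (∀ z, |z - x j| ≤ regDist C (x i) → |P.F z - P.F (x j)| ≤ ω) →
    ‖fderiv ℝ (stairMix P C i j) x‖ ≤ K * ω / regDist C (x i) := by
  obtain ⟨K, hK, hlip⟩ := exists_mollify_lip
  refine ⟨2 * K, by positivity, fun N r₀ q P C i j hC x ω hx hω => ?_⟩
  have hpos := hC.regDist_pos hx
  have hω0 : 0 ≤ ω := (abs_nonneg _).trans (hω (x j) (by simpa using hpos.le))
  have hd := ((contDiffAt_stairMix_of_notMem P i j hC hx).differentiableAt
    (by simp)).hasFDerivAt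
  refine hd.le_of_lip' (by positivity) ?_
  have h1 := hlip P.F P.mono (regDist C (x i)) (x j) ω hpos hω
  have hci : ContinuousAt (fun y : Euc N => regDist C (y i)) x :=
    ContinuousAt.comp (g := regDist C) (hC.contDiffAt_regDist hx).continuousAt
      (contDiff_coord i).continuous.continuousAt
  have h2 := (hci.prodMk (contDiff_coord j).continuous.continuousAt).eventually h1
  have h3 := ((contDiff_coord i).continuous.continuousAt (x := x)).eventually (hC.regDist_lip hx)
  filter_upwards [h2, h3] with y hy1 hy2
  rw [Real.norm_eq_abs]
  have hcoord : ∀ k : Fin N, |y k - x k| ≤ ‖y - x‖ := fun k => by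
    have := PiLp.norm_apply_le (y - x) k
    simpa using this
  refine hy1.trans ?_
  have : |regDist C (y i) - regDist C (x i)| + |y j - x j| ≤ 2 * ‖y - x‖ := by
    linarith [hcoord i, hcoord j]
  calc K * ω / regDist C (x i) * (|regDist C (y i) - regDist C (x i)| + |y j - x j|)
      ≤ K * ω / regDist C (x i) * (2 * ‖y - x‖) := by gcongr
    _ = _ := by ring

lemma exists_level {r₀ d : ℝ} (hd : 0 < d) :
    ∃ n : ℕ, r₀ / 2 ^ (n + 1) < d ∧ (n = 0 ∨ d ≤ r₀ / 2 ^ n) := by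
  classical
  have hex : ∃ n : ℕ, r₀ / 2 ^ (n + 1) < d := by
    obtain ⟨n, hn⟩ := pow_unbounded_of_one_lt (r₀ / d) (by norm_num : (1 : ℝ) < 2)
    refine ⟨n, ?_⟩
    rw [div_lt_iff₀ (by positivity)]
    rw [div_lt_iff₀ hd] at hn
    have : (2 : ℝ) ^ n ≤ 2 ^ (n + 1) := by rw [pow_succ]; linarith [pow_pos (two_pos (α := ℝ)) n]
    nlinarith
  refine ⟨Nat.find hex, Nat.find_spec hex, ?_⟩
  rcases Nat.eq_zero_or_pos (Nat.find hex) with h0 | h0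
  · exact Or.inl h0
  · right
    have := Nat.find_min hex (Nat.sub_lt h0 one_pos)
    rw [Nat.sub_add_cancel (show 1 ≤ Nat.find hex from h0)] at this
    exact not_lt.1 this

lemma exists_stairMix_layer : ∃ K, 0 < K ∧ ∀ (N : ℕ) (r₀ : ℝ) (q : ℕ → ℝ)
    (P : CantorPair r₀ q) (C : Set ℝ) (i j : Fin N), 0 < r₀ → (∀ n, 0 < q n) →
    IsClosedUnbdd C → ∀ x : Euc N,
    x i ∉ C → fderiv ℝ (stairMix P C i j) x ≠ 0 →
    ∃ n : ℕ, ‖fderiv ℝ (stairMix P C i j) x‖ ≤ K * (2 ^ n / (r₀ * q n)) ∧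
      r₀ / 2 ^ (n + 1) < Metric.infDist (x i) C ∧
      Metric.infDist (x j) P.C ≤ Metric.infDist (x i) C / 4 ∧
      (n = 0 ∨ Metric.infDist (x i) C ≤ r₀ / 2 ^ n) := by
  obtain ⟨K, hK, hb⟩ := exists_fderiv_stairMix_le
  refine ⟨4 * K, by positivity, fun N r₀ q P C i j hr hq hC x hx hne => ?_⟩
  obtain ⟨n, hn1, hn2⟩ := exists_level (hC.infDist_pos hx)
  refine ⟨n, ?_, hn1, ?_, hn2⟩
  · have hω : ∀ z, |z - x j| ≤ regDist C (x i) → |P.F z - P.F (x j)| ≤ 1 / q n := by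
      intro z hz
      rcases hn2 with rfl | h
      · exact P.osc_zero _ _
      · exact P.osc n _ _ (hz.trans (hC.regDist_le.trans h))
    refine (hb N r₀ q P C i j hC x _ hx hω).trans ?_
    have h1 : r₀ / (4 * 2 ^ n) ≤ regDist C (x i) := by
      have := hC.infDist_le (x := x i)
      have e : r₀ / 2 ^ (n + 1) = 2 * (r₀ / (4 * 2 ^ n)) := by rw [pow_succ]; field_simp; norm_num
      linarith
    have hqn := hq n
    calc K * (1 / q n) / regDist C (x i) ≤ K * (1 / q n) / (r₀ / (4 * 2 ^ n)) := by gcongr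
      _ = _ := by field_simp
  · by_contra! h
    exact hne (fderiv_stairMix_eq_zero P i j hC h)

end stairMix

lemma integral_fderiv_apply_eq_zero {N : ℕ} {Ψ : Euc N → ℝ} (v : Euc N) (hΨ : Integrable Ψ)
    (hd : ∀ᵐ x : Euc N, ∀ t : ℝ, DifferentiableAt ℝ Ψ (x + t • v))
    (hf : Integrable fun x => fderiv ℝ Ψ x v) : ∫ x, fderiv ℝ Ψ x v = 0 := by
  set f : Euc N → ℝ := fun x => fderiv ℝ Ψ x v with hfdef
  set ν : Measure ℝ := volume.restrict (Set.Ioc 0 1) with hν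
  have hmp : MeasurePreserving (fun p : ℝ × Euc N => (p.1, p.2 + p.1 • v))
      (ν.prod volume) (ν.prod volume) := by
    refine (MeasurePreserving.id ν).skew_product (g := fun t x => x + t • v) (by fun_prop) ?_
    exact Eventually.of_forall fun t => (measurePreserving_add_right volume (t • v)).map_eq
  have hint : Integrable (fun p : ℝ × Euc N => f (p.2 + p.1 • v)) (ν.prod volume) :=
    hmp.integrable_comp_of_integrable (g := fun p : ℝ × Euc N => f p.2) (hf.comp_snd ν)
  have h1 : ∫ t, ∫ x, f (x + t • v) ∂volume ∂ν = ∫ x, f x := by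
    have : ∀ t : ℝ, ∫ x, f (x + t • v) = ∫ x, f x := fun t => integral_add_right_eq_self f (t • v)
    simp only [this]
    simp [hν]
  have h2 := integral_integral_swap (μ := ν) (ν := (volume : Measure (Euc N)))
    (f := fun t x => f (x + t • v)) hint
  rw [← h1, h2]
  have h3 : ∀ᵐ x : Euc N, ∫ t, f (x + t • v) ∂ν = Ψ (x + v) - Ψ x := by
    filter_upwards [hd, hint.prod_left_ae] with x hx hxi
    have hderiv : ∀ t ∈ Set.uIcc (0 : ℝ) 1,
        HasDerivAt (fun t : ℝ => Ψ (x + t • v)) (f (x + t • v)) t := fun t _ => by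
      have hl : HasDerivAt (fun t : ℝ => x + t • v) v t := by
        simpa using ((hasDerivAt_id t).smul_const v).const_add x
      exact (hx t).hasFDerivAt.comp_hasDerivAt t hl
    have := intervalIntegral.integral_eq_sub_of_hasDerivAt hderiv
      ((intervalIntegrable_iff_integrableOn_Ioc_of_le zero_le_one).2 hxi)
    rw [intervalIntegral.integral_of_le zero_le_one] at this
    simpa using this
  rw [integral_congr_ae h3, integral_sub (hΨ.comp_add_right v) hΨ,
    integral_add_right_eq_self Ψ v, sub_self]

section singSet

variable {N : ℕ} {C C' : Set ℝ} {i j : Fin N}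

/-- The points whose coordinates `i` and `j` lie in `C` and `C'` respectively. -/
def singSet (C C' : Set ℝ) (i j : Fin N) : Set (Euc N) := {x | x i ∈ C ∧ x j ∈ C'}

lemma isClosed_singSet (hC : IsClosed C) (hC' : IsClosed C') :
    IsClosed (singSet C C' i j : Set (Euc N)) :=
  (hC.preimage (contDiff_coord i).continuous).inter (hC'.preimage (contDiff_coord j).continuous)

lemma ae_coord_notMem (hC : volume C = 0) (i : Fin N) : ∀ᵐ x : Euc N, x i ∉ C := by
  have h1 : Measure.QuasiMeasurePreserving (fun x : Fin N → ℝ => x i) volume volume :=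
    Measure.quasiMeasurePreserving_eval _ i
  have h2 := h1.comp (EuclideanSpace.volume_preserving_symm_measurableEquiv_toLp
    (Fin N)).quasiMeasurePreserving
  exact h2.ae (measure_eq_zero_iff_ae_notMem.1 hC)

lemma ae_notMem_singSet (hC : volume C = 0) : ∀ᵐ x : Euc N, x ∉ singSet C C' i j := by
  filter_upwards [ae_coord_notMem hC i] with x hx h using hx h.1

lemma ae_line_notMem_singSet (hij : i ≠ j) (hC : volume C = 0) (hC' : volume C' = 0)
    (k : Fin N) : ∀ᵐ x : Euc N, ∀ t : ℝ,
      x + t • EuclideanSpace.single k (1 : ℝ) ∉ singSet C C' i j := by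
  filter_upwards [ae_coord_notMem hC i, ae_coord_notMem hC' j] with x hx hx' t h
  by_cases hk : k = i
  · subst hk
    refine hx' ?_
    simpa [Ne.symm hij] using h.2
  · refine hx ?_
    simpa [Ne.symm hk] using h.1

lemma aestronglyMeasurable_of_smooth_off {u : Euc N → ℝ} (hC : IsClosed C) (hC' : IsClosed C')
    (hn : volume C = 0)
    (hu : ∀ x ∉ singSet C C' i j, ContDiffAt ℝ (⊤ : ℕ∞) u x) :
    AEStronglyMeasurable u (volume : Measure (Euc N)) := by
  have hcl : IsClosed (singSet C C' i j : Set (Euc N)) := isClosed_singSet hC hC'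
  have h1 : ContinuousOn u (singSet C C' i j)ᶜ := fun x hx =>
    (hu x hx).continuousAt.continuousWithinAt
  have h2 := h1.aestronglyMeasurable (μ := volume) hcl.isOpen_compl.measurableSet
  rwa [Measure.restrict_eq_self_of_ae_mem] at h2
  exact ae_notMem_singSet hn

/-- Integration by parts for a bounded function that is smooth off a product of null sets. -/
lemma integral_mul_fderiv_eq_neg {u ξ : Euc N → ℝ} {B : ℝ} (hij : i ≠ j)
    (hC : IsClosed C) (hC' : IsClosed C') (hn : volume C = 0) (hn' : volume C' = 0)
    (hu : ∀ x ∉ singSet C C' i j, ContDiffAt ℝ (⊤ : ℕ∞) u x) (hB : ∀ x, |u x| ≤ B)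
    (hξ : ContDiff ℝ 1 ξ) (hξc : HasCompactSupport ξ) (k : Fin N)
    (hint : Integrable fun x => fderiv ℝ u x (EuclideanSpace.single k 1) * ξ x) :
    ∫ x, u x * fderiv ℝ ξ x (EuclideanSpace.single k 1) =
      - ∫ x, fderiv ℝ u x (EuclideanSpace.single k 1) * ξ x := by
  set e : Euc N := EuclideanSpace.single k 1 with he
  have hum := aestronglyMeasurable_of_smooth_off hC hC' hn hu
  have hd1 : ∀ x ∉ singSet C C' i j, DifferentiableAt ℝ u x := fun x hx =>
    (hu x hx).differentiableAt (by simp)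
  have hd2 : Differentiable ℝ ξ := hξ.differentiable (by simp)
  have hform : ∀ x ∉ singSet C C' i j, fderiv ℝ (fun y => u y * ξ y) x e =
      u x * fderiv ℝ ξ x e + fderiv ℝ u x e * ξ x := fun x hx => by
    rw [fderiv_fun_mul (hd1 x hx) (hd2 x)]
    simp [mul_comm]
  have hae : (fun x => fderiv ℝ (fun y => u y * ξ y) x e) =ᵐ[volume]
      fun x => u x * fderiv ℝ ξ x e + fderiv ℝ u x e * ξ x := by
    filter_upwards [ae_notMem_singSet (C' := C') (j := j) hn] with x hx using hform x hx
  have hi1 : Integrable fun x => u x * fderiv ℝ ξ x e := by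
    refine Integrable.bdd_mul (c := B) ?_ hum (Eventually.of_forall fun x => hB x)
    refine Continuous.integrable_of_hasCompactSupport ?_ (hξc.fderiv_apply ℝ e)
    exact (hξ.continuous_fderiv (by simp)).clm_apply continuous_const
  have hi2 : Integrable fun x => u x * ξ x :=
    Integrable.bdd_mul (c := B) (hξ.continuous.integrable_of_hasCompactSupport hξc) hum
      (Eventually.of_forall fun x => hB x)
  have h0 := integral_fderiv_apply_eq_zero (Ψ := fun y => u y * ξ y) e hi2 (by
    filter_upwards [ae_line_notMem_singSet hij hn hn' k] with x hx t
    exact (hd1 _ (hx t)).mul (hd2 _)) ((hi1.add hint).congr hae.symm)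
  rw [integral_congr_ae hae, integral_add hi1 hint] at h0
  linarith

end singSet

section layers

variable {N : ℕ} {r₀ : ℝ} {q q' : ℕ → ℝ}

/-- The part of a cube where `x i` and `x j` are close to `C` and `C'` at scale `n`. -/
def layer (X r₀ : ℝ) (C C' : Set ℝ) (i j : Fin N) (n : ℕ) : Set (Euc N) :=
  {x | (∀ k, |x k| ≤ X) ∧ (n = 0 ∨ (Metric.infDist (x i) C ≤ 4 * (r₀ / 2 ^ n) ∧
    Metric.infDist (x j) C' ≤ 4 * (r₀ / 2 ^ n)))}

lemma isClosed_layer (X r₀ : ℝ) (C C' : Set ℝ) (i j : Fin N) (n : ℕ) :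
    IsClosed (layer X r₀ C C' i j n) := by
  have hc : ∀ k : Fin N, Continuous fun x : Euc N => x k := fun k => (contDiff_coord k).continuous
  refine IsClosed.inter ?_ ?_
  · show IsClosed {x : Euc N | ∀ k, |x k| ≤ X}
    simp only [Set.ofPred_forall]
    exact isClosed_iInter fun k => isClosed_le (hc k).abs continuous_const
  · by_cases h : n = 0
    · show IsClosed {x : Euc N | n = 0 ∨ _}
      simp [h]
    · show IsClosed {x : Euc N | n = 0 ∨ _}
      simp only [h, false_or]
      exact (isClosed_le ((Metric.continuous_infDist_pt C).comp (hc i)) continuous_const).inter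
        (isClosed_le ((Metric.continuous_infDist_pt C').comp (hc j)) continuous_const)

lemma volume_coord_box (s : Fin N → Set ℝ) (L : Set (Euc N)) (hL : ∀ x ∈ L, ∀ k, x k ∈ s k) :
    volume L ≤ ∏ k, volume (s k) := by
  rw [← volume_pi_pi]
  have hsub : L ⊆ (MeasurableEquiv.toLp 2 (Fin N → ℝ)).symm ⁻¹' (Set.univ.pi s) :=
    fun x hx k _ => hL x hx k
  refine (measure_mono hsub).trans_eq ?_
  exact (EuclideanSpace.volume_preserving_symm_measurableEquiv_toLp
    (Fin N)).measure_preimage_equiv _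

lemma exists_volume_layer_le {X : ℝ} (hX : 0 < X) (hr : 0 < r₀)
    (P : CantorPair r₀ q) (P' : CantorPair r₀ q') (hq : 0 < q 0) (hq' : 0 < q' 0)
    {i j : Fin N} (hij : i ≠ j) : ∃ K, 0 < K ∧ ∀ n,
    volume (layer X r₀ P.C P'.C i j n) ≤
      ENNReal.ofReal (K * ((q n * (r₀ / 2 ^ n)) * (q' n * (r₀ / 2 ^ n)))) := by
  obtain ⟨K₁, hK₁, h1⟩ := P.vol X hX
  obtain ⟨K₂, hK₂, h2⟩ := P'.vol X hX
  set c : ℝ := ∏ _k ∈ (Finset.univ.erase i).erase j, (2 * X) with hc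
  have hc0 : 0 < c := by rw [hc]; exact Finset.prod_pos fun _ _ => mul_pos two_pos hX
  set b : ℝ := ∏ _k : Fin N, (2 * X) with hb
  have hb0 : 0 < b := by rw [hb]; exact Finset.prod_pos fun _ _ => mul_pos two_pos hX
  have hIcc : volume {y : ℝ | |y| ≤ X} = ENNReal.ofReal (2 * X) := by
    have : {y : ℝ | |y| ≤ X} = Set.Icc (-X) X := by ext y; exact abs_le (a := y) (b := X)
    rw [this, Real.volume_Icc]; congr 1; ring
  refine ⟨K₁ * K₂ * c + b / (q 0 * r₀ * (q' 0 * r₀)), by positivity, fun n => ?_⟩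
  rcases Nat.eq_zero_or_pos n with rfl | hn
  · refine (volume_coord_box (fun _ => {y | |y| ≤ X}) _ fun x hx k => hx.1 k).trans ?_
    simp only [hIcc]
    rw [← ENNReal.ofReal_prod_of_nonneg fun _ _ => (mul_pos two_pos hX).le]
    refine ENNReal.ofReal_le_ofReal ?_
    rw [← hb, add_mul]
    have : b / (q 0 * r₀ * (q' 0 * r₀)) * (q 0 * (r₀ / 2 ^ 0) * (q' 0 * (r₀ / 2 ^ 0))) = b := by
      simp only [pow_zero, div_one]
      field_simp
    rw [this]
    have : 0 ≤ K₁ * K₂ * c * (q 0 * (r₀ / 2 ^ 0) * (q' 0 * (r₀ / 2 ^ 0))) := by positivity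
    linarith
  · have hn0 : n ≠ 0 := hn.ne'
    set s : Fin N → Set ℝ := fun k => if k = i then
        {y | |y| ≤ X ∧ Metric.infDist y P.C ≤ 4 * (r₀ / 2 ^ n)} else if k = j then
        {y | |y| ≤ X ∧ Metric.infDist y P'.C ≤ 4 * (r₀ / 2 ^ n)} else {y | |y| ≤ X} with hs
    refine (volume_coord_box s _ fun x hx k => ?_).trans ?_
    · have h3 := hx.2.resolve_left hn0
      simp only [hs]
      split_ifs with hk hk'
      · subst hk; exact ⟨hx.1 _, h3.1⟩
      · subst hk'; exact ⟨hx.1 _, h3.2⟩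
      · exact hx.1 k
    · rw [← Finset.mul_prod_erase _ _ (Finset.mem_univ i),
        ← Finset.mul_prod_erase _ _ (Finset.mem_erase.2 ⟨hij.symm, Finset.mem_univ j⟩)]
      have e1 : ∏ x ∈ (Finset.univ.erase i).erase j, volume (s x) = ENNReal.ofReal c := by
        rw [hc, ENNReal.ofReal_prod_of_nonneg fun _ _ => (mul_pos two_pos hX).le]
        refine Finset.prod_congr rfl fun k hk => ?_
        have hkj := (Finset.mem_erase.1 hk).1
        have hki := (Finset.mem_erase.1 (Finset.mem_erase.1 hk).2).1
        simp only [hs, if_neg hki, if_neg hkj, hIcc]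
      have e2 : volume (s i) ≤ ENNReal.ofReal (K₁ * (q n * (r₀ / 2 ^ n))) := by
        simp only [hs, if_true]; exact h1 n
      have e3 : volume (s j) ≤ ENNReal.ofReal (K₂ * (q' n * (r₀ / 2 ^ n))) := by
        simp only [hs, if_neg hij.symm, if_true]; exact h2 n
      rw [e1]
      by_cases hneg : 0 ≤ q n ∧ 0 ≤ q' n
      · obtain ⟨hqn, hqn'⟩ := hneg
        refine (mul_le_mul' e2 (mul_le_mul' e3 le_rfl)).trans ?_
        rw [← ENNReal.ofReal_mul (by positivity), ← ENNReal.ofReal_mul (by positivity)]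
        refine ENNReal.ofReal_le_ofReal ?_
        have : 0 ≤ b / (q 0 * r₀ * (q' 0 * r₀)) * (q n * (r₀ / 2 ^ n) * (q' n * (r₀ / 2 ^ n))) := by
          positivity
        linarith
      · have hz : volume (s i) * (volume (s j) * ENNReal.ofReal c) = 0 := by
          rw [not_and_or, not_le, not_le] at hneg
          rcases hneg with hneg | hneg
          · rw [ENNReal.ofReal_of_nonpos] at e2
            · rw [le_zero_iff.1 e2, zero_mul]
            · exact mul_nonpos_of_nonneg_of_nonpos hK₁.le
                (mul_nonpos_of_nonpos_of_nonneg hneg.le (by positivity))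
          · rw [ENNReal.ofReal_of_nonpos] at e3
            · rw [le_zero_iff.1 e3, zero_mul, mul_zero]
            · exact mul_nonpos_of_nonneg_of_nonpos hK₂.le
                (mul_nonpos_of_nonpos_of_nonneg hneg.le (by positivity))
        rw [hz]; exact zero_le

/-- The function equal to `∑ c n` over the layers containing the point. -/
def layerSum (X r₀ : ℝ) (C C' : Set ℝ) (i j : Fin N) (c : ℕ → ℝ) (x : Euc N) : ℝ≥0∞ :=
  ∑' n, (layer X r₀ C C' i j n).indicator (fun _ => ENNReal.ofReal (c n)) x

lemma measurable_layerSum (X r₀ : ℝ) (C C' : Set ℝ) (i j : Fin N) (c : ℕ → ℝ) :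
    Measurable (layerSum X r₀ C C' i j c) :=
  Measurable.tsum fun n =>
    measurable_const.indicator (isClosed_layer X r₀ C C' i j n).measurableSet

lemma le_layerSum {X r₀ : ℝ} {C C' : Set ℝ} {i j : Fin N} {n : ℕ} {x : Euc N}
    (h : x ∈ layer X r₀ C C' i j n) (c : ℕ → ℝ) :
    ENNReal.ofReal (c n) ≤ layerSum X r₀ C C' i j c x := by
  refine le_trans ?_ (ENNReal.le_tsum n)
  rw [Set.indicator_of_mem h]

lemma lintegral_layerSum_lt_top {X : ℝ} (hX : 0 < X) (hr : 0 < r₀)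
    (P : CantorPair r₀ q) (P' : CantorPair r₀ q') (hq : 0 < q 0) (hq' : 0 < q' 0)
    {i j : Fin N} (hij : i ≠ j) {c : ℕ → ℝ} (hc : ∀ n, 0 ≤ c n)
    (hsum : Summable fun n => c n * ((q n * (r₀ / 2 ^ n)) * (q' n * (r₀ / 2 ^ n)))) :
    ∫⁻ x, layerSum X r₀ P.C P'.C i j c x < ⊤ := by
  obtain ⟨K, hK, hv⟩ := exists_volume_layer_le hX hr P P' hq hq' hij
  set L := layer X r₀ P.C P'.C i j with hL
  have hmeas : ∀ n, MeasurableSet (L n) := fun n => (isClosed_layer _ _ _ _ _ _ n).measurableSet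
  simp only [layerSum]
  rw [lintegral_tsum fun n => (measurable_const.indicator (hmeas n)).aemeasurable]
  have h2 : ∀ n, ∫⁻ x, (L n).indicator (fun _ => ENNReal.ofReal (c n)) x ≤
      ENNReal.ofReal (K * (c n * ((q n * (r₀ / 2 ^ n)) * (q' n * (r₀ / 2 ^ n))))) := fun n => by
    rw [lintegral_indicator_const (hmeas n)]
    calc ENNReal.ofReal (c n) * volume (L n)
        ≤ ENNReal.ofReal (c n) *
          ENNReal.ofReal (K * ((q n * (r₀ / 2 ^ n)) * (q' n * (r₀ / 2 ^ n)))) := by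
          gcongr; exact hv n
      _ = _ := by rw [← ENNReal.ofReal_mul (hc n)]; congr 1; ring
  exact (ENNReal.tsum_le_tsum h2).trans_lt (hsum.mul_left K).tsum_ofReal_lt_top

end layers

namespace IsOrlicz

variable {f : ℝ → ℝ}

lemma div_le_div (hf : IsOrlicz f) {s t : ℝ} (hs : 0 < s) (hst : s ≤ t) : f s / s ≤ f t / t := by
  have h := hf.1.secant_mono (a := 0) (x := s) (y := t) (by simp) (by simpa using hs.le)
    (by simpa using hs.le.trans hst) hs.ne' (hs.trans_le hst).ne' hst
  simpa [hf.2.1] using h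

lemma nonneg (hf : IsOrlicz f) {t : ℝ} (ht : 0 ≤ t) : 0 ≤ f t := by
  rcases ht.eq_or_lt with rfl | ht
  · rw [hf.2.1]
  have h : 0 ≤ f t / t := by
    refine le_of_tendsto hf.2.2.1 ?_
    filter_upwards [Ioo_mem_nhdsGT ht] with s hs
    exact hf.div_le_div hs.1 hs.2.le
  have := mul_nonneg h ht.le
  rwa [div_mul_cancel₀ _ ht.ne'] at this

lemma mono (hf : IsOrlicz f) {s t : ℝ} (hs : 0 ≤ s) (hst : s ≤ t) : f s ≤ f t := by
  rcases hs.eq_or_lt with rfl | hs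
  · rw [hf.2.1]; exact hf.nonneg hst
  have h := hf.div_le_div hs hst
  rw [div_le_div_iff₀ hs (hs.trans_le hst)] at h
  nlinarith [hf.nonneg (hs.le.trans hst)]

lemma exists_mul_le (hf : IsOrlicz f) (K : ℝ) : ∃ t, 0 < t ∧ K * t ≤ f t := by
  obtain ⟨t, h1, h2⟩ := ((hf.2.2.2.eventually_ge_atTop K).and (eventually_gt_atTop 0)).exists
  exact ⟨t, h2, (le_div_iff₀ h2).1 h1⟩

/-- A Young-type inequality obtained from a single comparison point. -/
lemma mul_le_add (hf : IsOrlicz f) {a k κ t₀ t : ℝ} (ha : 0 ≤ a) (ht₀ : 0 < t₀) (ht : 0 ≤ t)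
    (hk : 0 ≤ k) (hκ : k ≤ κ) (h : κ * t₀ ≤ a * f t₀) : k * t ≤ a * f t + κ * t₀ := by
  rcases le_total t t₀ with htt | htt
  · have : k * t ≤ κ * t₀ := mul_le_mul hκ htt ht (hk.trans hκ)
    linarith [mul_nonneg ha (hf.nonneg ht)]
  · have htp := ht₀.trans_le htt
    have h1 := hf.div_le_div ht₀ htt
    have h2 : κ ≤ a * (f t₀ / t₀) := by
      rw [← mul_div_assoc, le_div_iff₀ ht₀]; exact h
    have h3 : κ ≤ a * (f t / t) := h2.trans (mul_le_mul_of_nonneg_left h1 ha)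
    rw [← mul_div_assoc, le_div_iff₀ htp] at h3
    nlinarith [mul_nonneg (hk.trans hκ) ht₀.le]

lemma exists_le_add (hf : IsOrlicz f) : ∃ c, 0 ≤ c ∧ ∀ t, 0 ≤ t → t ≤ c + f t := by
  obtain ⟨t₀, ht₀, h⟩ := hf.exists_mul_le 1
  refine ⟨t₀, ht₀.le, fun t ht => ?_⟩
  have := hf.mul_le_add (a := 1) (k := 1) (κ := 1) zero_le_one ht₀ ht zero_le_one le_rfl
    (by simpa using h)
  linarith

lemma measurable_comp (hf : IsOrlicz f) : Measurable fun t => f (max 0 t) :=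
  Monotone.measurable fun _ _ hst => hf.mono (le_max_left _ _) (max_le_max_left _ hst)

end IsOrlicz

/-- The logarithmic modulus of continuity with exponent `κ`. -/
def logWeight (κ u : ℝ) : ℝ := if u ≤ 0 then 0 else (1 + κ + Real.posLog (1 / u)) ^ (-κ)

section scales

lemma tendsto_rpow_mul_nat {e : ℝ} (he : 0 < e) (s : ℝ) :
    Tendsto (fun m : ℕ => (2 : ℝ) ^ (e * m) * (m : ℝ) ^ s) atTop atTop := by
  have h := tendsto_exp_mul_div_rpow_atTop (-s) (e * Real.log 2) (by positivity)
  refine (h.comp tendsto_natCast_atTop_atTop).congr' ?_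
  filter_upwards [eventually_gt_atTop 0] with m hm
  simp only [Function.comp]
  rw [Real.rpow_neg (by positivity), Real.rpow_def_of_pos (by norm_num : (0:ℝ) < 2), div_inv_eq_mul]
  congr 2; ring

lemma tendsto_log_scale {e : ℝ} (K : ℝ) (hK : 0 < K) (s : ℝ) :
    Tendsto (fun m : ℕ => Real.log (K * ((2 : ℝ) ^ (e * m) * (m : ℝ) ^ s)) / m) atTop
      (𝓝 (e * Real.log 2)) := by
  have h1 : Tendsto (fun m : ℕ => Real.log K / (m : ℝ)) atTop (𝓝 0) :=
    tendsto_const_nhds.div_atTop tendsto_natCast_atTop_atTop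
  have h2 : Tendsto (fun m : ℕ => Real.log (m : ℝ) / m) atTop (𝓝 0) := by
    have h := (isLittleO_log_id_atTop).tendsto_div_nhds_zero
    exact h.comp tendsto_natCast_atTop_atTop
  have h3 := (h1.add_const (e * Real.log 2)).add (h2.const_mul s)
  rw [zero_add, mul_zero, add_zero] at h3
  refine h3.congr' ?_
  filter_upwards [eventually_gt_atTop 0] with m hm
  have hm' : (0 : ℝ) < m := by exact_mod_cast hm
  rw [Real.log_mul hK.ne' (by positivity), Real.log_mul (by positivity) (by positivity),
    Real.log_rpow (by norm_num), Real.log_rpow hm']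
  field_simp
  ring

/-- Two-sided comparison of powers of a quantity growing linearly. -/
lemma rpow_comparable {x : ℕ → ℝ} {l : ℝ} (hl : 0 < l)
    (hx : Tendsto (fun m : ℕ => x m / m) atTop (𝓝 l)) (s : ℝ) :
    ∃ c C : ℝ, 0 < c ∧ 0 < C ∧ ∀ᶠ m : ℕ in atTop,
      c * (m : ℝ) ^ s ≤ x m ^ s ∧ x m ^ s ≤ C * (m : ℝ) ^ s := by
  have h := hx.rpow_const (p := s) (Or.inl hl.ne')
  have hls : 0 < l ^ s := by positivity
  refine ⟨l ^ s / 2, 2 * l ^ s, by positivity, by positivity, ?_⟩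
  filter_upwards [h.eventually (lt_mem_nhds (half_lt_self hls)),
    h.eventually (gt_mem_nhds (by linarith : l ^ s < 2 * l ^ s)), eventually_gt_atTop 0,
    hx.eventually (lt_mem_nhds hl)] with m h1 h2 hm hpos
  have hm' : (0 : ℝ) < m := by exact_mod_cast hm
  have e : x m ^ s = (x m / m) ^ s * (m : ℝ) ^ s := by
    rw [← Real.mul_rpow hpos.le hm'.le, div_mul_cancel₀ _ hm'.ne']
  rw [e]
  exact ⟨by gcongr, by gcongr⟩

lemma logWeight_scale (κ : ℝ) :
    ∃ c : ℝ, 0 < c ∧ ∀ᶠ m : ℕ in atTop,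
      c * (m : ℝ) ^ (-κ) ≤ logWeight κ (1 / 2 ^ (m + 2)) := by
  have ht : Tendsto (fun m : ℕ => (1 + κ + (m + 2) * Real.log 2) / m) atTop (𝓝 (Real.log 2)) := by
    have h1 : Tendsto (fun m : ℕ => (1 + κ + 2 * Real.log 2) / (m : ℝ)) atTop (𝓝 0) :=
      tendsto_const_nhds.div_atTop tendsto_natCast_atTop_atTop
    have h2 := h1.add_const (Real.log 2)
    rw [zero_add] at h2
    refine h2.congr' ?_
    filter_upwards [eventually_gt_atTop 0] with m hm
    have hm' : (0 : ℝ) < m := by exact_mod_cast hm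
    field_simp
    ring
  obtain ⟨c, C, hc, -, h⟩ := rpow_comparable (by positivity) ht (-κ)
  refine ⟨c, hc, ?_⟩
  filter_upwards [h] with m hm
  refine hm.1.trans_eq ?_
  rw [logWeight, if_neg (not_le.2 (by positivity)), one_div_one_div]
  congr 2
  rw [Real.posLog_eq_log, Real.log_pow]
  · push_cast; ring
  · rw [abs_of_pos (by positivity)]; exact one_le_pow₀ (by norm_num)

end scales

/-- The scale `2 ^ (e m) m ^ s`. -/
def logScale (e s : ℝ) (m : ℕ) : ℝ := (2 : ℝ) ^ (e * m) * (m : ℝ) ^ s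

lemma logScale_pos (e s : ℝ) {m : ℕ} (hm : 0 < m) : 0 < logScale e s m := by
  have : (0 : ℝ) < m := by exact_mod_cast hm
  unfold logScale; positivity

lemma tendsto_logScale {e : ℝ} (he : 0 < e) (s : ℝ) : Tendsto (logScale e s) atTop atTop :=
  tendsto_rpow_mul_nat he s

lemma logScale_ratio (e s : ℝ) :
    Tendsto (fun m : ℕ => logScale e s (m + 1) / logScale e s m) atTop (𝓝 (2 ^ e)) := by
  have h1 : Tendsto (fun m : ℕ => ((m + 1 : ℕ) : ℝ) / m) atTop (𝓝 1) := by
    have h : Tendsto (fun m : ℕ => 1 + 1 / (m : ℝ)) atTop (𝓝 (1 + 0)) :=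
      tendsto_const_nhds.add (tendsto_const_nhds.div_atTop tendsto_natCast_atTop_atTop)
    rw [add_zero] at h
    refine h.congr' ?_
    filter_upwards [eventually_gt_atTop 0] with m hm
    have hm' : (0 : ℝ) < m := by exact_mod_cast hm
    push_cast
    field_simp
  have h2 := (h1.rpow_const (p := s) (Or.inl one_ne_zero)).const_mul ((2 : ℝ) ^ e)
  rw [Real.one_rpow, mul_one] at h2
  refine h2.congr' ?_
  filter_upwards [eventually_gt_atTop 0] with m hm
  have hm' : (0 : ℝ) < m := by exact_mod_cast hm
  have e1 : (2 : ℝ) ^ (e * ((m + 1 : ℕ) : ℝ)) = 2 ^ (e * m) * 2 ^ e := by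
    rw [← Real.rpow_add (by norm_num)]; push_cast; ring_nf
  rw [logScale, logScale, e1, Real.div_rpow (by positivity) hm'.le]
  field_simp

lemma exists_geomGrowth {e : ℝ} (he : 0 < e) (he1 : e < 1) (s : ℝ) : ∃ ρ₁ ρ₂ : ℝ,
    ∀ᶠ n₀ : ℕ in atTop, GeomGrowth ρ₁ ρ₂ (fun n => logScale e s (n + n₀)) ∧
      GeomGrowth.cellConst ρ₂ * (1 / 2 ^ n₀) ≤ 1 / 16 := by
  have hR1 : (1 : ℝ) < 2 ^ e := Real.one_lt_rpow (by norm_num) he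
  have hR2 : (2 : ℝ) ^ e < 2 := by
    have := Real.rpow_lt_rpow_of_exponent_lt (by norm_num : (1:ℝ) < 2) he1
    rwa [Real.rpow_one] at this
  refine ⟨(1 + 2 ^ e) / 2, (2 ^ e + 2) / 2, ?_⟩
  have h1 := ((logScale_ratio e s).eventually (lt_mem_nhds
    (by linarith : (1 + (2 : ℝ) ^ e) / 2 < 2 ^ e))).and ((logScale_ratio e s).eventually
      (gt_mem_nhds (by linarith : (2 : ℝ) ^ e < (2 ^ e + 2) / 2)))
  have h2 := eventually_forall_ge_atTop.2 (h1.and (eventually_gt_atTop 0))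
  have h3 := (tendsto_logScale he s).eventually_ge_atTop 1
  have h4 : Tendsto (fun n₀ : ℕ => GeomGrowth.cellConst ((2 ^ e + 2) / 2) * (1 / 2 ^ n₀)) atTop (𝓝 0) := by
    have := (tendsto_pow_atTop_nhds_zero_of_lt_one (by norm_num : (0:ℝ) ≤ 1/2)
      (by norm_num)).const_mul (GeomGrowth.cellConst ((2 ^ e + 2) / 2))
    simpa using this
  filter_upwards [h2, h3, h4.eventually (gt_mem_nhds (by norm_num : (0:ℝ) < 1/16))] with
    n₀ a2 a3 a4
  refine ⟨⟨by linarith, by linarith, by simpa using a3, fun n => ?_, fun n => ?_⟩, a4.le⟩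
  · obtain ⟨⟨b1, -⟩, b3⟩ := a2 (n + n₀) (by omega)
    rw [show n + 1 + n₀ = n + n₀ + 1 by ring]
    exact ((lt_div_iff₀ (logScale_pos e s b3)).1 b1).le
  · obtain ⟨⟨-, b2⟩, b3⟩ := a2 (n + n₀) (by omega)
    rw [show n + 1 + n₀ = n + n₀ + 1 by ring]
    exact ((div_lt_iff₀ (logScale_pos e s b3)).1 b2).le

lemma two_pow_div_logScale (e s : ℝ) {m : ℕ} (hm : 0 < m) :
    (2 : ℝ) ^ m / logScale e s m = logScale (1 - e) (-s) m := by
  have hm' : (0 : ℝ) < m := by exact_mod_cast hm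
  rw [logScale, logScale, Real.rpow_neg hm'.le, div_mul_eq_div_div, ← Real.rpow_natCast,
    ← Real.rpow_sub (by norm_num), div_eq_mul_inv]
  congr 2; ring

lemma logScale_mul (e s e' s' : ℝ) {m : ℕ} (hm : 0 < m) :
    logScale e s m * logScale e' s' m = logScale (e + e') (s + s') m := by
  have hm' : (0 : ℝ) < m := by exact_mod_cast hm
  simp only [logScale]
  rw [Real.rpow_add hm', add_mul, Real.rpow_add (by norm_num)]; ring

lemma logScale_rpow (e s r : ℝ) (m : ℕ) :
    logScale e s m ^ r = logScale (e * r) (s * r) m := by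
  simp only [logScale]
  rw [Real.mul_rpow (by positivity) (by positivity), ← Real.rpow_mul (by positivity),
    ← Real.rpow_mul (by positivity)]
  congr 2; ring

lemma logScale_inv (e s : ℝ) {m : ℕ} (hm : 0 < m) :
    (logScale e s m)⁻¹ = logScale (-e) (-s) m := by
  have hm' : (0 : ℝ) < m := by exact_mod_cast hm
  rw [logScale, logScale, mul_inv, neg_mul, Real.rpow_neg (by norm_num), Real.rpow_neg hm'.le]

lemma logScale_zero (s : ℝ) (m : ℕ) : logScale 0 s m = (m : ℝ) ^ s := by simp [logScale]

variable {f : ℝ → ℝ} {p s c₁ c₂ T : ℝ}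

/-- Upper bound of a log-perturbed power along a scale. -/
lemma eventually_le_logScale {e : ℝ} (he : 0 < e) (u : ℝ)
    (hbd : ∀ t, T ≤ t → f t ≤ c₂ * t ^ p * Real.log t ^ s) (hc₂ : 0 < c₂) {K : ℝ} (hK : 0 < K) :
    ∃ C, 0 < C ∧ ∀ᶠ m : ℕ in atTop,
      f (K * logScale e u m) ≤ C * (logScale e u m ^ p * (m : ℝ) ^ s) := by
  obtain ⟨_, C, -, hC, h⟩ := rpow_comparable (mul_pos he (Real.log_pos one_lt_two)) (tendsto_log_scale (e := e) K hK u) s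
  refine ⟨c₂ * K ^ p * C, by positivity, ?_⟩
  filter_upwards [h, (tendsto_logScale he u).const_mul_atTop hK |>.eventually_ge_atTop T,
    eventually_gt_atTop 0] with m h1 h2 hm
  have hp := logScale_pos e u hm
  refine (hbd _ h2).trans ?_
  rw [Real.mul_rpow hK.le hp.le]
  calc c₂ * (K ^ p * logScale e u m ^ p) * Real.log (K * logScale e u m) ^ s
      ≤ c₂ * (K ^ p * logScale e u m ^ p) * (C * (m : ℝ) ^ s) := by gcongr; exact h1.2
    _ = _ := by ring

/-- Lower bound of a log-perturbed power along a scale. -/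
lemma eventually_logScale_le {e : ℝ} (he : 0 < e) (u : ℝ)
    (hbd : ∀ t, T ≤ t → c₁ * t ^ p * Real.log t ^ s ≤ f t) (hc₁ : 0 < c₁) :
    ∃ c, 0 < c ∧ ∀ᶠ m : ℕ in atTop,
      c * (logScale e u m ^ p * (m : ℝ) ^ s) ≤ f (logScale e u m) := by
  obtain ⟨c, _, hc, -, h⟩ := rpow_comparable (mul_pos he (Real.log_pos one_lt_two))
    (tendsto_log_scale (e := e) 1 one_pos u) s
  refine ⟨c₁ * c, by positivity, ?_⟩
  filter_upwards [h, (tendsto_logScale he u).eventually_ge_atTop T,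
    eventually_gt_atTop 0] with m h1 h2 hm
  have hp := logScale_pos e u hm
  refine le_trans ?_ (hbd _ h2)
  have h3 := h1.1
  rw [one_mul] at h3
  calc c₁ * c * (logScale e u m ^ p * (m : ℝ) ^ s)
      = c₁ * logScale e u m ^ p * (c * (m : ℝ) ^ s) := by ring
    _ ≤ _ := by gcongr; exact h3

lemma logWeight_pos {κ u : ℝ} (hκ : 0 ≤ κ) (hu : 0 < u) : 0 < logWeight κ u := by
  rw [logWeight, if_neg (not_le.2 hu)]
  have := Real.posLog_nonneg (x := 1 / u)
  positivity

lemma summable_of_eventually_le_rpow {f : ℕ → ℝ} {C s : ℝ} (hs : 1 < s) (h0 : ∀ᶠ m in atTop, 0 ≤ f m)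
    (h : ∀ᶠ m : ℕ in atTop, f m ≤ C * (m : ℝ) ^ (-s)) : Summable f := by
  refine Summable.of_norm_bounded_eventually_nat
    ((Real.summable_nat_rpow.2 (by linarith : -s < -1)).mul_left C) ?_
  filter_upwards [h0, h] with m h1 h2
  rwa [Real.norm_of_nonneg h1]

/-- Choice of the comparison points for Young's inequality on the layers. -/
lemma exists_young_points {p α κ γ : ℝ} (hp : 1 < p) (hκ : 0 ≤ κ) (hγ : γ < α - κ - (p - 1))
    {ψ : ℝ → ℝ} (hψ : IsOrlicz ψ) {c₁ T : ℝ} (hc₁ : 0 < c₁)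
    (hbd : ∀ t, T ≤ t → c₁ * t ^ p * Real.log t ^ α ≤ ψ t) {K : ℝ} (hK : 0 < K) :
    ∃ t : ℕ → ℝ, (∀ m, 0 < m → 0 < t m ∧ K * logScale ((p - 1) / (2 * p)) γ m * t m ≤
        logWeight κ (1 / 2 ^ (m + 2)) * ψ (t m)) ∧
      Summable fun m => K * logScale ((p - 1) / (2 * p)) γ m * t m *
        ((logScale ((p - 1) / (2 * p)) γ m)⁻¹ * (logScale (1 / (2 * p)) 0 m)⁻¹) := by
  have hp0 : 0 < p := by linarith
  have he2 : 0 < 1 / (2 * p) := by positivity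
  obtain ⟨σ, hσ1, hσ2⟩ := exists_between
    ((lt_div_iff₀ (by linarith : 0 < p - 1)).2 (by linarith : 1 * (p - 1) < α - κ - γ))
  rw [lt_div_iff₀ (by linarith)] at hσ2
  set B := logScale ((p - 1) / (2 * p)) γ with hB
  set A := logScale (1 / (2 * p)) 0 with hA
  obtain ⟨c, hc, h1⟩ := logWeight_scale κ
  obtain ⟨c', hc', h2⟩ := eventually_logScale_le he2 (-σ) hbd hc₁
  have h3 : ∀ᶠ m : ℕ in atTop, K / (c * c') ≤ (m : ℝ) ^ (α - κ - γ - σ * (p - 1)) :=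
    ((tendsto_rpow_atTop (by linarith)).comp
      tendsto_natCast_atTop_atTop).eventually_ge_atTop _
  set t₀ := logScale (1 / (2 * p)) (-σ) with ht₀
  have hgood : ∀ᶠ m : ℕ in atTop, K * B m * t₀ m ≤
      logWeight κ (1 / 2 ^ (m + 2)) * ψ (t₀ m) := by
    filter_upwards [h1, h2, h3, eventually_gt_atTop 0] with m b1 b2 b3 hm
    have hm' : (0 : ℝ) < m := by exact_mod_cast hm
    rw [div_le_iff₀ (by positivity)] at b3
    have hS := logScale_pos (1 / 2) (γ - σ) hm
    have e1 : B m * t₀ m = logScale (1 / 2) (γ - σ) m := by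
      rw [hB, ht₀, logScale_mul _ _ _ _ hm]
      congr 1
      field_simp; ring
    have e2 : (m : ℝ) ^ (-κ) * (t₀ m ^ p * (m : ℝ) ^ α) =
        logScale (1 / 2) (γ - σ) m * (m : ℝ) ^ (α - κ - γ - σ * (p - 1)) := by
      rw [ht₀, logScale_rpow, ← logScale_zero, ← logScale_zero, ← logScale_zero,
        logScale_mul _ _ _ _ hm, logScale_mul _ _ _ _ hm, logScale_mul _ _ _ _ hm]
      congr 1
      · field_simp; ring
      · ring
    have hpos : 0 < t₀ m ^ p * (m : ℝ) ^ α := by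
      have := logScale_pos (1 / (2 * p)) (-σ) hm
      positivity
    calc K * B m * t₀ m = K * logScale (1 / 2) (γ - σ) m := by rw [mul_assoc, e1]
      _ ≤ ((m : ℝ) ^ (α - κ - γ - σ * (p - 1)) * (c * c')) * logScale (1 / 2) (γ - σ) m := by
        gcongr
      _ = (c * (m : ℝ) ^ (-κ)) * (c' * (t₀ m ^ p * (m : ℝ) ^ α)) := by
        linear_combination (-c * c') * e2
      _ ≤ _ := mul_le_mul b1 b2 (by positivity) ((by positivity : 0 ≤ c * (m : ℝ) ^ (-κ)).trans b1)
  classical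
  have hex : ∀ m : ℕ, ∃ t, 0 < m → (0 < t ∧ K * B m * t ≤
      logWeight κ (1 / 2 ^ (m + 2)) * ψ t) ∧ (K * B m * t₀ m ≤
      logWeight κ (1 / 2 ^ (m + 2)) * ψ (t₀ m) → t = t₀ m) := fun m => by
    by_cases hm : K * B m * t₀ m ≤ logWeight κ (1 / 2 ^ (m + 2)) * ψ (t₀ m)
    · exact ⟨t₀ m, fun h => ⟨⟨logScale_pos _ _ h, hm⟩, fun _ => rfl⟩⟩
    · have hw := logWeight_pos hκ (by positivity : (0 : ℝ) < 1 / 2 ^ (m + 2))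
      obtain ⟨t, ht, hKt⟩ := hψ.exists_mul_le (K * B m / logWeight κ (1 / 2 ^ (m + 2)))
      refine ⟨t, fun _ => ⟨⟨ht, ?_⟩, fun h => absurd h hm⟩⟩
      rw [div_mul_eq_mul_div, div_le_iff₀ hw] at hKt
      linarith
  choose t ht using hex
  refine ⟨t, fun m hm => (ht m hm).1, summable_of_eventually_le_rpow (C := K) hσ1 ?_ ?_⟩
  · filter_upwards [eventually_gt_atTop 0] with m hm
    have h1 := logScale_pos ((p - 1) / (2 * p)) γ hm
    have h2 := logScale_pos (1 / (2 * p)) 0 hm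
    have h3 := (ht m hm).1.1
    positivity
  · filter_upwards [hgood, eventually_gt_atTop 0] with m h hm
    rw [(ht m hm).2 h]
    have h1 := logScale_pos ((p - 1) / (2 * p)) γ hm
    have e : K * B m * t₀ m * ((B m)⁻¹ * (A m)⁻¹) = K * (t₀ m * (A m)⁻¹) := by
      rw [← hB] at h1
      field_simp
    rw [e, ht₀, hA, logScale_inv _ _ hm, logScale_mul _ _ _ _ hm, add_neg_cancel, logScale_zero]
    simp

lemma summable_energy {p β γ : ℝ} (hp : 1 < p) (hγ : 1 - β < γ)
    {φ : ℝ → ℝ} (hφ : IsOrlicz φ) {c₂ T : ℝ} (hc₂ : 0 < c₂)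
    (hbd : ∀ t, T ≤ t → φ t ≤ c₂ * t ^ p * Real.log t ^ (-β)) {K : ℝ} (hK : 0 < K) :
    Summable fun m => φ (K * logScale (1 / (2 * p)) 0 m) *
        ((logScale ((p - 1) / (2 * p)) γ m)⁻¹ * (logScale (1 / (2 * p)) 0 m)⁻¹) := by
  have hp0 : 0 < p := by linarith
  obtain ⟨C, hC, h⟩ := eventually_le_logScale (by positivity : 0 < 1 / (2 * p)) 0 hbd hc₂ hK
  refine summable_of_eventually_le_rpow (C := C) (by linarith : 1 < β + γ) ?_ ?_
  · filter_upwards [eventually_gt_atTop 0] with m hm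
    have h1 := logScale_pos ((p - 1) / (2 * p)) γ hm
    have h2 := logScale_pos (1 / (2 * p)) 0 hm
    have h3 := hφ.nonneg (t := K * logScale (1 / (2 * p)) 0 m) (by positivity)
    positivity
  · filter_upwards [h, eventually_gt_atTop 0] with m h hm
    have h1 := logScale_pos ((p - 1) / (2 * p)) γ hm
    have h2 := logScale_pos (1 / (2 * p)) 0 hm
    refine (mul_le_mul_of_nonneg_right h (by positivity)).trans_eq ?_
    rw [mul_assoc]
    congr 1
    rw [logScale_rpow, ← logScale_zero, ← logScale_zero, logScale_inv _ _ hm, logScale_inv _ _ hm,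
      logScale_mul _ _ _ _ hm, logScale_mul _ _ _ _ hm, logScale_mul _ _ _ _ hm]
    congr 1
    · field_simp; ring
    · ring

/-- The two geometric sequences driving the construction, with the summability properties used for
the energy and for the dual estimate. -/
lemma exists_scales {p α β κ : ℝ} (hp : 1 < p) (hκ : 0 ≤ κ) (hαβ : p + κ < α + β)
    {φ ψ : ℝ → ℝ} (hφ : IsOrlicz φ) (hψ : IsOrlicz ψ) {c₁ c₂ T : ℝ} (hc₁ : 0 < c₁) (hc₂ : 0 < c₂)
    (hφbd : ∀ t, T ≤ t → φ t ≤ c₂ * t ^ p * Real.log t ^ (-β))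
    (hψbd : ∀ t, T ≤ t → c₁ * t ^ p * Real.log t ^ α ≤ ψ t) :
    ∃ (r₀ : ℝ) (q₁ q₂ : ℕ → ℝ) (_ : CantorPair r₀ q₁) (_ : CantorPair r₀ q₂),
      0 < r₀ ∧ r₀ ≤ 1 / 16 ∧ (∀ n, 0 < q₁ n) ∧ (∀ n, 0 < q₂ n) ∧
      (∀ K, 0 < K → Summable fun n => φ (K * (2 ^ n / (r₀ * q₂ n))) *
        ((q₁ n * (r₀ / 2 ^ n)) * (q₂ n * (r₀ / 2 ^ n)))) ∧
      (∀ K, 0 < K → ∃ t : ℕ → ℝ, (∀ n, 0 < t n ∧ K * (2 ^ n / (r₀ * q₁ n)) * t n ≤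
          logWeight κ (r₀ / 2 ^ (n + 2)) * ψ (t n)) ∧
        Summable fun n => K * (2 ^ n / (r₀ * q₁ n)) * t n *
          ((q₁ n * (r₀ / 2 ^ n)) * (q₂ n * (r₀ / 2 ^ n)))) := by
  have hp0 : 0 < p := by linarith
  obtain ⟨γ, hγ1, hγ2⟩ := exists_between (by linarith : 1 - β < α - κ - (p - 1))
  have he1 : 0 < 1 - (p - 1) / (2 * p) ∧ 1 - (p - 1) / (2 * p) < 1 := by
    have h1 : (p - 1) / (2 * p) < 1 := by rw [div_lt_one (by positivity)]; linarith
    have h2 : 0 < (p - 1) / (2 * p) := div_pos (by linarith) (by positivity)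
    constructor <;> linarith
  have he2 : 0 < 1 - 1 / (2 * p) ∧ 1 - 1 / (2 * p) < 1 := by
    have h1 : 1 / (2 * p) < 1 := by rw [div_lt_one (by positivity)]; linarith
    have h2 : 0 < 1 / (2 * p) := by positivity
    constructor <;> linarith
  obtain ⟨ρ₁, ρ₂, g1⟩ := exists_geomGrowth he1.1 he1.2 (-γ)
  obtain ⟨ρ₁', ρ₂', g2⟩ := exists_geomGrowth he2.1 he2.2 0
  obtain ⟨n₀, ⟨⟨G1, s1⟩, ⟨G2, s2⟩⟩, hn₀⟩ := ((g1.and g2).and (eventually_ge_atTop 4)).exists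
  set r₀ : ℝ := 1 / 2 ^ n₀ with hr₀
  have hr : 0 < r₀ := by positivity
  set q₁ : ℕ → ℝ := fun n => logScale (1 - (p - 1) / (2 * p)) (-γ) (n + n₀) with hq₁
  set q₂ : ℕ → ℝ := fun n => logScale (1 - 1 / (2 * p)) 0 (n + n₀) with hq₂
  have hm : ∀ n, 0 < n + n₀ := fun n => by omega
  have hp1 : ∀ n, 0 < q₁ n := fun n => logScale_pos _ _ (hm n)
  have hp2 : ∀ n, 0 < q₂ n := fun n => logScale_pos _ _ (hm n)
  have eB : ∀ n, 2 ^ n / (r₀ * q₁ n) = logScale ((p - 1) / (2 * p)) γ (n + n₀) := fun n => by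
    have := two_pow_div_logScale (1 - (p - 1) / (2 * p)) (-γ) (hm n)
    rw [sub_sub_cancel, neg_neg] at this
    rw [← this, hr₀, hq₁, pow_add]
    field_simp
  have eA : ∀ n, 2 ^ n / (r₀ * q₂ n) = logScale (1 / (2 * p)) 0 (n + n₀) := fun n => by
    have := two_pow_div_logScale (1 - 1 / (2 * p)) 0 (hm n)
    rw [sub_sub_cancel, neg_zero] at this
    rw [← this, hr₀, hq₂, pow_add]
    field_simp
  have iB : ∀ n, q₁ n * (r₀ / 2 ^ n) = (logScale ((p - 1) / (2 * p)) γ (n + n₀))⁻¹ := fun n => by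
    rw [← eB, inv_div]; ring
  have iA : ∀ n, q₂ n * (r₀ / 2 ^ n) = (logScale (1 / (2 * p)) 0 (n + n₀))⁻¹ := fun n => by
    rw [← eA, inv_div]; ring
  refine ⟨r₀, q₁, q₂, G1.cantorPair hr s1, G2.cantorPair hr s2, hr, ?_, hp1, hp2,
    fun K hK => ?_, fun K hK => ?_⟩
  · rw [hr₀]
    have : (2 : ℝ) ^ 4 ≤ 2 ^ n₀ := pow_le_pow_right₀ (by norm_num) hn₀
    exact one_div_le_one_div_of_le (by norm_num) (by linarith)
  · simp only [eA, iA, iB]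
    exact (summable_nat_add_iff n₀).2 (summable_energy hp hγ1 hφ hc₂ hφbd hK)
  · obtain ⟨t, ht, hs⟩ := exists_young_points hp hκ hγ2 hψ hc₁ hψbd hK
    refine ⟨fun n => t (n + n₀), fun n => ?_, ?_⟩
    · have e : r₀ / 2 ^ (n + 2) = 1 / 2 ^ (n + n₀ + 2) := by
        rw [hr₀, div_div, ← pow_add]; congr 2; ring
      rw [eB, e]
      exact ht _ (hm n)
    · simp only [eB, iA, iB]
      exact (summable_nat_add_iff n₀).2 hs

section weight

variable {κ : ℝ}

lemma logWeight_of_nonpos {u : ℝ} (hu : u ≤ 0) : logWeight κ u = 0 := if_pos hu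

lemma logWeight_nonneg (hκ : 0 ≤ κ) (u : ℝ) : 0 ≤ logWeight κ u := by
  rcases le_or_gt u 0 with h | h
  · rw [logWeight_of_nonpos h]
  · exact (logWeight_pos hκ h).le

lemma logWeight_le_one (hκ : 0 ≤ κ) (u : ℝ) : logWeight κ u ≤ 1 := by
  rw [logWeight]
  split_ifs
  · exact zero_le_one
  · exact rpow_le_one_of_one_le_of_nonpos (by linarith [@posLog_nonneg (1 / u)]) (by linarith)

lemma logWeight_mono (hκ : 0 ≤ κ) : Monotone (logWeight κ) := fun u v huv => by
  rcases le_or_gt u 0 with h | h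
  · rw [logWeight_of_nonpos h]; exact logWeight_nonneg hκ v
  · rw [logWeight, logWeight, if_neg h.not_ge, if_neg (h.trans_le huv).not_ge]
    have h1 : Real.posLog (1 / v) ≤ Real.posLog (1 / u) :=
      posLog_le_posLog (by have := h.trans_le huv; positivity) (one_div_le_one_div_of_le h huv)
    exact rpow_le_rpow_of_nonpos (by linarith [@posLog_nonneg (1 / v)]) (by linarith) (by linarith)

lemma logWeight_div_anti (hκ : 0 ≤ κ) {u v : ℝ} (hu : 0 < u) (huv : u ≤ v) :
    logWeight κ v * u ≤ logWeight κ u * v := by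
  have hv := hu.trans_le huv
  rw [logWeight, logWeight, if_neg hu.not_ge, if_neg hv.not_ge]
  set A := 1 + κ + Real.posLog (1 / u) with hA
  set B := 1 + κ + Real.posLog (1 / v) with hB
  have hBp : 1 + κ ≤ B := by linarith [@posLog_nonneg (1 / v)]
  have hAp : 1 + κ ≤ A := by linarith [@posLog_nonneg (1 / u)]
  have hB0 : 0 < B := by linarith
  have hA0 : 0 < A := by linarith
  have hl : 0 ≤ Real.log (v / u) := Real.log_nonneg ((one_le_div hu).2 huv)
  have hAB : A ≤ B + Real.log (v / u) := by
    have h1 : Real.posLog (1 / u) ≤ Real.posLog (1 / v) + Real.posLog (v / u) := by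
      have := posLog_mul (x := 1 / v) (y := v / u)
      rwa [show 1 / v * (v / u) = 1 / u by field_simp] at this
    have h2 : Real.posLog (v / u) = Real.log (v / u) :=
      posLog_eq_log (by rw [abs_of_pos (by positivity)]; exact (one_le_div hu).2 huv)
    linarith
  have h3 : A ≤ B * Real.exp (Real.log (v / u) / (1 + κ)) := by
    have := Real.add_one_le_exp (Real.log (v / u) / (1 + κ))
    have h4 : Real.log (v / u) ≤ B * (Real.log (v / u) / (1 + κ)) := by
      rw [mul_div_assoc', le_div_iff₀ (by linarith)]; nlinarith
    nlinarith
  have h5 : A ^ κ ≤ B ^ κ * (v / u) := by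
    calc A ^ κ ≤ (B * Real.exp (Real.log (v / u) / (1 + κ))) ^ κ := rpow_le_rpow hA0.le h3 hκ
      _ = B ^ κ * Real.exp (Real.log (v / u) / (1 + κ) * κ) := by
          rw [mul_rpow hB0.le (exp_pos _).le, ← Real.exp_mul]
      _ ≤ B ^ κ * Real.exp (Real.log (v / u)) := by
          gcongr
          rw [div_mul_eq_mul_div, div_le_iff₀ (by linarith)]; nlinarith
      _ = B ^ κ * (v / u) := by rw [Real.exp_log (by positivity)]
  rw [rpow_neg hB0.le, rpow_neg hA0.le, inv_mul_eq_div, inv_mul_eq_div,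
    div_le_div_iff₀ (by positivity) (by positivity)]
  have := mul_le_mul_of_nonneg_right h5 hu.le
  rw [mul_assoc, div_mul_cancel₀ _ hu.ne'] at this
  linarith

lemma logWeight_sub_le (hκ : 0 ≤ κ) {u v : ℝ} (huv : v < u) :
    logWeight κ u - logWeight κ v ≤ logWeight κ (u - v) := by
  rcases le_or_gt v 0 with h | h
  · rw [logWeight_of_nonpos h]
    rw [sub_zero]; exact logWeight_mono hκ (by linarith)
  · have h1 := logWeight_div_anti hκ h huv.le
    have h2 := logWeight_div_anti hκ (sub_pos.2 huv) (show u - v ≤ u by linarith)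
    have h3 : logWeight κ u * u ≤ (logWeight κ v + logWeight κ (u - v)) * u := by nlinarith
    linarith [le_of_mul_le_mul_right h3 (h.trans huv)]

lemma abs_logWeight_sub_le (hκ : 0 ≤ κ) {u v r : ℝ} (hr : 0 < r) (hr' : r ≤ 1 / 2)
    (huv : |u - v| ≤ 3 * r) :
    |logWeight κ u - logWeight κ v| ≤ 3 * Real.log (1 / r) ^ (-κ) := by
  wlog h : v ≤ u generalizing u v
  · rw [abs_sub_comm]
    exact this (by rwa [abs_sub_comm]) (le_of_not_ge h)
  have hl : 0 < Real.log (1 / r) := Real.log_pos (by rw [lt_div_iff₀ hr]; linarith)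
  rw [abs_of_nonneg (sub_nonneg.2 (logWeight_mono hκ h))]
  rcases h.eq_or_lt with rfl | h'
  · rw [sub_self]; positivity
  have h1 := logWeight_sub_le hκ h'
  have h2 : logWeight κ (u - v) ≤ logWeight κ (3 * r) :=
    logWeight_mono hκ ((le_abs_self _).trans huv)
  have h3 := logWeight_div_anti hκ hr (show r ≤ 3 * r by linarith)
  have h4 : logWeight κ (3 * r) ≤ 3 * logWeight κ r := by
    refine le_of_mul_le_mul_right ?_ hr; linarith
  have h5 : logWeight κ r ≤ Real.log (1 / r) ^ (-κ) := by
    rw [logWeight, if_neg hr.not_ge]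
    refine rpow_le_rpow_of_nonpos hl ?_ (by linarith)
    rw [posLog_eq_log]
    · linarith
    · rw [abs_of_pos (by positivity), le_div_iff₀ hr]; linarith
  linarith

/-- The weight, written in terms of the distances to two closed sets in two coordinates. -/
def distWeight {N : ℕ} (κ : ℝ) (C C' : Set ℝ) (i j : Fin N) (x : Euc N) : ℝ :=
  logWeight κ (Metric.infDist (x j) C' - 2 * Metric.infDist (x i) C)

lemma distWeight_nonneg {N : ℕ} (hκ : 0 ≤ κ) (C C' : Set ℝ) (i j : Fin N) (x : Euc N) :
    0 ≤ distWeight κ C C' i j x :=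
  logWeight_nonneg hκ _

lemma distWeight_le_one {N : ℕ} (hκ : 0 ≤ κ) (C C' : Set ℝ) (i j : Fin N) (x : Euc N) :
    distWeight κ C C' i j x ≤ 1 :=
  logWeight_le_one hκ _

lemma measurable_distWeight {N : ℕ} (hκ : 0 ≤ κ) (C C' : Set ℝ) (i j : Fin N) :
    Measurable (distWeight κ C C' i j) := by
  refine (logWeight_mono hκ).measurable.comp (Continuous.measurable ?_)
  have h1 := (Metric.continuous_infDist_pt C').comp (contDiff_coord (N := N) j).continuous
  have h2 := (Metric.continuous_infDist_pt C).comp (contDiff_coord (N := N) i).continuous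
  exact h1.sub (continuous_const.mul h2)

lemma abs_coord_le_norm {N : ℕ} (x : Euc N) (i : Fin N) : |x i| ≤ ‖x‖ := by
  simpa using PiLp.norm_apply_le x i

lemma abs_distWeight_sub_le {N : ℕ} (hκ : 0 ≤ κ) (C C' : Set ℝ) (i j : Fin N) {x y : Euc N}
    (hr : 0 < dist x y) (hr' : dist x y ≤ 1 / 2) :
    |distWeight κ C C' i j x - distWeight κ C C' i j y|
      ≤ 3 * Real.log (1 / dist x y) ^ (-κ) := by
  refine abs_logWeight_sub_le hκ hr hr' ?_
  have h : ∀ (k : Fin N) (D : Set ℝ),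
      |Metric.infDist (x k) D - Metric.infDist (y k) D| ≤ dist x y := fun k D => by
    have h1 := (Metric.lipschitz_infDist_pt D).dist_le_mul (x k) (y k)
    rw [NNReal.coe_one, one_mul, Real.dist_eq] at h1
    refine h1.trans ?_
    have := abs_coord_le_norm (x - y) k
    rwa [dist_eq_norm]
  have h1 := abs_le.1 (h i C)
  have h2 := abs_le.1 (h j C')
  rw [abs_le]
  constructor <;> linarith [h1.1, h1.2, h2.1, h2.2]

end weight

section pair

variable {N : ℕ} {r₀ κ X : ℝ} {q₁ q₂ : ℕ → ℝ} (P₁ : CantorPair r₀ q₁) (P₂ : CantorPair r₀ q₂)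
  {i j : Fin N} {φ ψ : ℝ → ℝ}

lemma fderiv_stairMix_swap_eq_zero (hr : 0 < r₀) (hq : ∀ n, 0 < q₁ n) {x : Euc N}
    (hx : x j ∉ P₂.C) (h : fderiv ℝ (stairMix P₁ P₂.C j i) x ≠ 0) :
    fderiv ℝ (stairMix P₂ P₁.C i j) x = 0 := by
  obtain ⟨K, hK, hb⟩ := exists_stairMix_layer
  obtain ⟨n, -, h1, h2, -⟩ := hb N r₀ q₁ P₁ P₂.C j i hr hq P₂.isClosedUnbdd x hx h
  refine fderiv_stairMix_eq_zero P₂ i j P₁.isClosedUnbdd ?_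
  have : 0 < r₀ / 2 ^ (n + 1) := by positivity
  linarith

lemma stairMix_swap_eq (hr : 0 < r₀) (hq : ∀ n, 0 < q₁ n) {x : Euc N}
    (hx : x j ∉ P₂.C) (h : fderiv ℝ (stairMix P₁ P₂.C j i) x ≠ 0) :
    stairMix P₂ P₁.C i j x = P₂.F (x j) := by
  obtain ⟨K, hK, hb⟩ := exists_stairMix_layer
  obtain ⟨n, -, h1, h2, -⟩ := hb N r₀ q₁ P₁ P₂.C j i hr hq P₂.isClosedUnbdd x hx h
  refine stairMix_eq P₂ i j P₁.isClosedUnbdd ?_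
  have : 0 < r₀ / 2 ^ (n + 1) := by positivity
  linarith

lemma distWeight_eq_zero (hr : 0 < r₀) (hq : ∀ n, 0 < q₂ n) {x : Euc N}
    (hx : x i ∉ P₁.C) (h : fderiv ℝ (stairMix P₂ P₁.C i j) x ≠ 0) :
    distWeight κ P₁.C P₂.C i j x = 0 := by
  obtain ⟨K, hK, hb⟩ := exists_stairMix_layer
  obtain ⟨n, -, h1, h2, -⟩ := hb N r₀ q₂ P₂ P₁.C i j hr hq P₁.isClosedUnbdd x hx h
  refine logWeight_of_nonpos ?_
  have : 0 < r₀ / 2 ^ (n + 1) := by positivity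
  linarith

lemma lintegral_fderiv_stairMix_lt_top (hφ : IsOrlicz φ) (hX : 0 < X) (hr : 0 < r₀)
    (hq₁ : ∀ n, 0 < q₁ n) (hq₂ : ∀ n, 0 < q₂ n) (hij : i ≠ j)
    (hsum : ∀ K > 0, Summable fun n => φ (K * (2 ^ n / (r₀ * q₂ n))) *
      ((q₁ n * (r₀ / 2 ^ n)) * (q₂ n * (r₀ / 2 ^ n)))) :
    ∫⁻ x in {x : Euc N | ∀ k, |x k| ≤ X},
      ENNReal.ofReal (φ (2 * ‖fderiv ℝ (stairMix P₂ P₁.C i j) x‖)) < ⊤ := by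
  obtain ⟨K, hK, hb⟩ := exists_stairMix_layer
  have hA : ∀ n, 0 < 2 ^ n / (r₀ * q₂ n) := fun n => by have := hq₂ n; positivity
  refine (setLIntegral_mono_ae (measurable_layerSum X r₀ P₁.C P₂.C i j
    (fun n => φ (2 * K * (2 ^ n / (r₀ * q₂ n))))).aemeasurable ?_).trans_lt
    ((setLIntegral_le_lintegral _ _).trans_lt (lintegral_layerSum_lt_top hX hr P₁ P₂ (hq₁ 0)
      (hq₂ 0) hij (fun n => hφ.nonneg (by have := hA n; positivity))
      (hsum (2 * K) (by positivity))))
  filter_upwards [ae_coord_notMem P₁.null i] with x hx hxX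
  by_cases h : fderiv ℝ (stairMix P₂ P₁.C i j) x = 0
  · rw [h, norm_zero, mul_zero, hφ.2.1, ENNReal.ofReal_zero]; exact zero_le
  obtain ⟨n, h0, h1, h2, h3⟩ := hb N r₀ q₂ P₂ P₁.C i j hr hq₂ P₁.isClosedUnbdd x hx h
  have hs : 0 < r₀ / 2 ^ n := by positivity
  have hl : x ∈ layer X r₀ P₁.C P₂.C i j n :=
    ⟨hxX, h3.imp id fun h => ⟨by linarith, by linarith⟩⟩
  refine le_trans (ENNReal.ofReal_le_ofReal ?_)
    (le_layerSum hl fun n => φ (2 * K * (2 ^ n / (r₀ * q₂ n))))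
  exact hφ.mono (by positivity) (by linarith)

/-- A Young inequality between the gradient of the dual mixture and the weighted modular, with
integrable remainder. -/
lemma exists_young_remainder (hψ : IsOrlicz ψ) (hκ : 0 ≤ κ) (hX : 0 < X) (hr : 0 < r₀)
    (hq₁ : ∀ n, 0 < q₁ n) (hq₂ : ∀ n, 0 < q₂ n) (hij : i ≠ j)
    (ht : ∀ K > 0, ∃ t : ℕ → ℝ, (∀ n, 0 < t n ∧
      K * (2 ^ n / (r₀ * q₁ n)) * t n ≤ logWeight κ (r₀ / 2 ^ (n + 2)) * ψ (t n)) ∧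
      Summable fun n => K * (2 ^ n / (r₀ * q₁ n)) * t n *
        ((q₁ n * (r₀ / 2 ^ n)) * (q₂ n * (r₀ / 2 ^ n)))) :
    ∃ H : Euc N → ℝ≥0∞, Measurable H ∧ ∫⁻ x, H x < ⊤ ∧ ∀ x : Euc N, (∀ k, |x k| ≤ X) →
      x j ∉ P₂.C → ∀ t, 0 ≤ t →
      ENNReal.ofReal (‖fderiv ℝ (stairMix P₁ P₂.C j i) x‖ * t) ≤
        ENNReal.ofReal (distWeight κ P₁.C P₂.C i j x * ψ t) + H x := by
  obtain ⟨K, hK, hb⟩ := exists_stairMix_layer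
  obtain ⟨τ, hτ, hsum⟩ := ht K hK
  have hA : ∀ n, 0 < 2 ^ n / (r₀ * q₁ n) := fun n => by have := hq₁ n; positivity
  refine ⟨layerSum X r₀ P₁.C P₂.C i j fun n => K * (2 ^ n / (r₀ * q₁ n)) * τ n,
    measurable_layerSum _ _ _ _ _ _ _, lintegral_layerSum_lt_top hX hr P₁ P₂ (hq₁ 0) (hq₂ 0) hij
      (fun n => by have := hA n; have := (hτ n).1; positivity) hsum, fun x hxX hx t ht0 => ?_⟩
  by_cases h : fderiv ℝ (stairMix P₁ P₂.C j i) x = 0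
  · rw [h, norm_zero, zero_mul, ENNReal.ofReal_zero]; exact zero_le
  obtain ⟨n, h0, h1, h2, h3⟩ := hb N r₀ q₁ P₁ P₂.C j i hr hq₁ P₂.isClosedUnbdd x hx h
  have hs : 0 < r₀ / 2 ^ n := by positivity
  have hl : x ∈ layer X r₀ P₁.C P₂.C i j n :=
    ⟨hxX, h3.imp id fun h => ⟨by linarith, by linarith⟩⟩
  refine le_trans ?_ (add_le_add_right (le_layerSum hl fun n => K * (2 ^ n / (r₀ * q₁ n)) * τ n) _)
  have hn := hA n
  have hτn := (hτ n).1
  rw [← ENNReal.ofReal_add (mul_nonneg (distWeight_nonneg hκ _ _ _ _ _) (hψ.nonneg ht0)) (by positivity)]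
  refine ENNReal.ofReal_le_ofReal ?_
  refine hψ.mul_le_add (distWeight_nonneg hκ _ _ _ _ _) hτn ht0 (norm_nonneg _) h0 ((hτ n).2.trans ?_)
  refine mul_le_mul_of_nonneg_right (logWeight_mono hκ ?_) (hψ.nonneg hτn.le)
  have : r₀ / 2 ^ (n + 1) = 2 * (r₀ / 2 ^ (n + 2)) := by
    rw [pow_succ _ (n + 1)]; field_simp
  linarith

end pair

section tensor

variable {N : ℕ}

/-- The product function `x ↦ ∏ f i (x i)`. -/
def tensor (f : Fin N → ℝ → ℝ) (x : Euc N) : ℝ := ∏ i, f i (x i)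

lemma contDiff_tensor {n : WithTop ℕ∞} {f : Fin N → ℝ → ℝ} (hf : ∀ i, ContDiff ℝ n (f i)) :
    ContDiff ℝ n (tensor f) :=
  contDiff_prod fun i _ => (hf i).comp (by fun_prop)

lemma fderiv_tensor_apply {f : Fin N → ℝ → ℝ} (hf : ∀ i, Differentiable ℝ (f i)) (k : Fin N)
    (x : Euc N) :
    fderiv ℝ (tensor f) x (EuclideanSpace.single k 1) =
      tensor (Function.update f k (deriv (f k))) x := by
  have h : ∀ i ∈ Finset.univ, HasFDerivAt (fun y : Euc N => f i (y i))
      (deriv (f i) (x i) • (EuclideanSpace.proj i : Euc N →L[ℝ] ℝ)) x := fun i _ => by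
    have h1 : HasFDerivAt (fun y : Euc N => y i) (EuclideanSpace.proj i : Euc N →L[ℝ] ℝ) x :=
      (EuclideanSpace.proj i : Euc N →L[ℝ] ℝ).hasFDerivAt
    exact ((hf i) (x i)).hasDerivAt.comp_hasFDerivAt x h1
  have h2 := HasFDerivAt.finsetProd h
  have h3 : fderiv ℝ (tensor f) x = _ := h2.fderiv
  rw [h3, sum_apply, Finset.sum_eq_single k]
  · rw [tensor, ← Finset.mul_prod_erase _ _ (Finset.mem_univ k)]
    have h4 : (EuclideanSpace.proj k : Euc N →L[ℝ] ℝ) (EuclideanSpace.single k 1) = 1 := by simp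
    rw [smul_apply, smul_apply, h4, smul_eq_mul, smul_eq_mul, mul_one, mul_comm,
      Function.update_self]
    congr 1
    refine Finset.prod_congr rfl fun i hi => ?_
    rw [Function.update_of_ne (Finset.ne_of_mem_erase hi)]
  · intro i _ hik
    simp [hik]
  · simp

lemma integral_tensor (f : Fin N → ℝ → ℝ) : ∫ x, tensor f x = ∏ i, ∫ y, f i y := by
  rw [← integral_fintype_prod_eq_prod]
  exact (EuclideanSpace.volume_preserving_symm_measurableEquiv_toLp (Fin N)).integral_comp'
    (g := fun y : Fin N → ℝ => ∏ i, f i (y i))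

lemma tensor_update_mul (f : Fin N → ℝ → ℝ) (k : Fin N) (g h : ℝ → ℝ) (x : Euc N) :
    tensor (Function.update f k fun y => g y * h y) x =
      g (x k) * tensor (Function.update f k h) x := by
  simp only [tensor]
  rw [← Finset.mul_prod_erase _ _ (Finset.mem_univ k),
    ← Finset.mul_prod_erase _ _ (Finset.mem_univ k)]
  simp only [Function.update_self, mul_assoc]
  congr 2
  refine Finset.prod_congr rfl fun i hi => ?_
  rw [Function.update_of_ne (Finset.ne_of_mem_erase hi),
    Function.update_of_ne (Finset.ne_of_mem_erase hi)]

lemma ne_zero_of_tensor_ne_zero {f : Fin N → ℝ → ℝ} {x : Euc N} (h : tensor f x ≠ 0) (i : Fin N) :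
    f i (x i) ≠ 0 :=
  Finset.prod_ne_zero_iff.1 h i (Finset.mem_univ i)

end tensor

section cutoff

variable {N : ℕ} {r₀ : ℝ} {q : ℕ → ℝ} (P : CantorPair r₀ q)

lemma CantorPair.F_eq_of_far {t z : ℝ} (ht : 7 / 32 < |t|) (hz : |z - t| ≤ 5 / 32) :
    P.F z = P.F t := by
  have hY := P.Y_le
  rw [abs_le] at hz
  rcases lt_abs.1 ht with h | h
  · rw [P.F_right z (by linarith [hz.1]), P.F_right t (by linarith)]
  · rw [P.F_left z (by linarith [hz.2]), P.F_left t (by linarith)]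

lemma stairMix_eventuallyEq_of_far {C : Set ℝ} (hC : IsClosedUnbdd C) (h0 : (0 : ℝ) ∈ C)
    (i j : Fin N) {x : Euc N} (hi : |x i| ≤ 1 / 2) (hj : 1 / 4 ≤ |x j|) :
    stairMix P C i j =ᶠ[𝓝 x] fun _ => P.F (x j) := by
  have hci : Continuous fun y : Euc N => y i := (contDiff_coord i).continuous
  have hcj : Continuous fun y : Euc N => y j := (contDiff_coord j).continuous
  have h1 : ∀ᶠ y : Euc N in 𝓝 x, |y i| < 5 / 8 :=
    (hci.abs.tendsto x).eventually (gt_mem_nhds (by linarith))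
  have h2 : ∀ᶠ y : Euc N in 𝓝 x, 7 / 32 < |y j| :=
    (hcj.abs.tendsto x).eventually (lt_mem_nhds (by linarith))
  have h3 : ∀ᶠ y : Euc N in 𝓝 x, |y j - x j| < 5 / 32 :=
    ((hcj.sub continuous_const).abs.tendsto x).eventually (gt_mem_nhds (by simp))
  filter_upwards [h1, h2, h3] with y hy1 hy2 hy3
  rw [← P.F_eq_of_far (by linarith) hy3.le]
  refine mollify_of_const hC.regDist_nonneg fun z hz => P.F_eq_of_far hy2 (hz.trans ?_)
  have h4 : Metric.infDist (y i) C ≤ |y i| := by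
    simpa [Real.dist_eq] using Metric.infDist_le_dist_of_mem (x := y i) h0
  linarith [hC.regDist_le (x := y i)]

variable {b : ℝ → ℝ} {δ : ℝ}

lemma CantorPair.contDiff_F_mul_deriv (hb : ContDiff ℝ (⊤ : ℕ∞) b) (hδ : 0 < δ)
    (h1 : ∀ y ∈ Set.Icc (-δ) (P.Y + δ), b y = 1) :
    ContDiff ℝ (⊤ : ℕ∞) fun y => P.F y * deriv b y := by
  have hY := P.Y_nonneg
  have hd : ContDiff ℝ (⊤ : ℕ∞) (deriv b) := (contDiff_infty_iff_deriv.1 hb).2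
  rw [contDiff_iff_contDiffAt]
  intro y
  rcases le_or_gt y (-δ) with h | h
  · have : (fun y => P.F y * deriv b y) =ᶠ[𝓝 y] fun _ => 0 := by
      filter_upwards [gt_mem_nhds (show y < 0 by linarith)] with z hz
      rw [P.F_left z hz, zero_mul]
    exact contDiffAt_const.congr_of_eventuallyEq this
  rcases lt_or_ge y (P.Y + δ) with h' | h'
  · have : (fun y => P.F y * deriv b y) =ᶠ[𝓝 y] fun _ => 0 := by
      filter_upwards [Ioo_mem_nhds h h'] with z hz
      have : b =ᶠ[𝓝 z] fun _ => 1 := by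
        filter_upwards [Ioo_mem_nhds hz.1 hz.2] with u hu using h1 u ⟨hu.1.le, hu.2.le⟩
      rw [this.deriv_eq, deriv_const, mul_zero]
    exact contDiffAt_const.congr_of_eventuallyEq this
  · have : (fun y => P.F y * deriv b y) =ᶠ[𝓝 y] fun y => 1 / q 0 * deriv b y := by
      filter_upwards [lt_mem_nhds (show P.Y < y by linarith)] with z hz
      rw [P.F_right z hz.le]
    exact (contDiffAt_const.mul hd.contDiffAt).congr_of_eventuallyEq this

lemma CantorPair.integral_F_mul_deriv (hb : ContDiff ℝ (⊤ : ℕ∞) b) (hc : HasCompactSupport b)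
    (hδ : 0 < δ) (h1 : ∀ y ∈ Set.Icc (-δ) (P.Y + δ), b y = 1) :
    ∫ y, P.F y * deriv b y = - (1 / q 0) := by
  have hY := P.Y_nonneg
  have h : (fun y => P.F y * deriv b y) =
      (Set.Ioi P.Y).indicator fun y => 1 / q 0 * deriv b y := by
    ext y
    by_cases hy : y ∈ Set.Ioi P.Y
    · rw [Set.indicator_of_mem hy, P.F_right y (le_of_lt hy)]
    · rw [Set.indicator_of_notMem hy]
      rcases lt_or_ge y 0 with h0 | h0
      · rw [P.F_left y h0, zero_mul]
      · have : b =ᶠ[𝓝 y] fun _ => 1 := by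
          filter_upwards [Ioo_mem_nhds (show -δ < y by linarith)
            (show y < P.Y + δ by linarith [not_lt.1 (show ¬ P.Y < y from hy)])] with u hu using h1 u ⟨hu.1.le, hu.2.le⟩
        rw [this.deriv_eq, deriv_const, mul_zero]
  rw [h, integral_indicator measurableSet_Ioi, integral_const_mul,
    hc.integral_Ioi_deriv_eq (hb.of_le (by simp)), h1 P.Y ⟨by linarith, by linarith⟩, mul_neg,
    mul_one]

end cutoff

section wedge

variable {N : ℕ} {C C' : Set ℝ} {i j : Fin N} {v ζ w : Euc N → ℝ} {B : ℝ} {Ω : Set (Euc N)}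

lemma abs_fderiv_single_le (u : Euc N → ℝ) (x : Euc N) (k : Fin N) :
    |fderiv ℝ u x (EuclideanSpace.single k 1)| ≤ ‖fderiv ℝ u x‖ := by
  simpa using (fderiv ℝ u x).le_opNorm (EuclideanSpace.single k 1)

lemma integrable_fderiv_mul {ξ : Euc N → ℝ}
    (hv : IntegrableOn (fderiv ℝ v) Ω) (hξ : Continuous ξ) (hξc : HasCompactSupport ξ)
    (hξΩ : ∀ x ∉ Ω, ξ x = 0) (k : Fin N) :
    Integrable fun x => fderiv ℝ v x (EuclideanSpace.single k 1) * ξ x := by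
  obtain ⟨M, hM⟩ := hξ.bounded_above_of_compact_support hξc
  have h1 : IntegrableOn (fun x => fderiv ℝ v x (EuclideanSpace.single k 1)) Ω :=
    Integrable.apply_continuousLinearMap hv _
  have h2 : IntegrableOn (fun x => fderiv ℝ v x (EuclideanSpace.single k 1) * ξ x) Ω :=
    h1.mul_bdd hξ.aestronglyMeasurable (Eventually.of_forall hM)
  refine (integrableOn_iff_integrable_of_support_subset fun x hx => ?_).1 h2
  by_contra h
  exact hx (by simp [hξΩ x h])

lemma integral_wedge_eq_zero (hij : i ≠ j) (hC : IsClosed C) (hC' : IsClosed C')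
    (hn : volume C = 0) (hn' : volume C' = 0)
    (hv : ∀ x ∉ singSet C C' i j, ContDiffAt ℝ (⊤ : ℕ∞) v x) (hB : ∀ x, |v x| ≤ B)
    (hvi : IntegrableOn (fderiv ℝ v) Ω) {Y : Euc N → ℝ}
    (hY : ContDiff ℝ (⊤ : ℕ∞) Y) (hYc : HasCompactSupport Y) (hYΩ : tsupport Y ⊆ Ω) (k l : Fin N) :
    Integrable (fun x => fderiv ℝ v x (EuclideanSpace.single l 1) *
        fderiv ℝ Y x (EuclideanSpace.single k 1) -
      fderiv ℝ v x (EuclideanSpace.single k 1) * fderiv ℝ Y x (EuclideanSpace.single l 1)) ∧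
    ∫ x, (fderiv ℝ v x (EuclideanSpace.single l 1) * fderiv ℝ Y x (EuclideanSpace.single k 1) -
      fderiv ℝ v x (EuclideanSpace.single k 1) * fderiv ℝ Y x (EuclideanSpace.single l 1)) = 0 := by
  set D : Fin N → Euc N → ℝ := fun k x => fderiv ℝ Y x (EuclideanSpace.single k 1) with hD
  have hDsm : ∀ k, ContDiff ℝ 1 (D k) := fun k =>
    (hY.fderiv_right (m := 1) (by norm_cast)).clm_apply contDiff_const
  have hDc : ∀ k, HasCompactSupport (D k) := fun k => hYc.fderiv_apply ℝ _
  have hDΩ : ∀ k, ∀ x ∉ Ω, D k x = 0 := fun k x hx => by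
    have : fderiv ℝ Y x = 0 := by
      by_contra h
      exact hx (hYΩ (support_fderiv_subset ℝ h))
    simp [hD, this]
  have hint : ∀ m k, Integrable fun x => fderiv ℝ v x (EuclideanSpace.single m 1) * D k x :=
    fun m k => integrable_fderiv_mul hvi (hDsm k).continuous (hDc k) (hDΩ k) m
  refine ⟨(hint l k).sub (hint k l), ?_⟩
  rw [integral_sub (hint l k) (hint k l)]
  have h1 := integral_mul_fderiv_eq_neg hij hC hC' hn hn' hv hB (hDsm k) (hDc k) l (hint l k)
  have h2 := integral_mul_fderiv_eq_neg hij hC hC' hn hn' hv hB (hDsm l) (hDc l) k (hint k l)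
  have hsym : ∀ x, fderiv ℝ (D k) x (EuclideanSpace.single l 1) =
      fderiv ℝ (D l) x (EuclideanSpace.single k 1) := fun x => by
    have hd : DifferentiableAt ℝ (fderiv ℝ Y) x :=
      (hY.fderiv_right (m := 1) (by norm_cast)).differentiable (by simp) x
    have e : ∀ k l, fderiv ℝ (D k) x (EuclideanSpace.single l 1) =
        fderiv ℝ (fderiv ℝ Y) x (EuclideanSpace.single l 1) (EuclideanSpace.single k 1) :=
      fun k l => by
        rw [hD, fderiv_clm_apply hd (differentiableAt_const _)]
        simp
    rw [e, e]
    exact (hY.contDiffAt.isSymmSndFDerivAt (by simp; norm_cast)).eq _ _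
  simp only [hsym] at h1
  linarith

lemma integral_mul_flux_eq (hij : i ≠ j) (hC : IsClosed C) (hC' : IsClosed C')
    (hn : volume C = 0) (hn' : volume C' = 0)
    (hv : ∀ x ∉ singSet C C' i j, ContDiffAt ℝ (⊤ : ℕ∞) v x) (hB : ∀ x, |v x| ≤ B)
    (hΩ : IsOpen Ω) (hvi : IntegrableOn (fderiv ℝ v) Ω)
    (hζ : ContDiff ℝ (⊤ : ℕ∞) ζ) (hζc : HasCompactSupport ζ) (hζΩ : tsupport ζ ⊆ Ω) {k l : Fin N}
    (hz : ∀ x, fderiv ℝ v x (EuclideanSpace.single l 1) *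
      fderiv ℝ ζ x (EuclideanSpace.single k 1) = 0)
    (hρ : Continuous fun x => fderiv ℝ v x (EuclideanSpace.single k 1) *
      fderiv ℝ ζ x (EuclideanSpace.single l 1)) {f : Euc N → ℝ}
    (hf : ContDiffOn ℝ (⊤ : ℕ∞) f Ω) :
    Integrable (fun x => f x * (fderiv ℝ v x (EuclideanSpace.single k 1) *
      fderiv ℝ ζ x (EuclideanSpace.single l 1))) ∧
    ∫ x, f x * (fderiv ℝ v x (EuclideanSpace.single k 1) *
      fderiv ℝ ζ x (EuclideanSpace.single l 1)) =
    ∫ x, ζ x * (fderiv ℝ v x (EuclideanSpace.single l 1) *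
        fderiv ℝ f x (EuclideanSpace.single k 1) -
      fderiv ℝ v x (EuclideanSpace.single k 1) * fderiv ℝ f x (EuclideanSpace.single l 1)) := by
  have hout : ∀ x ∉ Ω, ζ =ᶠ[𝓝 x] 0 := fun x hx =>
    notMem_tsupport_iff_eventuallyEq.1 fun h => hx (hζΩ h)
  have hfx : ∀ x ∈ Ω, ContDiffAt ℝ (⊤ : ℕ∞) f x := fun x hx =>
    hf.contDiffAt (hΩ.mem_nhds hx)
  have hY : ContDiff ℝ (⊤ : ℕ∞) fun x => ζ x * f x := by
    rw [contDiff_iff_contDiffAt]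
    intro x
    by_cases hx : x ∈ Ω
    · exact hζ.contDiffAt.mul (hfx x hx)
    · refine (contDiffAt_const (c := (0 : ℝ))).congr_of_eventuallyEq ?_
      filter_upwards [hout x hx] with y hy
      simp [hy]
  have hYs : tsupport (fun x => ζ x * f x) ⊆ tsupport ζ :=
    tsupport_mul_subset_left
  obtain ⟨hwi, hw0⟩ := integral_wedge_eq_zero hij hC hC' hn hn' hv hB hvi hY
    (hζc.mul_right) (hYs.trans hζΩ) k l
  have hρf : Integrable (fun x => f x * (fderiv ℝ v x (EuclideanSpace.single k 1) *
      fderiv ℝ ζ x (EuclideanSpace.single l 1))) := by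
    refine Continuous.integrable_of_hasCompactSupport ?_ ?_
    · rw [continuous_iff_continuousAt]
      intro x
      by_cases hx : x ∈ Ω
      · exact (hfx x hx).continuousAt.mul hρ.continuousAt
      · refine (continuousAt_const (y := (0 : ℝ))).congr_of_eventuallyEq ?_
        filter_upwards [(hout x hx).eventuallyEq_nhds] with y hy
        rw [hy.fderiv_eq]
        simp
    · exact ((hζc.fderiv_apply ℝ _).mul_left).mul_left
  refine ⟨hρf, ?_⟩
  rw [← sub_eq_zero, ← neg_eq_zero, neg_sub]
  rw [← hw0]
  have hadd : ∀ x, ζ x * (fderiv ℝ v x (EuclideanSpace.single l 1) *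
        fderiv ℝ f x (EuclideanSpace.single k 1) -
      fderiv ℝ v x (EuclideanSpace.single k 1) * fderiv ℝ f x (EuclideanSpace.single l 1)) =
      (fderiv ℝ v x (EuclideanSpace.single l 1) *
        fderiv ℝ (fun x => ζ x * f x) x (EuclideanSpace.single k 1) -
      fderiv ℝ v x (EuclideanSpace.single k 1) *
        fderiv ℝ (fun x => ζ x * f x) x (EuclideanSpace.single l 1)) +
      f x * (fderiv ℝ v x (EuclideanSpace.single k 1) *
      fderiv ℝ ζ x (EuclideanSpace.single l 1)) := fun x => by
    by_cases hx : x ∈ Ω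
    · have hfd : ∀ e, fderiv ℝ (fun x => ζ x * f x) x e =
          ζ x * fderiv ℝ f x e + f x * fderiv ℝ ζ x e := fun e => by
        rw [fderiv_fun_mul (hζ.differentiable (by simp) x) ((hfx x hx).differentiableAt (by simp))]
        simp
      rw [hfd, hfd]
      linear_combination (-f x) * hz x
    · have h1 := hout x hx
      have h2 : (fun x => ζ x * f x) =ᶠ[𝓝 x] fun _ => 0 := by
        filter_upwards [h1] with y hy
        simp [hy]
      rw [h2.fderiv_eq, h1.fderiv_eq, h1.self_of_nhds]
      simp
  simp only [hadd]
  rw [integral_add hwi hρf, add_sub_cancel_right]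

end wedge

section approximation

variable {N : ℕ} {C C' : Set ℝ} {i j : Fin N} {v ζ w : Euc N → ℝ} {B B' : ℝ} {Ω : Set (Euc N)}

/-- Approximability of `w` by smooth functions in a modular forces the pairing of `w` with the
flux of `v` to vanish. -/
lemma integral_eq_zero_of_approx (hij : i ≠ j) (hC : IsClosed C) (hC' : IsClosed C')
    (hn : volume C = 0) (hn' : volume C' = 0)
    (hv : ∀ x ∉ singSet C C' i j, ContDiffAt ℝ (⊤ : ℕ∞) v x) (hB : ∀ x, |v x| ≤ B)
    (hΩ : IsOpen Ω) (hvi : IntegrableOn (fderiv ℝ v) Ω)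
    (hζ : ContDiff ℝ (⊤ : ℕ∞) ζ) (hζc : HasCompactSupport ζ) (hζΩ : tsupport ζ ⊆ Ω)
    (hζ1 : ∀ x, |ζ x| ≤ 1) {k l : Fin N}
    (hz : ∀ x, fderiv ℝ v x (EuclideanSpace.single l 1) *
      fderiv ℝ ζ x (EuclideanSpace.single k 1) = 0)
    (hρ : Continuous fun x => fderiv ℝ v x (EuclideanSpace.single k 1) *
      fderiv ℝ ζ x (EuclideanSpace.single l 1))
    (hwm : AEStronglyMeasurable w) (hwB : ∀ x, |w x| ≤ B')
    (hw : ∀ᵐ x, ζ x ≠ 0 → fderiv ℝ v x ≠ 0 → fderiv ℝ w x = 0)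
    {m : Euc N → ℝ → ℝ≥0∞} {H : Euc N → ℝ≥0∞} (hH : Measurable H) (hHi : ∫⁻ x, H x < ⊤)
    (hyoung : ∀ᵐ x ∂(volume.restrict Ω), ∀ t, 0 ≤ t →
      ENNReal.ofReal (‖fderiv ℝ v x‖ * t) ≤ m x t + H x)
    {f : ℕ → Euc N → ℝ} (hf : ∀ n, ContDiffOn ℝ (⊤ : ℕ∞) (f n) Ω)
    (hfw : Tendsto (fun n => ∫⁻ x in Ω, ENNReal.ofReal |f n x - w x|) atTop (𝓝 0))
    (hfm : ∀ lam : ℝ, 0 < lam → Tendsto (fun n =>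
      ∫⁻ x in Ω, m x (lam * ‖fderiv ℝ (f n) x - fderiv ℝ w x‖)) atTop (𝓝 0)) :
    ∫ x, w x * (fderiv ℝ v x (EuclideanSpace.single k 1) *
      fderiv ℝ ζ x (EuclideanSpace.single l 1)) = 0 := by
  set ρ : Euc N → ℝ := fun x => fderiv ℝ v x (EuclideanSpace.single k 1) *
      fderiv ℝ ζ x (EuclideanSpace.single l 1) with hρdef
  have hρc : HasCompactSupport ρ := (hζc.fderiv_apply ℝ _).mul_left
  obtain ⟨M, hM⟩ := hρ.bounded_above_of_compact_support hρc
  have hζ0 : ∀ x ∉ Ω, ζ x = 0 := fun x hx => image_eq_zero_of_notMem_tsupport fun h => hx (hζΩ h)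
  have hρ0 : ∀ x ∉ Ω, ρ x = 0 := fun x hx => by
    have : fderiv ℝ ζ x = 0 := by
      by_contra h
      exact hx (hζΩ (support_fderiv_subset ℝ h))
    simp [hρdef, this]
  have hwρ : Integrable fun x => w x * ρ x :=
    (hρ.integrable_of_hasCompactSupport hρc).bdd_mul hwm (Eventually.of_forall hwB)
  have hind : ∀ F : Euc N → ℝ, (∀ x ∉ Ω, F x = 0) →
      ENNReal.ofReal |∫ x, F x| ≤ ∫⁻ x in Ω, ENNReal.ofReal |F x| := fun F hF => by
    rw [← setIntegral_eq_integral_of_forall_compl_eq_zero hF]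
    have := enorm_integral_le_lintegral_enorm (μ := volume.restrict Ω) F
    simpa only [Real.enorm_eq_ofReal_abs] using this
  set c : ℝ := ∫ x, w x * ρ x with hc
  have key : ∀ lam : ℝ, 0 < lam → ∀ n, ENNReal.ofReal lam * ENNReal.ofReal |c| ≤
      2 * ((∫⁻ x in Ω, m x (lam * ‖fderiv ℝ (f n) x - fderiv ℝ w x‖)) + ∫⁻ x, H x) +
      ENNReal.ofReal lam * (ENNReal.ofReal M * ∫⁻ x in Ω, ENNReal.ofReal |f n x - w x|) := by
    intro lam hlam n
    obtain ⟨hfi, hfe⟩ := integral_mul_flux_eq hij hC hC' hn hn' hv hB hΩ hvi hζ hζc hζΩ hz hρ (hf n)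
    have h1 : ENNReal.ofReal |∫ x, (f n x - w x) * ρ x| ≤
        ENNReal.ofReal M * ∫⁻ x in Ω, ENNReal.ofReal |f n x - w x| := by
      refine (hind _ fun x hx => by simp [hρ0 x hx]).trans ?_
      rw [← lintegral_const_mul' _ _ ENNReal.ofReal_ne_top]
      refine lintegral_mono fun x => ?_
      rw [abs_mul, mul_comm, ENNReal.ofReal_mul (abs_nonneg _)]
      gcongr
      exact hM x
    have h2 : ENNReal.ofReal |c| ≤ ENNReal.ofReal |∫ x, f n x * ρ x| +
        ENNReal.ofReal |∫ x, (f n x - w x) * ρ x| := by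
      have : ∫ x, (f n x - w x) * ρ x = (∫ x, f n x * ρ x) - c := by
        rw [hc, ← integral_sub hfi hwρ]
        simp only [sub_mul, hρdef]
      rw [this, ← ENNReal.ofReal_add (abs_nonneg _) (abs_nonneg _)]
      refine ENNReal.ofReal_le_ofReal ?_
      have := abs_sub (∫ x, f n x * ρ x) ((∫ x, f n x * ρ x) - c)
      rwa [sub_sub_cancel] at this
    have h3 : ENNReal.ofReal lam * ENNReal.ofReal |∫ x, f n x * ρ x| ≤
        2 * ((∫⁻ x in Ω, m x (lam * ‖fderiv ℝ (f n) x - fderiv ℝ w x‖)) + ∫⁻ x, H x) := by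
      rw [hfe]
      refine (mul_le_mul_right (hind _ fun x hx => by simp [hζ0 x hx]) _).trans ?_
      rw [← lintegral_const_mul' _ _ ENNReal.ofReal_ne_top]
      have h4 : (∫⁻ x in Ω, m x (lam * ‖fderiv ℝ (f n) x - fderiv ℝ w x‖)) + ∫⁻ x in Ω, H x ≤
          (∫⁻ x in Ω, m x (lam * ‖fderiv ℝ (f n) x - fderiv ℝ w x‖)) + ∫⁻ x, H x := by
        gcongr
        exact Measure.restrict_le_self
      refine le_trans ?_ (mul_le_mul_right h4 2)
      rw [← lintegral_add_right _ hH, ← lintegral_const_mul' _ _ (by simp)]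
      refine lintegral_mono_ae ?_
      filter_upwards [hyoung, ae_restrict_of_ae hw] with x hy hwx
      by_cases h0 : ζ x = 0
      · simp [h0]
      by_cases h1 : fderiv ℝ v x = 0
      · simp [h1]
      have h5 := hwx h0 h1
      have h6 := hy (lam * ‖fderiv ℝ (f n) x - fderiv ℝ w x‖) (by positivity)
      refine le_trans ?_ (mul_le_mul_right h6 2)
      have e2 : ∀ r : ℝ, 2 * ENNReal.ofReal r = ENNReal.ofReal (2 * r) := fun r => by
        rw [ENNReal.ofReal_mul (by norm_num), ENNReal.ofReal_ofNat]
      rw [← ENNReal.ofReal_mul hlam.le, e2]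
      refine ENNReal.ofReal_le_ofReal ?_
      rw [h5, sub_zero]
      have a1 := abs_fderiv_single_le v x l
      have a2 := abs_fderiv_single_le v x k
      have a3 := abs_fderiv_single_le (f n) x l
      have a4 := abs_fderiv_single_le (f n) x k
      set p := ‖fderiv ℝ v x‖
      set s := ‖fderiv ℝ (f n) x‖
      have hp : 0 ≤ p := norm_nonneg _
      have hs : 0 ≤ s := norm_nonneg _
      have b1 : |fderiv ℝ v x (EuclideanSpace.single l 1) *
          fderiv ℝ (f n) x (EuclideanSpace.single k 1)| ≤ p * s := by
        rw [abs_mul]; gcongr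
      have b2 : |fderiv ℝ v x (EuclideanSpace.single k 1) *
          fderiv ℝ (f n) x (EuclideanSpace.single l 1)| ≤ p * s := by
        rw [abs_mul]; gcongr
      have b3 := (abs_sub _ _).trans (add_le_add b1 b2)
      rw [abs_mul]
      have b4 := mul_le_mul (hζ1 x) b3 (abs_nonneg _) zero_le_one
      nlinarith
    calc ENNReal.ofReal lam * ENNReal.ofReal |c|
        ≤ ENNReal.ofReal lam * (ENNReal.ofReal |∫ x, f n x * ρ x| +
          ENNReal.ofReal |∫ x, (f n x - w x) * ρ x|) := by gcongr
      _ = ENNReal.ofReal lam * ENNReal.ofReal |∫ x, f n x * ρ x| +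
          ENNReal.ofReal lam * ENNReal.ofReal |∫ x, (f n x - w x) * ρ x| := mul_add _ _ _
      _ ≤ _ := by gcongr
  have key2 : ∀ lam : ℝ, 0 < lam →
      ENNReal.ofReal lam * ENNReal.ofReal |c| ≤ 2 * ∫⁻ x, H x := fun lam hlam => by
    have t1 : Tendsto (fun n =>
      2 * ((∫⁻ x in Ω, m x (lam * ‖fderiv ℝ (f n) x - fderiv ℝ w x‖)) + ∫⁻ x, H x) +
      ENNReal.ofReal lam * (ENNReal.ofReal M * ∫⁻ x in Ω, ENNReal.ofReal |f n x - w x|)) atTop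
      (𝓝 (2 * (0 + ∫⁻ x, H x) + ENNReal.ofReal lam * (ENNReal.ofReal M * 0))) := by
      refine Tendsto.add ?_ ?_
      · exact ENNReal.Tendsto.const_mul ((hfm lam hlam).add tendsto_const_nhds) (Or.inr (by simp))
      · exact ENNReal.Tendsto.const_mul (ENNReal.Tendsto.const_mul hfw
          (Or.inr ENNReal.ofReal_ne_top)) (Or.inr ENNReal.ofReal_ne_top)
    simpa using ge_of_tendsto' t1 (key lam hlam)
  by_contra hne
  have hpos : 0 < |c| := abs_pos.2 hne
  set h := (2 * ∫⁻ x, H x).toReal with hh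
  have hfin : 2 * ∫⁻ x, H x ≠ ⊤ := ENNReal.mul_ne_top (by simp) hHi.ne
  have h7 := key2 ((h + 1) / |c|) (by positivity)
  rw [← ENNReal.ofReal_mul (by positivity), div_mul_cancel₀ _ hpos.ne',
    ENNReal.ofReal_le_iff_le_toReal hfin] at h7
  linarith

end approximation

/-- A smooth cut-off function supported in `[-1/2, 1/2]`. -/
structure IsCutoff (b : ℝ → ℝ) : Prop where
  contDiff : ContDiff ℝ (⊤ : ℕ∞) b
  nonneg : ∀ y, 0 ≤ b y
  le_one : ∀ y, b y ≤ 1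
  eq_zero : ∀ y, 1 / 2 ≤ |y| → b y = 0
  integral_pos : 0 < ∫ y, b y

lemma isCutoff_bump {c : ℝ} (b : ContDiffBump c) (h : |c| + b.rOut ≤ 1 / 2) : IsCutoff b where
  contDiff := b.contDiff
  nonneg _ := b.nonneg
  le_one _ := b.le_one
  eq_zero y hy := b.zero_of_le_dist <| by
    rw [Real.dist_eq]
    linarith [abs_sub_abs_le_abs_sub y c]
  integral_pos := b.integral_pos

namespace IsCutoff

variable {b : ℝ → ℝ}

lemma deriv_eq_zero (hb : IsCutoff b) {y : ℝ} (hy : 1 / 2 < |y|) : deriv b y = 0 := by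
  have : b =ᶠ[𝓝 y] fun _ => 0 := by
    filter_upwards [(continuous_abs.tendsto y).eventually (lt_mem_nhds hy)] with z hz
    exact hb.eq_zero z hz.le
  rw [this.deriv_eq, deriv_const]

lemma hasCompactSupport (hb : IsCutoff b) : HasCompactSupport b :=
  HasCompactSupport.of_support_subset_isCompact (isCompact_Icc (a := -(1 / 2)) (b := 1 / 2))
    fun y hy => by
      rw [Set.mem_Icc, ← abs_le]
      by_contra h
      exact hy (hb.eq_zero y (not_le.1 h).le)

end IsCutoff

section cube

variable {N : ℕ}

/-- The closed cube of side `1` centred at the origin. -/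
def unitCube (N : ℕ) : Set (Euc N) := {x | ∀ k, |x k| ≤ 1 / 2}

lemma norm_le_of_mem_unitCube {x : Euc N} (hx : x ∈ unitCube N) : ‖x‖ ≤ Real.sqrt N / 2 := by
  rw [EuclideanSpace.norm_eq]
  have : ∑ i, ‖x i‖ ^ 2 ≤ N * (1 / 4) := by
    calc ∑ i, ‖x i‖ ^ 2 ≤ ∑ _i : Fin N, (1 / 4 : ℝ) := by
          refine Finset.sum_le_sum fun i _ => ?_
          rw [Real.norm_eq_abs]
          have := hx i
          nlinarith [abs_nonneg (x i)]
      _ = N * (1 / 4) := by simp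
  calc √(∑ i, ‖x i‖ ^ 2) ≤ √(N * (1 / 4)) := Real.sqrt_le_sqrt this
    _ = Real.sqrt N / 2 := by
        rw [Real.sqrt_mul (by positivity), show (1 / 4 : ℝ) = (1 / 2) ^ 2 by norm_num,
          Real.sqrt_sq (by norm_num)]
        ring

lemma isClosed_unitCube : IsClosed (unitCube N) := by
  show IsClosed {x : Euc N | ∀ k, |x k| ≤ 1 / 2}
  simp only [Set.ofPred_forall]
  exact isClosed_iInter fun k => isClosed_le ((contDiff_coord k).continuous.abs) continuous_const

lemma isCompact_unitCube : IsCompact (unitCube N) :=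
  Metric.isCompact_of_isClosed_isBounded isClosed_unitCube <|
    (Metric.isBounded_closedBall (x := (0 : Euc N)) (r := Real.sqrt N / 2)).subset fun x hx => by
      rw [mem_closedBall_zero_iff]
      exact norm_le_of_mem_unitCube hx

lemma tsupport_tensor_subset {f : Fin N → ℝ → ℝ} (hf : ∀ k y, 1 / 2 < |y| → f k y = 0) :
    tsupport (tensor f) ⊆ unitCube N :=
  closure_minimal (fun _ hx k => not_lt.1 fun h => ne_zero_of_tensor_ne_zero hx k (hf k _ h))
    isClosed_unitCube

lemma hasCompactSupport_tensor {f : Fin N → ℝ → ℝ} (hf : ∀ k y, 1 / 2 < |y| → f k y = 0) :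
    HasCompactSupport (tensor f) :=
  isCompact_unitCube.of_isClosed_subset (isClosed_tsupport _) (tsupport_tensor_subset hf)

end cube

section flux

variable {N : ℕ} {r₀ : ℝ} {q₁ q₂ : ℕ → ℝ} (P₁ : CantorPair r₀ q₁) (P₂ : CantorPair r₀ q₂)
  {i j : Fin N} {b₀ b₁ : ℝ → ℝ} {δ : ℝ} {Ω : Set (Euc N)}

/-- The cut-off equal to `b₁` in the variable `x j` and to `b₀` in the other variables. -/
def cubeCutoff (j : Fin N) (b₀ b₁ : ℝ → ℝ) : Fin N → ℝ → ℝ := Function.update (fun _ => b₀) j b₁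

lemma isCutoff_cubeCutoff (h₀ : IsCutoff b₀) (h₁ : IsCutoff b₁) (k : Fin N) :
    IsCutoff (cubeCutoff j b₀ b₁ k) := by
  by_cases h : k = j
  · subst h; simpa [cubeCutoff] using h₁
  · simpa [cubeCutoff, h] using h₀

lemma abs_tensor_cubeCutoff_le (h₀ : IsCutoff b₀) (h₁ : IsCutoff b₁) (x : Euc N) :
    |tensor (cubeCutoff j b₀ b₁) x| ≤ 1 := by
  have h := fun k => isCutoff_cubeCutoff (j := j) h₀ h₁ k
  rw [tensor, abs_of_nonneg (Finset.prod_nonneg fun k _ => (h k).nonneg _)]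
  exact Finset.prod_le_one (fun k _ => (h k).nonneg _) fun k _ => (h k).le_one _

lemma IsCutoff.le_abs_of_deriv_ne_zero (h : ∀ y, |y| ≤ 1 / 4 → b₀ y = 1) {y : ℝ}
    (hy : deriv b₀ y ≠ 0) : 1 / 4 ≤ |y| := by
  by_contra hlt
  have : b₀ =ᶠ[𝓝 y] fun _ => 1 := by
    filter_upwards [(continuous_abs.tendsto y).eventually (gt_mem_nhds (not_le.1 hlt))] with z hz
    exact h z hz.le
  exact hy (by rw [this.deriv_eq, deriv_const])

lemma fderiv_mul_fderiv_cutoff_eq_zero (hij : i ≠ j) (h₀ : IsCutoff b₀) (h₁ : IsCutoff b₁)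
    (hb₀ : ∀ y, |y| ≤ 1 / 4 → b₀ y = 1) (x : Euc N) :
    fderiv ℝ (stairMix P₁ P₂.C j i) x (EuclideanSpace.single j 1) *
      fderiv ℝ (tensor (cubeCutoff j b₀ b₁)) x (EuclideanSpace.single i 1) = 0 := by
  by_cases h : fderiv ℝ (tensor (cubeCutoff j b₀ b₁)) x (EuclideanSpace.single i 1) = 0
  · rw [h, mul_zero]
  rw [fderiv_tensor_apply fun k =>
    (isCutoff_cubeCutoff h₀ h₁ k).contDiff.differentiable (by simp)] at h
  have hi := ne_zero_of_tensor_ne_zero h i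
  have hj := ne_zero_of_tensor_ne_zero h j
  simp only [Function.update_self, Function.update_of_ne hij.symm, cubeCutoff,
    Function.update_of_ne hij] at hi hj
  have hj' : |x j| ≤ 1 / 2 := not_lt.1 fun h => hj (h₁.eq_zero _ h.le)
  rw [(stairMix_eventuallyEq_of_far P₁ P₂.isClosedUnbdd P₂.zero_mem j i hj'
    (IsCutoff.le_abs_of_deriv_ne_zero hb₀ hi)).fderiv_eq]
  simp

lemma continuous_flux (h₀ : IsCutoff b₀) (h₁ : IsCutoff b₁)
    (hb₁ : ∀ y ∈ P₂.C, deriv b₁ =ᶠ[𝓝 y] 0) :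
    Continuous fun x => fderiv ℝ (stairMix P₁ P₂.C j i) x (EuclideanSpace.single i 1) *
      fderiv ℝ (tensor (cubeCutoff j b₀ b₁)) x (EuclideanSpace.single j 1) := by
  have hdiff : ∀ k, ContDiff ℝ (⊤ : ℕ∞) (cubeCutoff j b₀ b₁ k) := fun k =>
    (isCutoff_cubeCutoff h₀ h₁ k).contDiff
  have hζ := contDiff_tensor hdiff
  rw [continuous_iff_continuousAt]
  intro x
  by_cases hx : x j ∈ P₂.C
  · refine (continuousAt_const (y := (0 : ℝ))).congr_of_eventuallyEq ?_
    filter_upwards [((contDiff_coord j).continuous.tendsto x).eventually (hb₁ _ hx)] with y hy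
    rw [fderiv_tensor_apply fun k => (hdiff k).differentiable (by simp)]
    by_contra hne
    have := ne_zero_of_tensor_ne_zero (right_ne_zero_of_mul hne) j
    simp only [Function.update_self, cubeCutoff] at this
    exact this hy
  · have h1 := contDiffAt_stairMix P₁ j i P₂.isClosedUnbdd (x := x) fun h => hx h.1
    have h2 : ContinuousAt (fderiv ℝ (stairMix P₁ P₂.C j i)) x :=
      (h1.fderiv_right (m := 0) (by simp)).continuousAt
    have h3 : Continuous (fderiv ℝ (tensor (cubeCutoff j b₀ b₁))) := hζ.continuous_fderiv (by simp)
    exact (h2.clm_apply continuousAt_const).mul (h3.continuousAt.clm_apply continuousAt_const)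

lemma integral_mul_flux_ne_zero (hij : i ≠ j) (hr : 0 < r₀) (hq₁ : ∀ n, 0 < q₁ n)
    (hq₂ : 0 < q₂ 0) (h₀ : IsCutoff b₀) (h₁ : IsCutoff b₁)
    (hb₀ : ∀ y, |y| ≤ 1 / 4 → b₀ y = 1) (hδ : 0 < δ)
    (hb₁ : ∀ y ∈ Set.Icc (-δ) (P₂.Y + δ), b₁ y = 1) (hΩ : unitCube N ⊆ Ω)
    (hvi : IntegrableOn (fderiv ℝ (stairMix P₁ P₂.C j i)) Ω) {η : Euc N → ℝ}
    (hη : ∀ x ∈ unitCube N, η x = 1) :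
    ∫ x, (η x * stairMix P₂ P₁.C i j x) *
      (fderiv ℝ (stairMix P₁ P₂.C j i) x (EuclideanSpace.single i 1) *
      fderiv ℝ (tensor (cubeCutoff j b₀ b₁)) x (EuclideanSpace.single j 1)) ≠ 0 := by
  have hd : ∀ k, Differentiable ℝ (cubeCutoff j b₀ b₁ k) := fun k =>
    (isCutoff_cubeCutoff h₀ h₁ k).contDiff.differentiable (by simp)
  have hjj : cubeCutoff j b₀ b₁ j = b₁ := Function.update_self ..
  have hi' : cubeCutoff j b₀ b₁ i = b₀ := Function.update_of_ne hij ..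
  set g : ℝ → ℝ := fun y => P₂.F y * deriv b₁ y with hg
  set ξs : Fin N → ℝ → ℝ := Function.update (cubeCutoff j b₀ b₁) j g with hξs
  have hgs : ContDiff ℝ (⊤ : ℕ∞) g := P₂.contDiff_F_mul_deriv h₁.contDiff hδ hb₁
  have hξsm : ∀ k, ContDiff ℝ (⊤ : ℕ∞) (ξs k) := fun k => by
    by_cases h : k = j
    · subst h; simpa [hξs] using hgs
    · simpa [hξs, h] using (isCutoff_cubeCutoff h₀ h₁ k).contDiff
  have hξ0 : ∀ k y, 1 / 2 < |y| → ξs k y = 0 := fun k y hy => by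
    by_cases h : k = j
    · subst h; simp [hξs, hg, h₁.deriv_eq_zero hy]
    · simpa [hξs, h] using (isCutoff_cubeCutoff h₀ h₁ k).eq_zero y hy.le
  have hξi : ξs i = b₀ := by rw [hξs, Function.update_of_ne hij, hi']
  have hξj : ξs j = g := Function.update_self ..
  have hξ := contDiff_tensor hξsm
  have hξc := hasCompactSupport_tensor hξ0
  have step1 : ∫ x, (η x * stairMix P₂ P₁.C i j x) *
      (fderiv ℝ (stairMix P₁ P₂.C j i) x (EuclideanSpace.single i 1) *
      fderiv ℝ (tensor (cubeCutoff j b₀ b₁)) x (EuclideanSpace.single j 1)) =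
      ∫ x, fderiv ℝ (stairMix P₁ P₂.C j i) x (EuclideanSpace.single i 1) * tensor ξs x := by
    refine integral_congr_ae ?_
    filter_upwards [ae_coord_notMem P₂.null j] with x hx
    have e : tensor ξs x = P₂.F (x j) *
        fderiv ℝ (tensor (cubeCutoff j b₀ b₁)) x (EuclideanSpace.single j 1) := by
      rw [fderiv_tensor_apply hd, hjj, ← tensor_update_mul]
    rw [e]
    by_cases hv : fderiv ℝ (stairMix P₁ P₂.C j i) x = 0
    · simp [hv]
    by_cases hz : fderiv ℝ (tensor (cubeCutoff j b₀ b₁)) x (EuclideanSpace.single j 1) = 0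
    · simp [hz]
    have hxc : x ∈ unitCube N := by
      refine tsupport_tensor_subset (fun k y hy => (isCutoff_cubeCutoff (j := j) h₀ h₁ k).eq_zero y hy.le)
        (support_fderiv_subset ℝ (Function.mem_support.2 fun h => hz ?_))
      rw [h]; rfl
    rw [hη x hxc, stairMix_swap_eq P₁ P₂ hr hq₁ hx hv]
    ring
  have step2 := integral_mul_fderiv_eq_neg hij.symm P₂.closed P₁.closed P₂.null P₁.null
    (u := stairMix P₁ P₂.C j i) (ξ := tensor ξs)
    (fun x hx => contDiffAt_stairMix P₁ j i P₂.isClosedUnbdd hx)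
    (abs_stairMix_le P₁ j i P₂.C) (hξ.of_le (by norm_cast)) hξc i
    (integrable_fderiv_mul hvi hξ.continuous hξc (fun x hx =>
      image_eq_zero_of_notMem_tsupport fun h => hx (hΩ (tsupport_tensor_subset hξ0 h))) i)
  have step3 : ∀ x, stairMix P₁ P₂.C j i x *
      fderiv ℝ (tensor ξs) x (EuclideanSpace.single i 1) =
      tensor (Function.update ξs i fun y => P₁.F y * deriv b₀ y) x := fun x => by
    rw [fderiv_tensor_apply fun k => (hξsm k).differentiable (by simp), hξi, tensor_update_mul]
    by_cases h : tensor (Function.update ξs i (deriv b₀)) x = 0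
    · rw [h, mul_zero, mul_zero]
    have hi := ne_zero_of_tensor_ne_zero h i
    have hj := ne_zero_of_tensor_ne_zero h j
    rw [Function.update_self] at hi
    rw [Function.update_of_ne hij.symm] at hj
    have hj' : |x j| ≤ 1 / 2 := not_lt.1 fun h => hj (hξ0 _ _ h)
    rw [(stairMix_eventuallyEq_of_far P₁ P₂.isClosedUnbdd P₂.zero_mem j i hj'
      (IsCutoff.le_abs_of_deriv_ne_zero hb₀ hi)).self_of_nhds]
  rw [step1, ← neg_ne_zero, ← step2]
  simp only [step3]
  rw [integral_tensor]
  refine Finset.prod_ne_zero_iff.2 fun k _ => ?_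
  by_cases hki : k = i
  · subst hki
    rw [Function.update_self, P₁.integral_F_mul_deriv h₀.contDiff h₀.hasCompactSupport
      (show (0 : ℝ) < 1 / 8 by norm_num) fun y hy => hb₀ y ?_]
    · have := hq₁ 0
      simp [this.ne']
    · have := P₁.Y_le
      rw [abs_le]
      constructor <;> linarith [hy.1, hy.2]
  · rw [Function.update_of_ne hki]
    by_cases hkj : k = j
    · subst hkj
      rw [hξj, hg, P₂.integral_F_mul_deriv h₁.contDiff h₁.hasCompactSupport hδ hb₁]
      simp [hq₂.ne']
    · rw [hξs, Function.update_of_ne hkj]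
      exact (isCutoff_cubeCutoff h₀ h₁ k).integral_pos.ne'

end flux

section gradient

variable {N : ℕ}

lemma gradient_apply_coord (w : Euc N → ℝ) (x : Euc N) (k : Fin N) :
    gradient w x k = fderiv ℝ w x (EuclideanSpace.single k 1) := by
  rw [gradient, ← InnerProductSpace.toDual_symm_apply, EuclideanSpace.inner_single_right]
  simp

lemma norm_gradient_eq (w : Euc N → ℝ) (x : Euc N) : ‖gradient w x‖ = ‖fderiv ℝ w x‖ :=
  LinearIsometryEquiv.norm_map _ _

lemma norm_gradient_sub (u w : Euc N → ℝ) (x : Euc N) :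
    ‖gradient u x - gradient w x‖ = ‖fderiv ℝ u x - fderiv ℝ w x‖ := by
  rw [gradient, gradient, ← map_sub, LinearIsometryEquiv.norm_map]

lemma integrableOn_gradient {w : Euc N → ℝ} {Ω : Set (Euc N)}
    (h : IntegrableOn (fderiv ℝ w) Ω) : IntegrableOn (gradient w) Ω :=
  (LinearIsometryEquiv.integrable_comp_iff (InnerProductSpace.toDual ℝ (Euc N)).symm).2 h

end gradient

section localMix

variable {N : ℕ} {r₀ : ℝ} {q₁ q₂ : ℕ → ℝ} (P₁ : CantorPair r₀ q₁) (P₂ : CantorPair r₀ q₂)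
  {i j : Fin N} {κ X : ℝ} {φ ψ : ℝ → ℝ} {η : Euc N → ℝ} {Ω : Set (Euc N)}

/-- The staircase function multiplied by a cut-off. -/
def localMix (i j : Fin N) (η : Euc N → ℝ) (x : Euc N) : ℝ := η x * stairMix P₂ P₁.C i j x

lemma contDiffAt_localMix (hη : ContDiff ℝ (⊤ : ℕ∞) η) {x : Euc N}
    (hx : x ∉ singSet P₁.C P₂.C i j) : ContDiffAt ℝ (⊤ : ℕ∞) (localMix P₁ P₂ i j η) x :=
  hη.contDiffAt.mul (contDiffAt_stairMix P₂ i j P₁.isClosedUnbdd hx)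

lemma abs_localMix_le (hη : ∀ x, |η x| ≤ 1) (x : Euc N) : |localMix P₁ P₂ i j η x| ≤ 1 / q₂ 0 := by
  rw [localMix, abs_mul]
  exact (mul_le_of_le_one_left (abs_nonneg _) (hη x)).trans (abs_stairMix_le P₂ i j P₁.C x)

lemma exists_norm_fderiv_localMix_le (hη : ContDiff ℝ (⊤ : ℕ∞) η) (hηc : HasCompactSupport η)
    (hη1 : ∀ x, |η x| ≤ 1) : ∃ M, 0 ≤ M ∧ ∀ x ∉ singSet P₁.C P₂.C i j,
      ‖fderiv ℝ (localMix P₁ P₂ i j η) x‖ ≤ ‖fderiv ℝ (stairMix P₂ P₁.C i j) x‖ + M := by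
  obtain ⟨D, hD⟩ := (hη.continuous_fderiv (by simp)).bounded_above_of_compact_support
    (hηc.fderiv ℝ)
  have hD0 : 0 ≤ D := (norm_nonneg _).trans (hD 0)
  have hq : 0 ≤ 1 / q₂ 0 := (abs_nonneg _).trans (abs_stairMix_le P₂ i j P₁.C 0)
  refine ⟨1 / q₂ 0 * D, by positivity, fun x hx => ?_⟩
  have h1 : DifferentiableAt ℝ (stairMix P₂ P₁.C i j) x :=
    (contDiffAt_stairMix P₂ i j P₁.isClosedUnbdd hx).differentiableAt (by simp)
  have h2 : DifferentiableAt ℝ η x := hη.contDiffAt.differentiableAt (by simp)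
  have h3 : fderiv ℝ (localMix P₁ P₂ i j η) x = η x • fderiv ℝ (stairMix P₂ P₁.C i j) x +
      stairMix P₂ P₁.C i j x • fderiv ℝ η x := fderiv_fun_mul h2 h1
  rw [h3]
  refine (norm_add_le _ _).trans (add_le_add ?_ ?_)
  · rw [norm_smul]
    exact mul_le_of_le_one_left (norm_nonneg _) (hη1 x)
  · rw [norm_smul]
    exact mul_le_mul (abs_stairMix_le P₂ i j P₁.C x) (hD x) (norm_nonneg _) hq

lemma integrableOn_energy_localMix (hκ : 0 ≤ κ) (hφ : IsOrlicz φ) (hψ : IsOrlicz ψ) (hX : 0 < X)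
    (hr : 0 < r₀) (hq₁ : ∀ n, 0 < q₁ n) (hq₂ : ∀ n, 0 < q₂ n) (hij : i ≠ j)
    (hsum : ∀ K > 0, Summable fun n => φ (K * (2 ^ n / (r₀ * q₂ n))) *
      ((q₁ n * (r₀ / 2 ^ n)) * (q₂ n * (r₀ / 2 ^ n))))
    (hη : ContDiff ℝ (⊤ : ℕ∞) η) (hηc : HasCompactSupport η) (hη1 : ∀ x, |η x| ≤ 1)
    (hΩX : ∀ x ∈ Ω, ∀ k, |x k| ≤ X) (hΩv : volume Ω < ⊤) :
    IntegrableOn (fun x => φ ‖fderiv ℝ (localMix P₁ P₂ i j η) x‖ +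
      distWeight κ P₁.C P₂.C i j x * ψ ‖fderiv ℝ (localMix P₁ P₂ i j η) x‖) Ω := by
  obtain ⟨M, hM0, hM⟩ := exists_norm_fderiv_localMix_le P₁ P₂ (i := i) (j := j) hη hηc hη1
  have ha0 := distWeight_nonneg hκ P₁.C P₂.C i j
  have ha1 := distWeight_le_one hκ P₁.C P₂.C i j
  have hD : Measurable fun x => ‖fderiv ℝ (localMix P₁ P₂ i j η) x‖ :=
    (measurable_fderiv ℝ _).norm
  have hcomp : ∀ {f : ℝ → ℝ}, IsOrlicz f →
      Measurable fun x => f ‖fderiv ℝ (localMix P₁ P₂ i j η) x‖ := fun hf => by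
    have := hf.measurable_comp.comp hD
    convert this using 1
    funext x
    simp
  have hmeas := (hcomp hφ).add ((measurable_distWeight hκ P₁.C P₂.C i j).mul (hcomp hψ))
  refine (lintegral_ofReal_ne_top_iff_integrable hmeas.aestronglyMeasurable
    (Eventually.of_forall fun x => add_nonneg (hφ.nonneg (norm_nonneg _))
      (mul_nonneg (ha0 x) (hψ.nonneg (norm_nonneg _))))).1 (ne_of_lt ?_)
  set b := ENNReal.ofReal (φ (2 * M) + ψ M)
  have hbound : ∀ᵐ x : Euc N, ENNReal.ofReal (φ ‖fderiv ℝ (localMix P₁ P₂ i j η) x‖ +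
      distWeight κ P₁.C P₂.C i j x * ψ ‖fderiv ℝ (localMix P₁ P₂ i j η) x‖) ≤
      ENNReal.ofReal (φ (2 * ‖fderiv ℝ (stairMix P₂ P₁.C i j) x‖)) + b := by
    filter_upwards [ae_coord_notMem P₁.null i] with x hx
    have hMx := hM x fun h => hx h.1
    have hφ0 : 0 ≤ φ (2 * ‖fderiv ℝ (stairMix P₂ P₁.C i j) x‖) := hφ.nonneg (by positivity)
    have hφM : 0 ≤ φ (2 * M) := hφ.nonneg (by positivity)
    have hψM : 0 ≤ ψ M := hψ.nonneg hM0
    rw [← ENNReal.ofReal_add hφ0 (by positivity)]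
    refine ENNReal.ofReal_le_ofReal ?_
    by_cases h : fderiv ℝ (stairMix P₂ P₁.C i j) x = 0
    · rw [h, norm_zero, zero_add] at hMx
      have h1 := hφ.mono (norm_nonneg _) (hMx.trans (by linarith : M ≤ 2 * M))
      have h2 := hψ.mono (norm_nonneg _) hMx
      have h3 := mul_le_of_le_one_left (hψ.nonneg (norm_nonneg
        (fderiv ℝ (localMix P₁ P₂ i j η) x))) (ha1 x)
      linarith
    · rw [distWeight_eq_zero P₁ P₂ hr hq₂ hx h, zero_mul, add_zero]
      rcases le_total ‖fderiv ℝ (stairMix P₂ P₁.C i j) x‖ M with hle | hle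
      · have := hφ.mono (norm_nonneg _) (hMx.trans (by linarith : _ ≤ 2 * M))
        linarith
      · have := hφ.mono (norm_nonneg _)
          (hMx.trans (by linarith : _ ≤ 2 * ‖fderiv ℝ (stairMix P₂ P₁.C i j) x‖))
        linarith
  refine (lintegral_mono_ae (ae_restrict_of_ae hbound)).trans_lt ?_
  rw [lintegral_add_right _ measurable_const]
  refine ENNReal.add_lt_top.2 ⟨?_, ?_⟩
  · exact (lintegral_mono_set fun x hx => hΩX x hx).trans_lt
      (lintegral_fderiv_stairMix_lt_top P₁ P₂ hφ hX hr hq₁ hq₂ hij hsum)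
  · rw [setLIntegral_const]
    exact ENNReal.mul_lt_top ENNReal.ofReal_lt_top hΩv

lemma integrableOn_of_integrableOn_energy {a : Euc N → ℝ} {D : Euc N → Euc N →L[ℝ] ℝ}
    (hφ : IsOrlicz φ) (hψ : IsOrlicz ψ) (ha : ∀ x, 0 ≤ a x) (hD : Measurable D)
    (hΩv : volume Ω < ⊤) (h : IntegrableOn (fun x => φ ‖D x‖ + a x * ψ ‖D x‖) Ω) :
    IntegrableOn D Ω := by
  obtain ⟨c, hc0, hc⟩ := hφ.exists_le_add
  refine Integrable.mono' ((integrableOn_const (C := c) hΩv.ne).add h) hD.aestronglyMeasurable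
    (Eventually.of_forall fun x => ?_)
  have h1 := hc ‖D x‖ (norm_nonneg _)
  have h2 := mul_nonneg (ha x) (hψ.nonneg (norm_nonneg (D x)))
  simp only [Pi.add_apply]
  linarith

lemma exists_young_remainder_energy (hκ : 0 ≤ κ) (hφ : IsOrlicz φ) (hψ : IsOrlicz ψ) (hX : 0 < X)
    (hr : 0 < r₀) (hq₁ : ∀ n, 0 < q₁ n) (hq₂ : ∀ n, 0 < q₂ n) (hij : i ≠ j)
    (ht : ∀ K > 0, ∃ t : ℕ → ℝ, (∀ n, 0 < t n ∧
      K * (2 ^ n / (r₀ * q₁ n)) * t n ≤ logWeight κ (r₀ / 2 ^ (n + 2)) * ψ (t n)) ∧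
      Summable fun n => K * (2 ^ n / (r₀ * q₁ n)) * t n *
        ((q₁ n * (r₀ / 2 ^ n)) * (q₂ n * (r₀ / 2 ^ n))))
    (hΩ : MeasurableSet Ω) (hΩX : ∀ x ∈ Ω, ∀ k, |x k| ≤ X) :
    ∃ H : Euc N → ℝ≥0∞, Measurable H ∧ ∫⁻ x, H x < ⊤ ∧
      ∀ᵐ x ∂(volume.restrict Ω), ∀ t, 0 ≤ t →
      ENNReal.ofReal (‖fderiv ℝ (stairMix P₁ P₂.C j i) x‖ * t) ≤
        ENNReal.ofReal (φ t + distWeight κ P₁.C P₂.C i j x * ψ t) + H x := by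
  obtain ⟨H, hH, hHi, hb⟩ := exists_young_remainder P₁ P₂ hψ hκ hX hr hq₁ hq₂ hij ht
  refine ⟨H, hH, hHi, ?_⟩
  filter_upwards [ae_restrict_mem hΩ, ae_restrict_of_ae (ae_coord_notMem P₂.null j)]
    with x hx hxj t ht0
  refine (hb x (hΩX x hx) hxj t ht0).trans ?_
  gcongr
  linarith [hφ.nonneg ht0]

lemma integrableOn_of_young {a : Euc N → ℝ} {D : Euc N → Euc N →L[ℝ] ℝ} {H : Euc N → ℝ≥0∞}
    (hψ : IsOrlicz ψ) (ha : ∀ x, a x ≤ 1) (hD : Measurable D)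
    (hΩv : volume Ω < ⊤) (hHi : ∫⁻ x, H x < ⊤)
    (h : ∀ᵐ x ∂(volume.restrict Ω), ∀ t, 0 ≤ t →
      ENNReal.ofReal (‖D x‖ * t) ≤ ENNReal.ofReal (φ t + a x * ψ t) + H x) :
    IntegrableOn D Ω := by
  refine ⟨hD.aestronglyMeasurable, ?_⟩
  rw [hasFiniteIntegral_iff_norm]
  have : ∀ᵐ x ∂(volume.restrict Ω),
      ENNReal.ofReal ‖D x‖ ≤ ENNReal.ofReal (φ 1 + ψ 1) + H x := by
    filter_upwards [h] with x hx
    have h1 := hx 1 zero_le_one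
    rw [mul_one] at h1
    refine h1.trans ?_
    gcongr
    exact mul_le_of_le_one_left (hψ.nonneg zero_le_one) (ha x)
  refine (lintegral_mono_ae this).trans_lt ?_
  rw [lintegral_add_left measurable_const]
  refine ENNReal.add_lt_top.2 ⟨?_, (setLIntegral_le_lintegral _ _).trans_lt hHi⟩
  rw [setLIntegral_const]
  exact ENNReal.mul_lt_top ENNReal.ofReal_lt_top hΩv

lemma hasWeakGradOn_localMix (hij : i ≠ j) (hη : ContDiff ℝ (⊤ : ℕ∞) η) (hη1 : ∀ x, |η x| ≤ 1)
    (hD : IntegrableOn (fderiv ℝ (localMix P₁ P₂ i j η)) (Omg N)) :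
    HasWeakGradOn N (localMix P₁ P₂ i j η) (gradient (localMix P₁ P₂ i j η)) := by
  have hsm : ∀ x ∉ singSet P₁.C P₂.C i j, ContDiffAt ℝ (⊤ : ℕ∞) (localMix P₁ P₂ i j η) x :=
    fun x hx => contDiffAt_localMix P₁ P₂ hη hx
  have hb := abs_localMix_le P₁ P₂ (i := i) (j := j) hη1
  have hm := aestronglyMeasurable_of_smooth_off P₁.closed P₂.closed P₁.null hsm
  refine ⟨?_, integrableOn_gradient hD, fun ξ hξ k => ?_⟩
  · refine LocallyIntegrable.locallyIntegrableOn ?_ _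
    exact (locallyIntegrable_const (1 / q₂ 0)).mono hm (Eventually.of_forall fun x => by
      rw [Real.norm_eq_abs, Real.norm_eq_abs]
      exact (hb x).trans (le_abs_self _))
  · obtain ⟨hξs, hξc, hξΩ⟩ := hξ
    have hξ0 : ∀ x ∉ Omg N, ξ x = 0 := fun x hx =>
      image_eq_zero_of_notMem_tsupport fun h => hx (hξΩ h)
    have hξ0' : ∀ x ∉ Omg N, fderiv ℝ ξ x = 0 := fun x hx => by
      by_contra h
      exact hx (hξΩ (support_fderiv_subset ℝ h))
    simp only [gradient_apply_coord]
    rw [setIntegral_eq_integral_of_forall_compl_eq_zero fun x hx => by simp [hξ0' x hx],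
      setIntegral_eq_integral_of_forall_compl_eq_zero fun x hx => by simp [hξ0 x hx]]
    exact integral_mul_fderiv_eq_neg hij P₁.closed P₂.closed P₁.null P₂.null hsm hb
      (hξs.of_le (by norm_cast)) hξc k (integrable_fderiv_mul hD hξs.continuous hξc hξ0 k)

lemma contDiffAt_localMix_of_notMem_tsupport {x : Euc N} (hx : x ∉ tsupport η) :
    ContDiffAt ℝ (⊤ : ℕ∞) (localMix P₁ P₂ i j η) x := by
  refine contDiffAt_const (c := (0 : ℝ)).congr_of_eventuallyEq ?_
  filter_upwards [notMem_tsupport_iff_eventuallyEq.1 hx] with y hy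
  rw [localMix, hy]
  simp

lemma fderiv_localMix_eq_zero (hr : 0 < r₀) (hq : ∀ n, 0 < q₁ n) {x : Euc N}
    (hη : η =ᶠ[𝓝 x] fun _ => 1) (hx : x j ∉ P₂.C)
    (h : fderiv ℝ (stairMix P₁ P₂.C j i) x ≠ 0) : fderiv ℝ (localMix P₁ P₂ i j η) x = 0 := by
  have : localMix P₁ P₂ i j η =ᶠ[𝓝 x] stairMix P₂ P₁.C i j := by
    filter_upwards [hη] with y hy
    rw [localMix, hy, one_mul]
  rw [this.fderiv_eq]
  exact fderiv_stairMix_swap_eq_zero P₁ P₂ hr hq hx h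

end localMix

section cutoffs

variable {r₀ : ℝ} {q : ℕ → ℝ} (P : CantorPair r₀ q)

lemma exists_centredCutoff :
    ∃ b : ℝ → ℝ, IsCutoff b ∧ ∀ y, |y| ≤ 1 / 4 → b y = 1 := by
  let b : ContDiffBump (0 : ℝ) := ⟨1 / 4, 1 / 2, by norm_num, by norm_num⟩
  refine ⟨b, isCutoff_bump b (by simp [b]), fun y hy => b.one_of_mem_closedBall ?_⟩
  simpa [b] using hy

lemma CantorPair.exists_adaptedCutoff (hr : 0 < r₀) (hr' : r₀ ≤ 1 / 16) :
    ∃ b : ℝ → ℝ, IsCutoff b ∧ (∀ y ∈ Set.Icc (-(r₀ / 4)) (P.Y + r₀ / 4), b y = 1) ∧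
      ∀ y ∈ P.C, deriv b =ᶠ[𝓝 y] 0 := by
  have hY := P.Y_nonneg
  have hY' := P.Y_le
  let b : ContDiffBump (P.Y / 2) :=
    ⟨P.Y / 2 + r₀ / 4, P.Y / 2 + 3 * r₀ / 4, by linarith, by linarith⟩
  have h1 : ∀ y ∈ Set.Icc (-(r₀ / 4)) (P.Y + r₀ / 4), b y = 1 := fun y hy =>
    b.one_of_mem_closedBall <| by
      rw [mem_closedBall_iff_norm, Real.norm_eq_abs, abs_le]
      constructor <;> simp only [b] <;> linarith [hy.1, hy.2]
  have h0 : ∀ y, P.Y / 2 + 3 * r₀ / 4 ≤ |y - P.Y / 2| → b y = 0 := fun y hy =>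
    b.zero_of_le_dist hy
  refine ⟨b, isCutoff_bump b ?_, h1, fun y hy => ?_⟩
  · rw [abs_of_nonneg (by linarith)]
    simp only [b]
    linarith
  have hconst : ∀ {c : ℝ}, (b : ℝ → ℝ) =ᶠ[𝓝 y] (fun _ => c) → deriv b =ᶠ[𝓝 y] 0 := fun h => by
    refine h.deriv.trans (Eventually.of_forall fun z => ?_)
    simp
  rcases lt_or_ge y 0 with hneg | hpos
  · have : y ≤ -r₀ := not_lt.1 fun h =>
      Set.eq_empty_iff_forall_notMem.1 P.gap_left y ⟨⟨h, hneg⟩, hy⟩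
    refine hconst (c := 0) ?_
    filter_upwards [gt_mem_nhds (show y < -(3 * r₀ / 4) by linarith)] with z hz
    refine h0 z ?_
    rw [abs_sub_comm]
    exact le_trans (by linarith) (le_abs_self _)
  · rcases le_or_gt y P.Y with hle | hgt
    · refine hconst (c := 1) ?_
      filter_upwards [lt_mem_nhds (show -(r₀ / 4) < y by linarith),
        gt_mem_nhds (show y < P.Y + r₀ / 4 by linarith)] with z hz hz'
      exact h1 z ⟨hz.le, hz'.le⟩
    · have : P.Y + r₀ ≤ y := not_lt.1 fun h =>
        Set.eq_empty_iff_forall_notMem.1 P.gap_right y ⟨⟨hgt, h⟩, hy⟩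
      refine hconst (c := 0) ?_
      filter_upwards [lt_mem_nhds (show P.Y + 3 * r₀ / 4 < y by linarith)] with z hz
      exact h0 z (le_trans (by linarith) (le_abs_self _))

lemma exists_ballCutoff {N : ℕ} (hN : 0 < N) :
    ∃ η : Euc N → ℝ, ContDiff ℝ (⊤ : ℕ∞) η ∧ HasCompactSupport η ∧ tsupport η ⊆ Omg N ∧
      (∀ x, |η x| ≤ 1) ∧ ∀ x ∈ unitCube N, η =ᶠ[𝓝 x] fun _ => 1 := by
  have hs : 0 < Real.sqrt N := Real.sqrt_pos.2 (by exact_mod_cast hN)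
  let b : ContDiffBump (0 : Euc N) :=
    ⟨2 / 3 * Real.sqrt N, 5 / 6 * Real.sqrt N, by positivity, by nlinarith⟩
  refine ⟨b, b.contDiff, b.hasCompactSupport, ?_, fun x => ?_, fun x hx => ?_⟩
  · rw [b.tsupport_eq]
    exact Metric.closedBall_subset_ball (by simp only [b]; linarith)
  · rw [abs_of_nonneg b.nonneg]
    exact b.le_one
  · refine b.eventuallyEq_one_of_mem_ball ?_
    rw [mem_ball_zero_iff]
    have := norm_le_of_mem_unitCube hx
    simp only [b]
    linarith

end cutoffs

/-- Theorem B (0-form case), non-density `H ≠ W` for the borderline double phase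
integrand `Φ(x,t) = φ₀(t) + a(x) ψ₀(t)`. -/
theorem statement3 (N : ℕ) (hN : 2 ≤ N) (p₀ α β ϰ : ℝ) (hp₀ : 1 < p₀)
    (hϰ : 0 ≤ ϰ) (hαβ : p₀ + ϰ < α + β)
    (φ₀ ψ₀ : ℝ → ℝ) (hφ₀ : IsOrlicz φ₀) (hψ₀ : IsOrlicz ψ₀)
    (c₁ c₂ T : ℝ) (hc₁ : 0 < c₁) (hc₁₂ : c₁ ≤ c₂) (hT : Real.exp 1 ≤ T)
    (hφ₀bd : ∀ t, T ≤ t →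
      c₁ * t ^ p₀ * Real.log t ^ (-β) ≤ φ₀ t ∧ φ₀ t ≤ c₂ * t ^ p₀ * Real.log t ^ (-β))
    (hψ₀bd : ∀ t, T ≤ t →
      c₁ * t ^ p₀ * Real.log t ^ α ≤ ψ₀ t ∧ ψ₀ t ≤ c₂ * t ^ p₀ * Real.log t ^ α) :
    ∃ (a : Euc N → ℝ) (S : Set (Euc N)) (w : Euc N → ℝ) (g : Euc N → Euc N),
      -- the weight: nonnegative, bounded, with logarithmic modulus of continuity
      (∀ x, 0 ≤ a x) ∧ (∃ M : ℝ, ∀ x, a x ≤ M) ∧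
      (∃ L : ℝ, 0 < L ∧ ∀ x y : Euc N, 0 < dist x y → dist x y ≤ 1 / 2 →
        |a x - a y| ≤ L * Real.log (1 / dist x y) ^ (-ϰ)) ∧
      -- the singular set
      IsCompact S ∧ S ⊆ Omg N ∧ volume S = 0 ∧
      -- the function w with weak gradient g, of finite energy
      (∃ M : ℝ, ∀ x, |w x| ≤ M) ∧ ContDiffOn ℝ (⊤ : ℕ∞) w (Omg N \ S) ∧
      HasWeakGradOn N w g ∧
      IntegrableOn (fun x => φ₀ ‖g x‖ + a x * ψ₀ ‖g x‖) (Omg N) ∧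
      -- non-approximability by smooth functions with energy convergence
      ¬ ∃ φ : ℕ → Euc N → ℝ,
          (∀ j, ContDiffOn ℝ (⊤ : ℕ∞) (φ j) (Omg N)) ∧
          (∀ j, (∫⁻ x in Omg N,
              ENNReal.ofReal (φ₀ ‖gradient (φ j) x‖ + a x * ψ₀ ‖gradient (φ j) x‖)) < ⊤) ∧
          Tendsto (fun j => ∫⁻ x in Omg N, ENNReal.ofReal |φ j x - w x|) atTop (𝓝 0) ∧
          (∀ lam : ℝ, 0 < lam →
            Tendsto (fun j => ∫⁻ x in Omg N,
                ENNReal.ofReal (φ₀ (lam * ‖gradient (φ j) x - g x‖)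
                  + a x * ψ₀ (lam * ‖gradient (φ j) x - g x‖)))
              atTop (𝓝 0)) := by
  obtain ⟨r₀, q₁, q₂, P₁, P₂, hr, hr', hq₁, hq₂, hsum, ht⟩ := exists_scales hp₀ hϰ hαβ hφ₀ hψ₀ hc₁
    (hc₁.trans_le hc₁₂) (fun t h => (hφ₀bd t h).2) fun t h => (hψ₀bd t h).1
  obtain ⟨b₀, h₀, hb₀⟩ := exists_centredCutoff
  obtain ⟨b₁, h₁, hb₁, hb₁'⟩ := P₂.exists_adaptedCutoff hr hr'
  obtain ⟨η, hη, hηc, hηΩ, hη1, hηone⟩ := exists_ballCutoff (N := N) (by omega)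
  set i : Fin N := ⟨0, by omega⟩
  set j : Fin N := ⟨1, by omega⟩
  have hij : i ≠ j := by simp [i, j]
  have hX : 0 < Real.sqrt N := Real.sqrt_pos.2 (by exact_mod_cast (by omega : 0 < N))
  have hΩX : ∀ x ∈ Omg N, ∀ k, |x k| ≤ Real.sqrt N := fun x hx k =>
    (abs_coord_le_norm x k).trans (mem_ball_zero_iff.1 hx).le
  have hΩv : volume (Omg N) < ⊤ := measure_ball_lt_top
  have hΩo : IsOpen (Omg N) := Metric.isOpen_ball
  have hcube : unitCube N ⊆ Omg N := fun x hx => mem_ball_zero_iff.2 <|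
    (norm_le_of_mem_unitCube hx).trans_lt (by linarith)
  set a := distWeight ϰ P₁.C P₂.C i j
  set w := localMix P₁ P₂ i j η
  have ha0 : ∀ x, 0 ≤ a x := distWeight_nonneg hϰ P₁.C P₂.C i j
  have ha1 : ∀ x, a x ≤ 1 := distWeight_le_one hϰ P₁.C P₂.C i j
  have hwb : ∀ x, |w x| ≤ 1 / q₂ 0 := abs_localMix_le P₁ P₂ hη1
  have hws : ∀ x ∉ singSet P₁.C P₂.C i j, ContDiffAt ℝ (⊤ : ℕ∞) w x := fun x hx =>
    contDiffAt_localMix P₁ P₂ hη hx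
  have hen := integrableOn_energy_localMix P₁ P₂ hϰ hφ₀ hψ₀ hX hr hq₁ hq₂ hij hsum hη hηc hη1
    hΩX hΩv
  have hwi := integrableOn_of_integrableOn_energy hφ₀ hψ₀ ha0 (measurable_fderiv ℝ w) hΩv hen
  refine ⟨a, singSet P₁.C P₂.C i j ∩ tsupport η, w, gradient w, ha0, ⟨1, ha1⟩,
    ⟨3, by norm_num, fun x y => abs_distWeight_sub_le hϰ P₁.C P₂.C i j⟩,
    hηc.isCompact.inter_left (isClosed_singSet P₁.closed P₂.closed),
    Set.inter_subset_right.trans hηΩ,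
    measure_mono_null Set.inter_subset_left
      (measure_eq_zero_iff_ae_notMem.2 (ae_notMem_singSet P₁.null)),
    ⟨_, hwb⟩, fun x hx => ?_, hasWeakGradOn_localMix P₁ P₂ hij hη hη1 hwi, ?_, ?_⟩
  · refine ContDiffAt.contDiffWithinAt ?_
    by_cases h : x ∈ singSet P₁.C P₂.C i j
    · exact contDiffAt_localMix_of_notMem_tsupport P₁ P₂ fun h' => hx.2 ⟨h, h'⟩
    · exact hws x h
  · simpa only [norm_gradient_eq] using hen
  rintro ⟨f, hf, -, hfw, hfm⟩
  simp only [norm_gradient_sub] at hfm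
  obtain ⟨H, hH, hHi, hyoung⟩ := exists_young_remainder_energy P₁ P₂ hϰ hφ₀ hψ₀ hX hr hq₁ hq₂ hij
    ht hΩo.measurableSet hΩX
  have hvi := integrableOn_of_young hψ₀ ha1 (measurable_fderiv ℝ _) hΩv hHi hyoung
  have hcut : ∀ k y, 1 / 2 < |y| → cubeCutoff j b₀ b₁ k y = 0 := fun k y hy =>
    (isCutoff_cubeCutoff h₀ h₁ k).eq_zero y hy.le
  refine integral_mul_flux_ne_zero P₁ P₂ hij hr hq₁ (hq₂ 0) h₀ h₁ hb₀ (by positivity) hb₁ hcube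
    hvi (fun x hx => (hηone x hx).self_of_nhds) ?_
  refine integral_eq_zero_of_approx hij.symm P₂.closed P₁.closed P₂.null P₁.null
    (fun x hx => contDiffAt_stairMix P₁ j i P₂.isClosedUnbdd hx) (abs_stairMix_le P₁ j i P₂.C)
    hΩo hvi (contDiff_tensor fun k => (isCutoff_cubeCutoff h₀ h₁ k).contDiff)
    (hasCompactSupport_tensor hcut) ((tsupport_tensor_subset hcut).trans hcube)
    (abs_tensor_cubeCutoff_le h₀ h₁) (fderiv_mul_fderiv_cutoff_eq_zero P₁ P₂ hij h₀ h₁ hb₀)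
    (continuous_flux P₁ P₂ h₀ h₁ hb₁')
    (aestronglyMeasurable_of_smooth_off P₁.closed P₂.closed P₁.null hws) hwb ?_ hH hHi hyoung
    hf hfw hfm
  filter_upwards [ae_coord_notMem P₂.null j] with x hx hζ hv
  exact fderiv_localMix_eq_zero P₁ P₂ hr hq₁
    (hηone x (tsupport_tensor_subset hcut (subset_tsupport _ hζ))) hx hv

end
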